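/- Let Ω ⊂⊂ ℂⁿ be a pseudoconvex domain with smooth boundary, ρ a defining function of Ω, and Σ_∞ the set of infinite type boundary points of Ω. Write N := N_ρ; for each (1,0) tangent vector field L on ∂Ω, extended to U so that Lρ = 0 on U, set Σ_{∞,L} := {p ∈ Σ_∞ : L_ρ(L,L)(p) = 0}, and define η_ρ as the infimum of all η₂ ∈ (1,∞) such that for every such L the inequality (1/(η₂−1))·|L_ρ(L,N)|²/‖∇ρ‖² − (1/2)·(N L_ρ(L,L))/‖∇ρ‖ ≤ 0 holds at every point of Σ_{∞,L} (η_ρ := ∞ if no such η₂ exists). Then S(Ω) equals the infimum of η_ρ over all smooth defining functions ρ of Ω. -/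

import Mathlib

noncomputable section

open Complex Topology
open scoped ENNReal

/-- Wirtinger derivative `∂f/∂z_j`. -/
def dz {n : ℕ} (j : Fin n) (f : (Fin n → ℂ) → ℂ) (z : Fin n → ℂ) : ℂ :=
  (fderiv ℝ f z (Pi.single j 1) - Complex.I * fderiv ℝ f z (Pi.single j Complex.I)) / 2

/-- Wirtinger derivative `∂f/∂z̄_j`. -/
def dzbar {n : ℕ} (j : Fin n) (f : (Fin n → ℂ) → ℂ) (z : Fin n → ℂ) : ℂ :=
  (fderiv ℝ f z (Pi.single j 1) + Complex.I * fderiv ℝ f z (Pi.single j Complex.I)) / 2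

/-- Complexification of a real-valued function. -/
def cplx {n : ℕ} (ρ : (Fin n → ℂ) → ℝ) : (Fin n → ℂ) → ℂ := fun z => (ρ z : ℂ)

/-- The Levi form `L_ρ(X,Y)(z) = Σ_{j,k} ∂²ρ/∂z_j∂z̄_k (z) X_j conj(Y_k)`. -/
def levi {n : ℕ} (ρ : (Fin n → ℂ) → ℝ) (X Y : Fin n → ℂ) (z : Fin n → ℂ) : ℂ :=
  ∑ j, ∑ k, dz j (fun w => dzbar k (cplx ρ) w) z * X j * (starRingEnd ℂ) (Y k)

/-- `Xf = Σ_j X_j ∂f/∂z_j` for a (1,0) vector `X`. -/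
def dirDeriv {n : ℕ} (X : Fin n → ℂ) (f : (Fin n → ℂ) → ℂ) (z : Fin n → ℂ) : ℂ :=
  ∑ j, X j * dz j f z

/-- `X̄f = Σ_j conj(X_j) ∂f/∂z̄_j`. -/
def dirDerivBar {n : ℕ} (X : Fin n → ℂ) (f : (Fin n → ℂ) → ℂ) (z : Fin n → ℂ) : ℂ :=
  ∑ j, (starRingEnd ℂ) (X j) * dzbar j f z

/-- Derivative of `f` along the (1,0) vector field `X`. -/
def fieldDeriv {n : ℕ} (X : (Fin n → ℂ) → (Fin n → ℂ)) (f : (Fin n → ℂ) → ℂ)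
    (z : Fin n → ℂ) : ℂ :=
  dirDeriv (X z) f z

/-- Euclidean norm of the real gradient of `ρ`. -/
def gradNorm {n : ℕ} (ρ : (Fin n → ℂ) → ℝ) (z : Fin n → ℂ) : ℝ :=
  Real.sqrt (∑ j, ((fderiv ℝ ρ z (Pi.single j 1)) ^ 2 +
    (fderiv ℝ ρ z (Pi.single j Complex.I)) ^ 2))

/-- The complex normal field `N_ρ`. -/
def nfield {n : ℕ} (ρ : (Fin n → ℂ) → ℝ) (z : Fin n → ℂ) : Fin n → ℂ := fun j =>
  ((Real.sqrt (∑ k, Complex.normSq (dz k (cplx ρ) z)) : ℝ) : ℂ)⁻¹ * dzbar j (cplx ρ) z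

/-- Squared Euclidean norm of a vector in ℂⁿ. -/
def enormSq {n : ℕ} (X : Fin n → ℂ) : ℝ := ∑ j, Complex.normSq (X j)

/-- `f` is strictly plurisubharmonic on `S`. -/
def StrictPSHOn {n : ℕ} (f : (Fin n → ℂ) → ℝ) (S : Set (Fin n → ℂ)) : Prop :=
  ∀ z ∈ S, ∀ X : Fin n → ℂ, X ≠ 0 → 0 < (levi f X X z).re

/-- `ρ` is a (global smooth) defining function of `Ω` on the neighborhood `V` of `cl Ω`. -/
structure IsDefFn {n : ℕ} (Ω V : Set (Fin n → ℂ)) (ρ : (Fin n → ℂ) → ℝ) : Prop where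
  isOpen : IsOpen V
  subset : closure Ω ⊆ V
  smooth : ContDiffOn ℝ (⊤ : ℕ∞) ρ V
  eq : Ω = {z ∈ V | ρ z < 0}
  grad_ne : ∀ z ∈ frontier Ω, fderiv ℝ ρ z ≠ 0

/-- The Levi form of `ρ` is positive semidefinite on complex tangent vectors at `z`. -/
def LeviPseudoconvexAt {n : ℕ} (ρ : (Fin n → ℂ) → ℝ) (z : Fin n → ℂ) : Prop :=
  ∀ X : Fin n → ℂ, dirDeriv X (cplx ρ) z = 0 → 0 ≤ (levi ρ X X z).re

/-- `Ω` is a (smoothly bounded, Levi) pseudoconvex domain. -/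
def IsPseudoconvex {n : ℕ} (Ω : Set (Fin n → ℂ)) : Prop :=
  ∃ (V : Set (Fin n → ℂ)) (ρ : (Fin n → ℂ) → ℝ), IsDefFn Ω V ρ ∧
    ∀ p ∈ frontier Ω, LeviPseudoconvexAt ρ p

/-- The set of Steinness exponents of `ρ`. -/
def steinExpSet {n : ℕ} (Ω : Set (Fin n → ℂ)) (ρ : (Fin n → ℂ) → ℝ) : Set ℝ :=
  {η : ℝ | 1 < η ∧ ∃ W : Set (Fin n → ℂ), IsOpen W ∧ frontier Ω ⊆ W ∧
    StrictPSHOn (fun z => ρ z ^ η) ((closure Ω)ᶜ ∩ W)}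

/-- The Steinness exponent `η̃_ρ` of a defining function `ρ` (`∞` if none exists). -/
def steinExp {n : ℕ} (Ω : Set (Fin n → ℂ)) (ρ : (Fin n → ℂ) → ℝ) : ℝ≥0∞ :=
  sInf (ENNReal.ofReal '' steinExpSet Ω ρ)

/-- The Steinness index `S(Ω)`. -/
def steinIndex {n : ℕ} (Ω : Set (Fin n → ℂ)) : ℝ≥0∞ :=
  ⨅ (V : Set (Fin n → ℂ)) (ρ : (Fin n → ℂ) → ℝ) (_ : IsDefFn Ω V ρ), steinExp Ω ρ

/-- The set of Diederich–Fornæss exponents of `ρ`. -/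
def dfExpSet {n : ℕ} (Ω : Set (Fin n → ℂ)) (ρ : (Fin n → ℂ) → ℝ) : Set ℝ :=
  {η : ℝ | 0 < η ∧ η < 1 ∧ StrictPSHOn (fun z => -((-ρ z) ^ η)) Ω}

/-- The Diederich–Fornæss exponent of `ρ` (`0` if no exponent exists). -/
def dfExp {n : ℕ} (Ω : Set (Fin n → ℂ)) (ρ : (Fin n → ℂ) → ℝ) : ℝ :=
  sSup (insert 0 (dfExpSet Ω ρ))

/-- The Diederich–Fornæss index `DF(Ω)`. -/
def dfIndex {n : ℕ} (Ω : Set (Fin n → ℂ)) : ℝ :=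
  sSup {t : ℝ | ∃ V ρ, IsDefFn Ω V ρ ∧ t = dfExp Ω ρ}

/-- `L` is a smooth (1,0) tangent vector field for `ρ` on `A`. -/
def IsTangentField {n : ℕ} (ρ : (Fin n → ℂ) → ℝ) (L : (Fin n → ℂ) → (Fin n → ℂ))
    (A : Set (Fin n → ℂ)) : Prop :=
  ContDiffOn ℝ (⊤ : ℕ∞) L A ∧ ∀ z ∈ A, dirDeriv (L z) (cplx ρ) z = 0

/-- The key differential inequality
`(1/(η₂−1))|L_ρ(L,N)|²/‖∇ρ‖² − (1/2)(N L_ρ(L,L))/‖∇ρ‖ ≤ 0` at `p`. -/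
def keyIneqAt {n : ℕ} (ρ : (Fin n → ℂ) → ℝ) (L : (Fin n → ℂ) → (Fin n → ℂ)) (η₂ : ℝ)
    (p : Fin n → ℂ) : Prop :=
  1 / (η₂ - 1) * Complex.normSq (levi ρ (L p) (nfield ρ p) p) / (gradNorm ρ p) ^ 2 -
    1 / 2 * (fieldDeriv (nfield ρ) (fun w => levi ρ (L w) (L w) w) p).re / gradNorm ρ p ≤ 0

/-- The strict version of the key differential inequality. -/
def strictKeyIneqAt {n : ℕ} (ρ : (Fin n → ℂ) → ℝ) (L : (Fin n → ℂ) → (Fin n → ℂ)) (η₂ : ℝ)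
    (p : Fin n → ℂ) : Prop :=
  1 / (η₂ - 1) * Complex.normSq (levi ρ (L p) (nfield ρ p) p) / (gradNorm ρ p) ^ 2 -
    1 / 2 * (fieldDeriv (nfield ρ) (fun w => levi ρ (L w) (L w) w) p).re / gradNorm ρ p < 0

/-- `cl Ω` has a strong Stein neighborhood basis. -/
def HasStrongSteinBasis {n : ℕ} (Ω : Set (Fin n → ℂ)) : Prop :=
  ∃ (V : Set (Fin n → ℂ)) (ρ : (Fin n → ℂ) → ℝ), IsDefFn Ω V ρ ∧ ∃ ε₀ : ℝ, 0 < ε₀ ∧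
    (∀ z ∈ V, 0 ≤ ρ z → ρ z < ε₀ → fderiv ℝ ρ z ≠ 0) ∧
    ∀ ε : ℝ, 0 ≤ ε → ε < ε₀ → ∀ z ∈ V, ρ z = ε → LeviPseudoconvexAt ρ z

/-- Vanishing order at `0` of a holomorphic function `ℂ → ℂ` (`∞` if all derivatives vanish). -/
def orderC (h : ℂ → ℂ) : ℕ∞ :=
  sInf ((fun k : ℕ => (k : ℕ∞)) '' {k : ℕ | iteratedDeriv k h 0 ≠ 0})

/-- Vanishing order at `0` of a real-valued function on `ℂ`. -/
def orderR (g : ℂ → ℝ) : ℕ∞ :=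
  sInf ((fun k : ℕ => (k : ℕ∞)) '' {k : ℕ | iteratedFDeriv ℝ k g 0 ≠ 0})

/-- `ν(γ)`: minimal vanishing order at `0` of the components of `γ − p`. -/
def curveOrder {n : ℕ} (γ : ℂ → Fin n → ℂ) (p : Fin n → ℂ) : ℕ∞ :=
  ⨅ j, orderC (fun t => γ t j - p j)

/-- `p` is a boundary point of finite D'Angelo 1-type (w.r.t. the defining function `ρ`). -/
def FiniteTypePt {n : ℕ} (ρ : (Fin n → ℂ) → ℝ) (p : Fin n → ℂ) : Prop :=
  ∃ M : ℕ, ∀ γ : ℂ → Fin n → ℂ, (∀ j, AnalyticAt ℂ (fun t => γ t j) 0) → γ 0 = p →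
    ¬ (∀ᶠ t in nhds (0 : ℂ), γ t = p) →
    orderR (fun t => ρ (γ t)) ≤ (M : ℕ∞) * curveOrder γ p

/-- The set of exponents `η₂ > 1` for which the key differential inequality holds on
`Σ_{∞,L}` (the infinite type points where the Levi form of `L` degenerates) for every
(1,0) tangent vector field `L`. -/
def etaRhoInfSet {n : ℕ} (Ω U : Set (Fin n → ℂ)) (ρ : (Fin n → ℂ) → ℝ) : Set ℝ :=
  {η₂ : ℝ | 1 < η₂ ∧ ∀ L : (Fin n → ℂ) → (Fin n → ℂ), IsTangentField ρ L U →
    ∀ p ∈ frontier Ω, ¬ FiniteTypePt ρ p → levi ρ (L p) (L p) p = 0 →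
      keyIneqAt ρ L η₂ p}

/-- `η_ρ` of the statement (`∞` if no admissible exponent exists). -/
def etaRhoInf {n : ℕ} (Ω U : Set (Fin n → ℂ)) (ρ : (Fin n → ℂ) → ℝ) : ℝ≥0∞ :=
  sInf (ENNReal.ofReal '' etaRhoInfSet Ω U ρ)

/-- The additive Lie-closure of two elements of a Lie ring. -/
inductive LieGen {R : Type*} [LieRing R] (a b : R) : R → Prop
  | left : LieGen a b a
  | right : LieGen a b b
  | add {x y : R} : LieGen a b x → LieGen a b y → LieGen a b (x + y)
  | lie {x y : R} : LieGen a b x → LieGen a b y → LieGen a b ⁅x, y⁆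

/-- A subset that is stable under addition, contains both generators and is stable under bracketing
with the generators contains the whole Lie closure. -/
theorem LieGen.mem_of_ad_stable {R : Type*} [LieRing R] {a b : R} (S : AddSubgroup R)
    (ha : a ∈ S) (hb : b ∈ S)
    (hada : ∀ c, LieGen a b c → c ∈ S → ⁅a, c⁆ ∈ S)
    (hadb : ∀ c, LieGen a b c → c ∈ S → ⁅b, c⁆ ∈ S) {x : R} (hx : LieGen a b x) : x ∈ S := by
  have key : ∀ z, LieGen a b z → ∀ c, LieGen a b c → c ∈ S → ⁅z, c⁆ ∈ S := by
    intro z hz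
    induction hz with
    | left => exact hada
    | right => exact hadb
    | add _ _ ih1 ih2 =>
      intro c hc hcS
      rw [add_lie]
      exact S.add_mem (ih1 c hc hcS) (ih2 c hc hcS)
    | lie h1 h2 ih1 ih2 =>
      intro c hc hcS
      rw [lie_lie]
      exact S.sub_mem (ih1 _ (LieGen.lie h2 hc) (ih2 c hc hcS))
        (ih2 _ (LieGen.lie h1 hc) (ih1 c hc hcS))
  induction hx with
  | left => exact ha
  | right => exact hb
  | add _ _ ih1 ih2 => exact S.add_mem ih1 ih2
  | lie h1 h2 ih1 ih2 => exact key _ h1 _ h2 ih2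

/-- Coefficients of a vector-valued polynomial with values in a subspace at all naturals. -/
theorem Submodule.coeff_mem_of_forall_nat {R : Type*} [AddCommGroup R] [Module ℂ R]
    (J : Submodule ℂ R) (k : ℕ) (c : ℕ → R)
    (h : ∀ t : ℕ, ∑ i ∈ Finset.range (k + 1), ((t : ℂ) ^ i) • c i ∈ J) (i : ℕ) (hi : i ≤ k) :
    c i ∈ J := by
  rw [← Submodule.Quotient.mk_eq_zero, ← Module.forall_dual_apply_eq_zero_iff ℂ]
  intro φ
  set P : Polynomial ℂ := ∑ i ∈ Finset.range (k + 1),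
    Polynomial.C (φ (Submodule.Quotient.mk (c i))) * Polynomial.X ^ i with hP
  have hP0 : P = 0 := by
    apply Polynomial.eq_zero_of_infinite_isRoot
    refine Set.Infinite.mono ?_ (Set.infinite_range_of_injective (Nat.cast_injective (R := ℂ)))
    rintro _ ⟨t, rfl⟩
    have h1 := (Submodule.Quotient.mk_eq_zero J).2 (h t)
    have h2 := congrArg φ h1
    rw [← Submodule.mkQ_apply, map_sum, map_sum, map_zero] at h2
    simp only [Set.mem_ofPred_eq, Polynomial.IsRoot.def, hP, Polynomial.eval_finsetSum,
      Polynomial.eval_mul, Polynomial.eval_C, Polynomial.eval_pow, Polynomial.eval_X]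
    rw [← h2]
    refine Finset.sum_congr rfl fun i _ => ?_
    simp [mul_comm]
  have h3 := congrArg (fun Q => Polynomial.coeff Q i) hP0
  simp only [hP, Polynomial.finsetSum_coeff, Polynomial.coeff_C_mul, Polynomial.coeff_X_pow,
    Polynomial.coeff_zero] at h3
  simpa [Nat.lt_succ_of_le hi] using h3

section Enveloping

variable {R : Type*} [Ring R] [Algebra ℂ R] (V : Set R)

/-- The span of `1` and `V`. -/
def unitSpan : Submodule ℂ R := Submodule.span ℂ (insert 1 V)

theorem one_mem_unitSpan : (1 : R) ∈ unitSpan V := Submodule.subset_span (Set.mem_insert _ _)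

variable {V}

theorem mem_unitSpan {x : R} (hx : x ∈ V) : x ∈ unitSpan V :=
  Submodule.subset_span (Set.mem_insert_of_mem _ hx)

theorem unitSpan_pow_mono {m k : ℕ} (h : m ≤ k) : unitSpan V ^ m ≤ unitSpan V ^ k := by
  induction h with
  | refl => exact le_rfl
  | step _ ih =>
    refine ih.trans ?_
    intro x hx
    rw [pow_succ]
    simpa using Submodule.mul_mem_mul hx (one_mem_unitSpan V)

theorem mul_mem_unitSpan_pow {x y : R} {i j : ℕ} (hx : x ∈ unitSpan V ^ i)
    (hy : y ∈ unitSpan V ^ j) : x * y ∈ unitSpan V ^ (i + j) := by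
  rw [pow_add]; exact Submodule.mul_mem_mul hx hy

theorem pow_mem_unitSpan_pow {x : R} (hx : x ∈ unitSpan V) (i : ℕ) : x ^ i ∈ unitSpan V ^ i :=
  Submodule.pow_mem_pow _ hx i

theorem lie_mem_unitSpan (hV : ∀ x ∈ V, ∀ y ∈ V, x * y - y * x ∈ V) {x y : R}
    (hx : x ∈ unitSpan V) (hy : y ∈ unitSpan V) : x * y - y * x ∈ unitSpan V := by
  induction hx using Submodule.span_induction with
  | mem x hx =>
    induction hy using Submodule.span_induction with
    | mem y hy =>
      rcases hx with rfl | hx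
      · simp
      rcases hy with rfl | hy
      · simp
      exact mem_unitSpan (hV x hx y hy)
    | zero => simp
    | add y z _ _ h1 h2 =>
      have : x * (y + z) - (y + z) * x = (x * y - y * x) + (x * z - z * x) := by noncomm_ring
      rw [this]; exact add_mem h1 h2
    | smul c y _ h1 =>
      have : x * (c • y) - (c • y) * x = c • (x * y - y * x) := by
        rw [mul_smul_comm, smul_mul_assoc, smul_sub]
      rw [this]; exact Submodule.smul_mem _ _ h1
  | zero => simp
  | add x z _ _ h1 h2 =>
    have : (x + z) * y - y * (x + z) = (x * y - y * x) + (z * y - y * z) := by noncomm_ring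
    rw [this]; exact add_mem h1 h2
  | smul c x _ h1 =>
    have : (c • x) * y - y * (c • x) = c • (x * y - y * x) := by
      rw [mul_smul_comm, smul_mul_assoc, smul_sub]
    rw [this]; exact Submodule.smul_mem _ _ h1

theorem lie_mem_unitSpan_pow (hV : ∀ x ∈ V, ∀ y ∈ V, x * y - y * x ∈ V) {x : R}
    (hx : x ∈ unitSpan V) (k : ℕ) {r : R} (hr : r ∈ unitSpan V ^ k) :
    x * r - r * x ∈ unitSpan V ^ k := by
  induction k generalizing r with
  | zero =>
    rw [pow_zero, Submodule.mem_one] at hr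
    obtain ⟨c, rfl⟩ := hr
    rw [← Algebra.commutes c x, sub_self]; exact Submodule.zero_mem _
  | succ k ih =>
    rw [pow_succ] at hr ⊢
    induction hr using Submodule.mul_induction_on' with
    | mem_mul_mem s hs t ht =>
      have : x * (s * t) - s * t * x = (x * s - s * x) * t + s * (x * t - t * x) := by
        noncomm_ring
      rw [this]
      exact add_mem (Submodule.mul_mem_mul (ih hs) ht)
        (Submodule.mul_mem_mul hs (lie_mem_unitSpan hV hx ht))
    | add s _ t _ h1 h2 =>
      have : x * (s + t) - (s + t) * x = (x * s - s * x) + (x * t - t * x) := by noncomm_ring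
      rw [this]; exact add_mem h1 h2

/-- Expansion of `(x + t y)^k` in powers of `t`, with the linear coefficient known modulo lower
order. -/
theorem exists_add_smul_pow_expansion (hV : ∀ x ∈ V, ∀ y ∈ V, x * y - y * x ∈ V) {x y : R}
    (hx : x ∈ unitSpan V) (hy : y ∈ unitSpan V) (k : ℕ) :
    ∃ c : ℕ → R, (∀ t : ℕ, (x + t • y) ^ (k + 1) =
        ∑ i ∈ Finset.range (k + 2), ((t : ℂ) ^ i) • c i) ∧ c 0 = x ^ (k + 1) ∧
      c 1 - ((k + 1 : ℕ) : ℂ) • (x ^ k * y) ∈ unitSpan V ^ k := by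
  induction k with
  | zero =>
    refine ⟨fun i => if i = 0 then x else y, fun t => ?_, by simp, by simp⟩
    simp [Finset.sum_range_succ, Nat.cast_smul_eq_nsmul]
  | succ k ih =>
    obtain ⟨c, h1, h2, h3⟩ := ih
    refine ⟨fun i => (if i = k + 2 then 0 else x * c i) + (if i = 0 then 0 else y * c (i - 1)),
      fun t => ?_, ?_, ?_⟩
    · rw [pow_succ', h1]
      simp only [smul_add, Finset.sum_add_distrib]
      rw [Finset.sum_range_succ (fun i => (t : ℂ) ^ i • (if i = k + 2 then 0 else x * c i)),
        Finset.sum_range_succ' (fun i => (t : ℂ) ^ i • (if i = 0 then (0 : R) else y * c (i - 1)))]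
      simp only [if_true, smul_zero, add_zero, add_mul, Nat.add_sub_cancel]
      congr 1
      · rw [Finset.mul_sum]
        refine Finset.sum_congr rfl fun i hi => ?_
        rw [if_neg (by simp at hi; omega), mul_smul_comm]
      · rw [Finset.mul_sum]
        refine Finset.sum_congr rfl fun i hi => ?_
        rw [if_neg (by omega), ← Nat.cast_smul_eq_nsmul ℂ t y, smul_mul_assoc, mul_smul_comm,
          smul_smul, pow_succ']
    · simp [h2, pow_succ' x (k + 1)]
    · have e : ((if (1 : ℕ) = k + 2 then 0 else x * c 1) + (if (1 : ℕ) = 0 then 0 else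
          y * c (1 - 1))) - ((k + 1 + 1 : ℕ) : ℂ) • (x ^ (k + 1) * y) =
          x * (c 1 - ((k + 1 : ℕ) : ℂ) • (x ^ k * y)) + (y * x ^ (k + 1) - x ^ (k + 1) * y) := by
        rw [if_neg (by omega), if_neg (by omega), Nat.sub_self, h2, mul_sub, mul_smul_comm,
          ← mul_assoc, ← pow_succ']
        push_cast
        rw [add_smul (((k : ℂ) + 1)) 1, one_smul]
        abel
      simp only [e]
      refine add_mem ?_ (lie_mem_unitSpan_pow hV hy _ (pow_mem_unitSpan_pow hx _))
      rw [pow_succ']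
      exact Submodule.mul_mem_mul hx h3

/-- Polarization: powers of elements of `V` generate all products, modulo lower order. -/
theorem unitSpan_pow_le_of_pow_mem (hV : ∀ x ∈ V, ∀ y ∈ V, x * y - y * x ∈ V)
    (hadd : ∀ x ∈ V, ∀ y ∈ V, x + y ∈ V) (hne : V.Nonempty) (J : Submodule ℂ R) (m : ℕ)
    (hlow : unitSpan V ^ m ≤ J) (hpow : ∀ x ∈ V, x ^ (m + 1) ∈ J) :
    unitSpan V ^ (m + 1) ≤ J := by
  have haddn : ∀ x ∈ V, ∀ y ∈ V, ∀ t : ℕ, x + t • y ∈ V := by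
    intro x hx y hy t
    induction t with
    | zero => simpa using hx
    | succ t ih => rw [succ_nsmul, ← add_assoc]; exact hadd _ ih _ hy
  have key : ∀ j, j ≤ m + 1 → ∀ x ∈ V, ∀ r ∈ unitSpan V ^ j, x ^ (m + 1 - j) * r ∈ J := by
    intro j
    induction j with
    | zero =>
      intro _ x hx r hr
      rw [pow_zero, Submodule.mem_one] at hr
      obtain ⟨c, rfl⟩ := hr
      rw [← Algebra.commutes, ← Algebra.smul_def]
      exact J.smul_mem _ (hpow x hx)
    | succ j ih =>
      intro hj x hx r hr
      obtain ⟨d, hd⟩ : ∃ d, m = j + d := ⟨m - j, by omega⟩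
      have e1 : m + 1 - (j + 1) = d := by omega
      have e2 : m + 1 - j = d + 1 := by omega
      rw [e1]
      rw [e2] at ih
      rw [pow_succ'] at hr
      induction hr using Submodule.mul_induction_on' with
      | add s _ t _ h1 h2 => rw [mul_add]; exact add_mem h1 h2
      | mem_mul_mem y hy r' hr' =>
        induction hy using Submodule.span_induction with
        | zero => simp
        | add y z _ _ h1 h2 => rw [add_mul, mul_add]; exact add_mem h1 h2
        | smul c y _ h1 =>
          rw [smul_mul_assoc, mul_smul_comm]; exact J.smul_mem _ h1
        | mem y hy =>
          rcases hy with rfl | hy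
          · rw [one_mul]
            apply hlow
            rw [hd, add_comm j d]
            exact mul_mem_unitSpan_pow (pow_mem_unitSpan_pow (mem_unitSpan hx) d) hr'
          · obtain ⟨c, h1, h2, h3⟩ :=
              exists_add_smul_pow_expansion hV (mem_unitSpan hx) (mem_unitSpan hy) d
            have h4 := Submodule.coeff_mem_of_forall_nat J (d + 1) (fun i => c i * r')
              (fun t => by
                have := ih (by omega) (x + t • y) (haddn x hx y hy t) r' hr'
                rw [h1, Finset.sum_mul] at this
                simpa only [smul_mul_assoc] using this) 1 (by omega)
            have h5 : (c 1 - ((d + 1 : ℕ) : ℂ) • (x ^ d * y)) * r' ∈ J := by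
              apply hlow
              rw [hd, add_comm j d]
              exact mul_mem_unitSpan_pow h3 hr'
            have h6 := J.smul_mem (((d + 1 : ℕ) : ℂ)⁻¹) (sub_mem h4 h5)
            rw [sub_mul, sub_sub_cancel, smul_mul_assoc, smul_smul, inv_mul_cancel₀
              (by exact_mod_cast Nat.succ_ne_zero d), one_smul, mul_assoc] at h6
            exact h6
  intro r hr
  obtain ⟨x, hx⟩ := hne
  simpa using key (m + 1) le_rfl x hx r hr

end Enveloping

/-- Main inductive scheme: vanishing of all words, from nullity, positivity and the two one-sided
rules for `l` and `l'`. -/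
theorem unitSpan_pow_le_comap {R A : Type*} [Ring R] [Algebra ℂ R] [AddCommGroup A] [Module ℂ A]
    (lam : R →ₗ[ℂ] A) (J : Submodule ℂ A) (l l' : R) (V : Set R)
    (hVdef : V = {x | @LieGen R LieRing.ofAssociativeRing (l + l') (Complex.I • (l - l')) x})
    (hone : lam 1 ∈ J) (hr : ∀ r, lam (r * l') = 0) (hl : ∀ r, lam r ∈ J → lam (l * r) ∈ J)
    (hlone : lam l ∈ J)
    (hnull : ∀ c ∈ V, lam c ∈ J → lam (l' * c) ∈ J ∧ lam (c * l) ∈ J)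
    (hpos : ∀ k : ℕ, unitSpan V ^ (2 * k + 1) ≤ J.comap lam →
      ∀ c ∈ V, (∀ r ∈ unitSpan V ^ (2 * k + 1), lam (r * c) ∈ J) →
        ∀ x ∈ V, lam (c * x ^ (2 * k + 1) * c) ∈ J) (k : ℕ) :
    unitSpan V ^ k ≤ J.comap lam := by
  let _ : LieRing R := LieRing.ofAssociativeRing
  have hx1 : l + l' ∈ V := by rw [hVdef]; exact LieGen.left
  have hx2 : Complex.I • (l - l') ∈ V := by rw [hVdef]; exact LieGen.right
  have hV : ∀ x ∈ V, ∀ y ∈ V, x * y - y * x ∈ V := by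
    rw [hVdef]; intro x hx y hy; rw [← Ring.lie_def]; exact LieGen.lie hx hy
  have hadd : ∀ x ∈ V, ∀ y ∈ V, x + y ∈ V := by
    rw [hVdef]; intro x hx y hy; exact LieGen.add hx hy
  have el : ∀ x1 x2 : R, x1 = l + l' → x2 = Complex.I • (l - l') →
      l = (1 / 2 : ℂ) • (x1 - Complex.I • x2) ∧ l' = (1 / 2 : ℂ) • (x1 + Complex.I • x2) := by
    rintro _ _ rfl rfl
    simp only [smul_smul, Complex.I_mul_I, smul_add, smul_sub, neg_one_smul]
    constructor
    · module
    · module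
  obtain ⟨el1, el2⟩ := el _ _ rfl rfl
  have hlU : l ∈ unitSpan V := by
    rw [el1]
    exact Submodule.smul_mem _ _ (sub_mem (mem_unitSpan hx1)
      (Submodule.smul_mem _ _ (mem_unitSpan hx2)))
  have hl'U : l' ∈ unitSpan V := by
    rw [el2]
    exact Submodule.smul_mem _ _ (add_mem (mem_unitSpan hx1)
      (Submodule.smul_mem _ _ (mem_unitSpan hx2)))
  have hl'one : lam l' = 0 := by simpa using hr 1
  -- generator-wise induction
  have gen : ∀ S : Submodule ℂ R, l ∈ S → l' ∈ S →
      (∀ c ∈ V, c ∈ S → l * c - c * l ∈ S) → (∀ c ∈ V, c ∈ S → l' * c - c * l' ∈ S) →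
      ∀ x ∈ V, x ∈ S := by
    intro S h1 h2 h3 h4 x hx
    rw [hVdef] at hx
    refine LieGen.mem_of_ad_stable S.toAddSubgroup (add_mem h1 h2)
      (S.smul_mem _ (sub_mem h1 h2)) ?_ ?_ hx
    · intro c hc hcS
      have hcV : c ∈ V := by rw [hVdef]; exact hc
      have e : ⁅l + l', c⁆ = (l * c - c * l) + (l' * c - c * l') := by
        rw [Ring.lie_def]; noncomm_ring
      rw [e]
      exact S.add_mem (h3 c hcV hcS) (h4 c hcV hcS)
    · intro c hc hcS
      have hcV : c ∈ V := by rw [hVdef]; exact hc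
      have e : ⁅Complex.I • (l - l'), c⁆ =
          Complex.I • ((l * c - c * l) - (l' * c - c * l')) := by
        rw [Ring.lie_def, smul_mul_assoc, mul_smul_comm, ← smul_sub]
        congr 1; noncomm_ring
      rw [e]
      exact S.smul_mem _ (S.sub_mem (h3 c hcV hcS) (h4 c hcV hcS))
  have comm := fun (x : R) (hx : x ∈ unitSpan V) (k : ℕ) (r : R) (h : r ∈ unitSpan V ^ k) =>
    lie_mem_unitSpan_pow hV hx k h
  induction k using Nat.strong_induction_on with
  | _ k ih =>
  rcases Nat.even_or_odd' k with ⟨m, rfl | rfl⟩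
  · rcases m with _ | m
    · intro r hr'
      rw [Nat.mul_zero, pow_zero, Submodule.mem_one] at hr'
      obtain ⟨c, rfl⟩ := hr'
      rw [Submodule.mem_comap, Algebra.algebraMap_eq_smul_one, map_smul]
      exact J.smul_mem _ hone
    -- even case
    have hlow : unitSpan V ^ (2 * m + 1) ≤ J.comap lam := ih _ (by omega)
    have hlow' : unitSpan V ^ (2 * m) ≤ J.comap lam := ih _ (by omega)
    let S : Submodule ℂ R :=
      { carrier := {c | ∀ r ∈ unitSpan V ^ (2 * m + 1), lam (r * c) ∈ J}
        add_mem' := by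
          intro a b ha hb r hr'
          rw [mul_add, map_add]; exact J.add_mem (ha r hr') (hb r hr')
        zero_mem' := by intro r _; simp
        smul_mem' := by
          intro c x hx r hr'
          rw [mul_smul_comm, map_smul]; exact J.smul_mem _ (hx r hr') }
    have hSl : l ∈ S := by
      intro r hr'
      have e : r * l = l * r - (l * r - r * l) := by abel
      rw [e, map_sub]
      exact J.sub_mem (hl r (hlow hr')) (hlow (comm l hlU _ r hr'))
    have hSl' : l' ∈ S := by
      intro r _; rw [hr]; exact J.zero_mem
    have hall : ∀ x ∈ V, x ∈ S := by
      have pol : ∀ c ∈ V, c ∈ S → ∀ x ∈ V, ∀ c' ∈ V, c' ∈ S →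
          lam (c * x ^ (2 * m + 1) * c') + lam (c' * x ^ (2 * m + 1) * c) ∈ J := by
        intro c hc hcS x hx c' hc' hcS'
        have h1 := hpos m hlow c hc hcS x hx
        have h2 := hpos m hlow c' hc' hcS' x hx
        have h3 := hpos m hlow (c + c') (hadd _ hc _ hc') (S.add_mem hcS hcS') x hx
        have e : lam (c * x ^ (2 * m + 1) * c') + lam (c' * x ^ (2 * m + 1) * c) =
            lam ((c + c') * x ^ (2 * m + 1) * (c + c')) - lam (c * x ^ (2 * m + 1) * c) -
              lam (c' * x ^ (2 * m + 1) * c') := by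
          simp only [← map_sub, ← map_add]; congr 1; noncomm_ring
        rw [e]; exact J.sub_mem (J.sub_mem h3 h1) h2
      have polS : ∀ c ∈ V, c ∈ S → ∀ x ∈ V,
          lam (c * x ^ (2 * m + 1) * l) + lam (l * x ^ (2 * m + 1) * c) ∈ J ∧
          lam (c * x ^ (2 * m + 1) * l') + lam (l' * x ^ (2 * m + 1) * c) ∈ J := by
        intro c hc hcS x hx
        have h1 := pol c hc hcS x hx _ hx1 (S.add_mem hSl hSl')
        have h2 := pol c hc hcS x hx _ hx2 (S.smul_mem _ (S.sub_mem hSl hSl'))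
        have gl : ∀ s t : R, s = l + l' → t = Complex.I • (l - l') → ∀ w : ℂ,
            lam (c * x ^ (2 * m + 1) * ((1 / 2 : ℂ) • (s + w • t))) +
            lam (((1 / 2 : ℂ) • (s + w • t)) * x ^ (2 * m + 1) * c) ∈ J := by
          rintro _ _ rfl rfl w
          have := J.smul_mem (1 / 2 : ℂ) (J.add_mem h1 (J.smul_mem w h2))
          convert this using 1
          simp only [← map_add, ← map_smul]
          congr 1
          generalize l + l' = s
          generalize Complex.I • (l - l') = t
          simp only [mul_smul_comm, smul_mul_assoc, mul_add, add_mul, smul_add]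
          abel
        refine ⟨?_, ?_⟩
        · have := gl _ _ rfl rfl (-Complex.I)
          rwa [neg_smul, ← sub_eq_add_neg, ← el1] at this
        · have := gl _ _ rfl rfl Complex.I
          rwa [← el2] at this
      have polar : ∀ b ∈ unitSpan V, (∀ x ∈ V, lam (x ^ (2 * m + 1) * b) ∈ J) → b ∈ S := by
        intro b hb hxb
        let J' : Submodule ℂ R := J.comap (lam.comp (LinearMap.mulRight ℂ b))
        have hJ' : ∀ r, r ∈ J' ↔ lam (r * b) ∈ J := fun r => Iff.rfl
        have := unitSpan_pow_le_of_pow_mem hV hadd ⟨_, hx1⟩ J' (2 * m)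
          (fun r hr' => (hJ' r).2 (hlow (by
            have := mul_mem_unitSpan_pow hr' (show b ∈ unitSpan V ^ 1 by rwa [pow_one])
            exact this)))
          (fun x hx => (hJ' _).2 (hxb x hx))
        intro r hr'
        exact (hJ' r).1 (this hr')
      refine gen S hSl hSl' ?_ ?_
      · intro c hc hcS
        refine polar _ (lie_mem_unitSpan hV hlU (mem_unitSpan hc)) fun x hx => ?_
        have hxU : x ^ (2 * m + 1) ∈ unitSpan V ^ (2 * m + 1) :=
          pow_mem_unitSpan_pow (mem_unitSpan hx) _
        have left : ∀ r ∈ unitSpan V ^ (2 * m + 1), lam (c * r) ∈ J := by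
          intro r hr'
          have e : c * r = r * c + (c * r - r * c) := by abel
          rw [e, map_add]
          exact J.add_mem (hcS r hr') (hlow (comm c (mem_unitSpan hc) _ r hr'))
        have h1 := (polS c hc hcS x hx).1
        have h2 : lam (l * x ^ (2 * m + 1) * c) ∈ J := by
          rw [mul_assoc]; exact hl _ (hcS _ hxU)
        have h3 : lam (c * x ^ (2 * m + 1) * l) ∈ J := by
          have := J.sub_mem h1 h2; rwa [add_sub_cancel_right] at this
        have h4 : lam (c * (l * x ^ (2 * m + 1) - x ^ (2 * m + 1) * l)) ∈ J :=
          left _ (comm l hlU _ _ hxU)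
        have h5 : lam (l * (c * x ^ (2 * m + 1))) ∈ J := hl _ (left _ hxU)
        have h6 : lam ((l * c - c * l) * x ^ (2 * m + 1) - x ^ (2 * m + 1) * (l * c - c * l)) ∈ J :=
          hlow (comm _ (lie_mem_unitSpan hV hlU (mem_unitSpan hc)) _ _ hxU)
        have e : lam (x ^ (2 * m + 1) * (l * c - c * l)) =
            lam (l * (c * x ^ (2 * m + 1))) -
            (lam (c * x ^ (2 * m + 1) * l) +
              lam (c * (l * x ^ (2 * m + 1) - x ^ (2 * m + 1) * l))) -
            lam ((l * c - c * l) * x ^ (2 * m + 1) - x ^ (2 * m + 1) * (l * c - c * l)) := by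
          simp only [← map_sub, ← map_add]; congr 1
          generalize x ^ (2 * m + 1) = y
          noncomm_ring
        rw [e]
        exact J.sub_mem (J.sub_mem h5 (J.add_mem h3 h4)) h6
      · intro c hc hcS
        refine polar _ (lie_mem_unitSpan hV hl'U (mem_unitSpan hc)) fun x hx => ?_
        have hxU : x ^ (2 * m + 1) ∈ unitSpan V ^ (2 * m + 1) :=
          pow_mem_unitSpan_pow (mem_unitSpan hx) _
        have h1 := (polS c hc hcS x hx).2
        rw [hr, zero_add] at h1
        have h2 : lam ((l' * x ^ (2 * m + 1) - x ^ (2 * m + 1) * l') * c) ∈ J :=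
          hcS _ (comm l' hl'U _ _ hxU)
        have e : lam (x ^ (2 * m + 1) * (l' * c - c * l')) =
            lam (l' * x ^ (2 * m + 1) * c) -
              lam ((l' * x ^ (2 * m + 1) - x ^ (2 * m + 1) * l') * c) -
              lam (x ^ (2 * m + 1) * c * l') := by
          simp only [← map_sub]; congr 1
          generalize x ^ (2 * m + 1) = y
          noncomm_ring
        rw [e, hr, sub_zero]
        exact J.sub_mem h1 h2
    intro r hr'
    have e : 2 * (m + 1) = 2 * m + 1 + 1 := by ring
    rw [e, pow_succ] at hr'
    induction hr' using Submodule.mul_induction_on' with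
    | add s _ t _ h1 h2 => exact add_mem h1 h2
    | mem_mul_mem s hs y hy =>
      induction hy using Submodule.span_induction with
      | zero => simp
      | add y z _ _ h1 h2 => rw [mul_add]; exact add_mem h1 h2
      | smul c y _ h1 => rw [mul_smul_comm]; exact Submodule.smul_mem _ _ h1
      | mem y hy =>
        rcases hy with rfl | hy
        · rw [mul_one]; exact hlow hs
        · exact hall y hy s hs
  · rcases m with _ | m
    · -- degree one
      have h0 : ∀ x ∈ V, x ∈ J.comap lam := by
        refine gen _ hlone (by rw [Submodule.mem_comap, hl'one]; exact J.zero_mem) ?_ ?_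
        · intro c hc hcS
          rw [Submodule.mem_comap, map_sub]
          exact J.sub_mem (hl c hcS) (hnull c hc hcS).2
        · intro c hc hcS
          rw [Submodule.mem_comap, map_sub, hr, sub_zero]
          exact (hnull c hc hcS).1
      rw [Nat.mul_zero, zero_add, pow_one]
      refine Submodule.span_le.2 ?_
      rintro x (rfl | hx)
      · exact hone
      · exact h0 x hx
    · have hlow : unitSpan V ^ (2 * m + 1) ≤ J.comap lam := ih _ (by omega)
      have hlow' : unitSpan V ^ (2 * m + 2) ≤ J.comap lam := ih _ (by omega)
      refine unitSpan_pow_le_of_pow_mem hV hadd ⟨_, hx1⟩ _ (2 * (m + 1)) hlow' fun x hx => ?_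
      have := hpos m hlow x hx (fun r hr' => hlow' (by
        have := mul_mem_unitSpan_pow hr' (show x ∈ unitSpan V ^ 1 by
          rw [pow_one]; exact mem_unitSpan hx)
        exact this)) x hx
      rw [Submodule.mem_comap]
      convert this using 2
      rw [← pow_succ', ← pow_succ, show 2 * (m + 1) + 1 = 2 * m + 1 + 1 + 1 by ring]

section WordCalculus

/-- All ways of splitting a word into two complementary subwords. -/
def splits {α : Type*} : List α → List (List α × List α)
  | [] => [([], [])]
  | x :: l => (splits l).map (fun p => (x :: p.1, p.2)) ++ (splits l).map (fun p => (p.1, x :: p.2))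

theorem splits_map {α β : Type*} (f : α → β) (l : List α) :
    splits (l.map f) = (splits l).map (fun p => (p.1.map f, p.2.map f)) := by
  induction l with
  | nil => rfl
  | cons x l ih => simp [splits, ih, Function.comp_def]

theorem sublist_of_mem_splits {α : Type*} (l : List α) :
    ∀ p ∈ splits l, p.1.Sublist l ∧ p.2.Sublist l := by
  induction l with
  | nil => simp [splits]
  | cons x l ih =>
    intro p hp
    simp only [splits, List.mem_append, List.mem_map] at hp
    rcases hp with ⟨q, hq, rfl⟩ | ⟨q, hq, rfl⟩
    · exact ⟨(ih q hq).1.cons_cons x, (ih q hq).2.cons x⟩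
    · exact ⟨(ih q hq).1.cons x, (ih q hq).2.cons_cons x⟩

variable {A : Type*} [CommRing A] [Algebra ℂ A]

/-- Successive application of derivations, the head of the list being applied last. -/
def wordApp (S : List (Derivation ℂ A A)) (g : A) : A := S.foldr (fun X g => X g) g

@[simp] theorem wordApp_nil (g : A) : wordApp [] g = g := rfl

@[simp] theorem wordApp_cons (X : Derivation ℂ A A) (S : List (Derivation ℂ A A)) (g : A) :
    wordApp (X :: S) g = X (wordApp S g) := rfl

theorem wordApp_append (S T : List (Derivation ℂ A A)) (g : A) :
    wordApp (S ++ T) g = wordApp S (wordApp T g) := by simp [wordApp]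

theorem wordApp_sum {κ : Type*} (S : List (Derivation ℂ A A)) (s : Finset κ) (g : κ → A) :
    wordApp S (∑ j ∈ s, g j) = ∑ j ∈ s, wordApp S (g j) := by
  induction S with
  | nil => rfl
  | cons X S ih => simp [ih]

theorem wordApp_mul (S : List (Derivation ℂ A A)) (g h : A) :
    wordApp S (g * h) =
      ((splits S).map fun p => wordApp p.1 g * wordApp p.2 h).sum := by
  induction S with
  | nil => simp [splits]
  | cons X S ih =>
    rw [wordApp_cons, ih, map_list_sum]
    simp only [splits, List.map_append, List.map_map, List.sum_append, Function.comp_def,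
      wordApp_cons, Derivation.leibniz, smul_eq_mul, ← List.sum_map_add]
    congr 2
    funext p
    ring

theorem wordApp_comm (S T : List (Derivation ℂ A A))
    (h : ∀ X ∈ S, ∀ Y ∈ T, ∀ g, X (Y g) = Y (X g)) (g : A) :
    wordApp S (wordApp T g) = wordApp T (wordApp S g) := by
  have h1 : ∀ Y : Derivation ℂ A A, (∀ X ∈ S, ∀ g, X (Y g) = Y (X g)) → ∀ g,
      wordApp S (Y g) = Y (wordApp S g) := by
    intro Y hY g
    induction S with
    | nil => rfl
    | cons X S ih =>
      rw [wordApp_cons, ih (fun X hX => h X (List.mem_cons_of_mem _ hX))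
        (fun X hX => hY X (List.mem_cons_of_mem _ hX)), wordApp_cons, hY X List.mem_cons_self]
  induction T with
  | nil => rfl
  | cons Y T ih =>
    rw [wordApp_cons, h1 Y (fun X hX => h X hX Y List.mem_cons_self), ih, wordApp_cons]
    exact fun X hX Z hZ => h X hX Z (List.mem_cons_of_mem _ hZ)

theorem wordApp_mul_of_kills (S : List (Derivation ℂ A A)) (g h : A) (hS : ∀ X ∈ S, X g = 0) :
    wordApp S (g * h) = g * wordApp S h := by
  induction S with
  | nil => rfl
  | cons X S ih =>
    rw [wordApp_cons, ih fun X hX => hS X (List.mem_cons_of_mem _ hX), Derivation.leibniz,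
      hS X List.mem_cons_self]
    simp

end WordCalculus

section Symbols

variable {A ι : Type*} [CommRing A] [Algebra ℂ A] [Fintype ι]
  (d db : ι → Derivation ℂ A A) (z zb : ι → A)

/-- The left action of a derivation on operators, corrected so that only its `(1,0)` part
survives on the identity. -/
def opA : Derivation ℂ A A →ₗ[ℂ] Module.End ℂ (Module.End ℂ A) where
  toFun X := LinearMap.mulLeft ℂ (X : Module.End ℂ A) -
    ∑ j, (LinearMap.mulLeft ℂ (LinearMap.mulLeft ℂ (X (zb j)) : Module.End ℂ A)).comp
      (LinearMap.mulRight ℂ (db j : Module.End ℂ A))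
  map_add' X Y := by
    ext T f
    simp [add_mul, Finset.sum_add_distrib, LinearMap.sum_apply]
    ring
  map_smul' c X := by
    ext T f
    simp [LinearMap.sum_apply, Finset.smul_sum, smul_sub]

theorem opA_apply (X : Derivation ℂ A A) (T : Module.End ℂ A) (f : A) :
    opA db zb X T f = X (T f) - ∑ j, X (zb j) * T (db j f) := by
  simp [opA, LinearMap.sum_apply]

theorem opA_lie (hdb : ∀ i j f, db i (db j f) = db j (db i f)) (X Y : Derivation ℂ A A) :
    opA db zb ⁅X, Y⁆ = opA db zb X * opA db zb Y - opA db zb Y * opA db zb X := by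
  ext T f
  have e : ∑ k, X (zb k) * ∑ j, Y (zb j) * T (db j (db k f)) =
      ∑ k, Y (zb k) * ∑ j, X (zb j) * T (db j (db k f)) := by
    simp only [Finset.mul_sum]
    rw [Finset.sum_comm]
    refine Finset.sum_congr rfl fun k _ => Finset.sum_congr rfl fun j _ => ?_
    rw [hdb]; ring
  simp only [LinearMap.sub_apply, Module.End.mul_apply, opA_apply, map_sub, map_sum,
    Derivation.leibniz, smul_eq_mul, Derivation.commutator_apply, sub_mul, mul_sub,
    Finset.sum_sub_distrib, Finset.sum_add_distrib, e]
  have e2 : ∀ X Y : Derivation ℂ A A, ∑ j, T (db j f) * X (Y (zb j)) =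
      ∑ j, X (Y (zb j)) * T (db j f) := fun X Y => Finset.sum_congr rfl fun _ _ => mul_comm _ _
  rw [e2, e2]
  ring

/-- `X` is given by the first order operator with the coefficients `X z_j`, `X z̄_j`. -/
def HasCoeffs (X : Derivation ℂ A A) : Prop :=
  ∀ f, X f = ∑ j, X (z j) * d j f + ∑ j, X (zb j) * db j f

variable {d db z zb}

theorem HasCoeffs.add {X Y : Derivation ℂ A A} (hX : HasCoeffs d db z zb X)
    (hY : HasCoeffs d db z zb Y) : HasCoeffs d db z zb (X + Y) := by
  intro f
  rw [Derivation.add_apply, hX f, hY f]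
  simp only [Derivation.add_apply, add_mul, Finset.sum_add_distrib]
  ring

theorem HasCoeffs.lie (hdd : ∀ i j f, d i (d j f) = d j (d i f))
    (hdb : ∀ i j f, db i (db j f) = db j (db i f))
    (hddb : ∀ i j f, d i (db j f) = db j (d i f)) {X Y : Derivation ℂ A A}
    (hX : HasCoeffs d db z zb X)
    (hY : HasCoeffs d db z zb Y) : HasCoeffs d db z zb ⁅X, Y⁆ := by
  intro f
  have h1 : ∀ {X Y : Derivation ℂ A A}, HasCoeffs d db z zb X → HasCoeffs d db z zb Y →
      X (Y f) = ∑ j, X (Y (z j)) * d j f + ∑ j, X (Y (zb j)) * db j f +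
      (∑ j, ∑ k, Y (z j) * X (z k) * d k (d j f) + ∑ j, ∑ k, Y (z j) * X (zb k) * db k (d j f) +
      ∑ j, ∑ k, Y (zb j) * X (z k) * d k (db j f) +
      ∑ j, ∑ k, Y (zb j) * X (zb k) * db k (db j f)) := by
    intro X Y hX hY
    conv_lhs => rw [hY f]
    simp only [map_add, map_sum, Derivation.leibniz, smul_eq_mul, hX (d _ f), hX (db _ f),
      Finset.sum_add_distrib, mul_add, Finset.mul_sum, mul_assoc, mul_comm (d _ f),
      mul_comm (db _ f)]
    ring
  rw [Derivation.commutator_apply, h1 hX hY, h1 hY hX]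
  simp only [Derivation.commutator_apply, sub_mul, Finset.sum_sub_distrib]
  have e1 : ∑ j, ∑ k, Y (z j) * X (z k) * d k (d j f) =
      ∑ j, ∑ k, X (z j) * Y (z k) * d k (d j f) := by
    rw [Finset.sum_comm]
    refine Finset.sum_congr rfl fun k _ => Finset.sum_congr rfl fun j _ => ?_
    rw [hdd]; ring
  have e2 : ∑ j, ∑ k, Y (zb j) * X (zb k) * db k (db j f) =
      ∑ j, ∑ k, X (zb j) * Y (zb k) * db k (db j f) := by
    rw [Finset.sum_comm]
    refine Finset.sum_congr rfl fun k _ => Finset.sum_congr rfl fun j _ => ?_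
    rw [hdb]; ring
  have e3 : ∀ X Y : Derivation ℂ A A, ∑ j, ∑ k, Y (z j) * X (zb k) * db k (d j f) =
      ∑ j, ∑ k, X (zb j) * Y (z k) * d k (db j f) := by
    intro X Y
    rw [Finset.sum_comm]
    refine Finset.sum_congr rfl fun k _ => Finset.sum_congr rfl fun j _ => ?_
    rw [hddb]; ring
  rw [e1, e2, e3 X Y, ← e3 Y X]
  ring

variable (db zb)

/-- The mixed symbols: the values that the mixed derivatives of `f` along a formal holomorphic
map take when its jets are prescribed by words in vector fields. -/
def sig (f : A) : List (Derivation ℂ A A) → List (Derivation ℂ A A) → A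
  | D, [] => ((D.map (opA db zb)).prod 1) f
  | D, Y :: D' => Y (sig f D D') - sig f (Y :: D) D'

variable {db zb}

theorem sig_nil (f : A) (D : List (Derivation ℂ A A)) :
    sig db zb f D [] = ((D.map (opA db zb)).prod 1) f := rfl

theorem sig_cons (f : A) (D D' : List (Derivation ℂ A A)) (Y : Derivation ℂ A A) :
    sig db zb f D (Y :: D') = Y (sig db zb f D D') - sig db zb f (Y :: D) D' := rfl

/-- The operator `f ↦ g * T (∂_j f)`. -/
def twist (D : Derivation ℂ A A) (g : A) (T : Module.End ℂ A) : Module.End ℂ A :=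
  LinearMap.mulLeft ℂ g * T * (D : Module.End ℂ A)

theorem twist_apply (D : Derivation ℂ A A) (g : A) (T : Module.End ℂ A) (f : A) :
    twist D g T f = g * T (D f) := rfl

theorem opA_twist (hddb : ∀ i j f, d i (db j f) = db j (d i f)) (Y : Derivation ℂ A A)
    (j : ι) (g : A) (T : Module.End ℂ A) :
    opA db zb Y (twist (d j) g T) =
      twist (d j) (Y g) T + twist (d j) g (opA db zb Y T) := by
  ext f
  simp only [opA_apply, twist_apply, LinearMap.add_apply, Derivation.leibniz, smul_eq_mul, hddb,
    mul_sub, Finset.mul_sum]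
  have : ∑ i, Y (zb i) * (g * T (db i (d j f))) = ∑ i, g * (Y (zb i) * T (db i (d j f))) :=
    Finset.sum_congr rfl fun _ _ => by ring
  rw [this]
  ring

theorem opA_prod_twist (hddb : ∀ i j f, d i (db j f) = db j (d i f))
    (w : List (Derivation ℂ A A)) (j : ι) (g : A) :
    (w.map (opA db zb)).prod (twist (d j) g 1) =
      ((splits w).map fun p => twist (d j) (wordApp p.1 g)
        ((p.2.map (opA db zb)).prod 1)).sum := by
  induction w with
  | nil => simp [splits]
  | cons Y w ih =>
    rw [List.map_cons, List.prod_cons, Module.End.mul_apply, ih, map_list_sum]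
    simp only [splits, List.map_append, List.map_map, List.sum_append, Function.comp_def,
      wordApp_cons, opA_twist hddb, ← List.sum_map_add, List.map_cons, List.prod_cons,
      Module.End.mul_apply]

theorem list_sum_apply {κ : Type*} (l : List κ) (F : κ → Module.End ℂ A) (f : A) :
    (l.map F).sum f = (l.map fun x => F x f).sum := by
  induction l with
  | nil => rfl
  | cons x l ih => simp [ih]

/-- Leibniz rule for the mixed symbols with respect to the innermost holomorphic direction. -/
theorem sig_append_left (hddb : ∀ i j f, d i (db j f) = db j (d i f))
    (Z : Derivation ℂ A A) (hZ : HasCoeffs d db z zb Z) (D' : List (Derivation ℂ A A)) :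
    ∀ (w : List (Derivation ℂ A A)) (f : A), sig db zb f (w ++ [Z]) D' =
      ∑ j, ((splits w).map fun p => wordApp p.1 (Z (z j)) * sig db zb (d j f) p.2 D').sum := by
  induction D' with
  | nil =>
    intro w f
    have h1 : opA db zb Z 1 = ∑ j, twist (d j) (Z (z j)) 1 := by
      ext f
      rw [opA_apply]
      simp only [LinearMap.sum_apply, twist_apply, Module.End.one_apply]
      rw [hZ f]; ring
    rw [sig_nil, List.map_append, List.prod_append, List.map_singleton, List.prod_singleton,
      Module.End.mul_apply, h1, map_sum, LinearMap.sum_apply]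
    refine Finset.sum_congr rfl fun j _ => ?_
    rw [opA_prod_twist hddb, list_sum_apply]
    rfl
  | cons Y D' ih =>
    intro w f
    have h2 := ih (Y :: w) f
    rw [List.cons_append] at h2
    rw [sig_cons, ih w f, h2, map_sum, ← Finset.sum_sub_distrib]
    refine Finset.sum_congr rfl fun j _ => ?_
    rw [map_list_sum]
    simp only [splits, List.map_append, List.map_map, List.sum_append, Function.comp_def,
      wordApp_cons, Derivation.leibniz, smul_eq_mul, sig_cons, mul_sub]
    rw [sub_eq_iff_eq_add, ← List.sum_map_add, ← List.sum_map_add]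
    congr 2
    funext p
    ring

/-- Leibniz rule for the mixed symbols with respect to the innermost antiholomorphic
direction. -/
theorem sig_append_right (Z : Derivation ℂ A A) : ∀ (w D : List (Derivation ℂ A A)) (f : A),
    sig db zb f D (w ++ [Z]) =
      ∑ j, ((splits w).map fun p => wordApp p.1 (Z (zb j)) * sig db zb (db j f) D p.2).sum := by
  intro w
  induction w with
  | nil =>
    intro D f
    simp [sig_cons, sig_nil, splits, opA_apply]
  | cons Y w ih =>
    intro D f
    rw [List.cons_append, sig_cons, ih, ih, map_sum, ← Finset.sum_sub_distrib]
    refine Finset.sum_congr rfl fun j _ => ?_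
    rw [map_list_sum]
    simp only [splits, List.map_append, List.map_map, List.sum_append, Function.comp_def,
      wordApp_cons, Derivation.leibniz, smul_eq_mul, sig_cons, mul_sub]
    rw [sub_eq_iff_eq_add, ← List.sum_map_add, ← List.sum_map_add]
    congr 2
    funext p
    ring

/-- The mixed symbols compute the mixed derivatives of pull-backs under a holomorphic map whose
jets are given by words in vector fields. -/
theorem eval_wordApp_pullback {B κ : Type*} [CommRing B] [Algebra ℂ B]
    (hddb : ∀ i j f, d i (db j f) = db j (d i f))
    (d' db' : κ → Derivation ℂ B B)
    (hddb' : ∀ i j f, d' i (db' j f) = db' j (d' i f))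
    (Γ : A → B) (γ γb : ι → B)
    (hΓd : ∀ i f, d' i (Γ f) = ∑ j, d' i (γ j) * Γ (d j f))
    (hΓdb : ∀ i f, db' i (Γ f) = ∑ j, db' i (γb j) * Γ (db j f))
    (hγ : ∀ i j k, db' i (d' k (γ j)) = 0)
    (ev : B →ₐ[ℂ] ℂ) (evA : A →ₐ[ℂ] ℂ) (hev : ∀ f, ev (Γ f) = evA f)
    (X : κ → Derivation ℂ A A) (hX : ∀ i, HasCoeffs d db z zb (X i))
    (Good : List κ → Prop) (hGood : ∀ u v, Good u → v.Sublist u → Good v)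
    (hjet : ∀ w i j, Good (w ++ [i]) →
      ev (wordApp (w.map d') (d' i (γ j))) = evA (wordApp (w.map X) (X i (z j))))
    (hjetb : ∀ w i j, Good (w ++ [i]) →
      ev (wordApp (w.map db') (db' i (γb j))) = evA (wordApp (w.map X) (X i (zb j))))
    (u u' : List κ) (hu : Good u) (hu' : Good u') (f : A) :
    ev (wordApp (u.map d') (wordApp (u'.map db') (Γ f))) =
      evA (sig db zb f (u.map X) (u'.map X)) := by
  induction hN : u.length + u'.length using Nat.strong_induction_on generalizing u u' f with
  | _ N ih =>
  rcases List.eq_nil_or_concat u with rfl | ⟨w, i, rfl⟩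
  · rcases List.eq_nil_or_concat u' with rfl | ⟨w, i, rfl⟩
    · simp [sig_nil, hev]
    · simp only [List.map_nil, wordApp_nil, List.map_append, List.map_singleton, wordApp_append,
        wordApp_cons, hΓdb, wordApp_sum, wordApp_mul, sig_append_right, splits_map,
        List.map_map, map_sum, map_list_sum, Function.comp_def, map_mul, List.concat_eq_append]
      refine Finset.sum_congr rfl fun j _ => ?_
      congr 1
      refine List.map_congr_left fun p hp => ?_
      obtain ⟨s1, s2⟩ := sublist_of_mem_splits _ p hp
      rw [hjetb _ _ _ (hGood _ _ hu' (by
        rw [List.concat_eq_append]; exact s1.append_right [i]))]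
      have h2 := ih (p.2.length) (by
        rw [← hN]; simp only [List.concat_eq_append, List.length_append]
        have := s2.length_le; simp; omega) [] p.2 hu
        (hGood _ _ hu' (by
          rw [List.concat_eq_append]; exact s2.trans (List.sublist_append_left _ _))) (db j f)
        (by simp)
      simp only [List.map_nil, wordApp_nil] at h2
      rw [h2]
  · have hcomm : ∀ g, d' i (wordApp (u'.map db') g) = wordApp (u'.map db') (d' i g) := by
      intro g
      have := wordApp_comm [d' i] (u'.map db') (by
        intro X hX Y hY g
        obtain ⟨k, _, rfl⟩ := List.mem_map.1 hY
        rw [List.mem_singleton.1 hX, hddb']) g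
      simpa using this
    have hk : ∀ j g, wordApp (u'.map db') (d' i (γ j) * g) =
        d' i (γ j) * wordApp (u'.map db') g := fun j g =>
      wordApp_mul_of_kills _ _ _ fun X hX => by
        obtain ⟨k, _, rfl⟩ := List.mem_map.1 hX
        exact hγ _ _ _
    simp only [List.map_append, List.map_singleton, wordApp_append,
        wordApp_cons, wordApp_nil, hcomm, hΓd, wordApp_sum, hk, wordApp_mul,
        sig_append_left hddb (X i) (hX i), splits_map,
        List.map_map, map_sum, map_list_sum, Function.comp_def, map_mul, List.concat_eq_append]
    refine Finset.sum_congr rfl fun j _ => ?_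
    congr 1
    refine List.map_congr_left fun p hp => ?_
    obtain ⟨s1, s2⟩ := sublist_of_mem_splits _ p hp
    rw [hjet _ _ _ (hGood _ _ hu (by
      rw [List.concat_eq_append]; exact s1.append_right [i]))]
    rw [ih (p.2.length + u'.length) (by
      rw [← hN]; simp only [List.concat_eq_append, List.length_append]
      have := s2.length_le; simp; omega) p.2 u' (hGood _ _ hu (by
          rw [List.concat_eq_append]; exact s2.trans (List.sublist_append_left _ _))) hu' (d j f)
        rfl]

end Symbols

section SmoothAlgebra

variable {n m : ℕ}

/-- The subalgebra of smooth complex-valued functions on `ℂⁿ`. -/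
def smoothSubalg (n : ℕ) : Subalgebra ℂ ((Fin n → ℂ) → ℂ) where
  carrier := {f | ContDiff ℝ (⊤ : ℕ∞) f}
  mul_mem' {f g} hf hg := by
    rw [Set.mem_ofPred_eq] at *; exact ContDiff.mul hf hg
  add_mem' {f g} hf hg := by
    rw [Set.mem_ofPred_eq] at *; exact ContDiff.add hf hg
  algebraMap_mem' c := by
    rw [Set.mem_ofPred_eq]; exact (contDiff_const : ContDiff ℝ _ fun _ : Fin n → ℂ => c)

theorem mem_smoothSubalg {f : (Fin n → ℂ) → ℂ} : f ∈ smoothSubalg n ↔ ContDiff ℝ (⊤ : ℕ∞) f := by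
  change f ∈ {f | ContDiff ℝ (⊤ : ℕ∞) f} ↔ _
  rw [Set.mem_ofPred_eq]

/-- The algebra of smooth complex-valued functions on `ℂⁿ`. -/
def smoothAlg (n : ℕ) : Type := smoothSubalg n

instance : CommRing (smoothAlg n) := inferInstanceAs (CommRing (smoothSubalg n))

instance : Algebra ℂ (smoothAlg n) := inferInstanceAs (Algebra ℂ (smoothSubalg n))

/-- The element of the algebra given by a smooth function. -/
def smoothAlg.mk (f : (Fin n → ℂ) → ℂ) (hf : ContDiff ℝ (⊤ : ℕ∞) f) : smoothAlg n :=
  Subtype.mk f (mem_smoothSubalg.2 hf)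

theorem smoothAlg.contDiff (f : smoothAlg n) : ContDiff ℝ (⊤ : ℕ∞) f.1 := mem_smoothSubalg.1 f.2

theorem smoothAlg.differentiable (f : smoothAlg n) : Differentiable ℝ f.1 :=
  (smoothAlg.contDiff f).differentiable (by simp)

theorem smoothAlg.ext {f g : smoothAlg n} (h : ∀ z, f.1 z = g.1 z) : f = g :=
  Subtype.ext (funext h)

@[simp] theorem smoothAlg.add_val (f g : smoothAlg n) (z : Fin n → ℂ) :
    (f + g).1 z = f.1 z + g.1 z := rfl

@[simp] theorem smoothAlg.sub_val (f g : smoothAlg n) (z : Fin n → ℂ) :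
    (f - g).1 z = f.1 z - g.1 z := rfl

@[simp] theorem smoothAlg.mul_val (f g : smoothAlg n) (z : Fin n → ℂ) :
    (f * g).1 z = f.1 z * g.1 z := rfl

@[simp] theorem smoothAlg.smul_val (c : ℂ) (f : smoothAlg n) (z : Fin n → ℂ) :
    (c • f).1 z = c * f.1 z := rfl

@[simp] theorem smoothAlg.zero_val (z : Fin n → ℂ) : (0 : smoothAlg n).1 z = 0 := rfl

@[simp] theorem smoothAlg.one_val (z : Fin n → ℂ) : (1 : smoothAlg n).1 z = 1 := rfl

/-- Evaluation at a point. -/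
def smoothAlg.ev (p : Fin n → ℂ) : smoothAlg n →ₐ[ℂ] ℂ :=
  (Pi.evalAlgHom ℂ (fun _ : Fin n → ℂ => ℂ) p).comp (smoothSubalg n).val

@[simp] theorem smoothAlg.ev_apply (p : Fin n → ℂ) (f : smoothAlg n) : smoothAlg.ev p f = f.1 p :=
  rfl

@[simp] theorem smoothAlg.sum_val {κ : Type*} (s : Finset κ) (f : κ → smoothAlg n)
    (z : Fin n → ℂ) : (∑ j ∈ s, f j).1 z = ∑ j ∈ s, (f j).1 z := by
  exact map_sum (smoothAlg.ev z) f s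

/-- Complex conjugation on smooth functions. -/
def cj (f : smoothAlg n) : smoothAlg n :=
  smoothAlg.mk (fun z => (starRingEnd ℂ) (f.1 z))
    (Complex.conjCLE.contDiff.comp (smoothAlg.contDiff f))

@[simp] theorem cj_val (f : smoothAlg n) (z : Fin n → ℂ) :
    (cj f).1 z = (starRingEnd ℂ) (f.1 z) := rfl

/-- The derivation given by differentiation in a fixed real direction. -/
def dirDer (v : Fin n → ℂ) : Derivation ℂ (smoothAlg n) (smoothAlg n) :=
  Derivation.mk'
    { toFun := fun f => smoothAlg.mk (fun z => fderiv ℝ f.1 z v)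
        (((smoothAlg.contDiff f).fderiv_right (m := (⊤ : ℕ∞)) (by simp)).clm_apply contDiff_const)
      map_add' := fun f g => smoothAlg.ext fun z => by
        change fderiv ℝ (f.1 + g.1) z v = _
        rw [fderiv_add ((smoothAlg.differentiable f) z) ((smoothAlg.differentiable g) z)]; rfl
      map_smul' := fun c f => smoothAlg.ext fun z => by
        change fderiv ℝ (c • f.1) z v = _
        rw [fderiv_const_smul ((smoothAlg.differentiable f) z)]; rfl }
    fun f g => smoothAlg.ext fun z => by
      change fderiv ℝ (f.1 * g.1) z v = f.1 z * fderiv ℝ g.1 z v + g.1 z * fderiv ℝ f.1 z v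
      rw [fderiv_mul ((smoothAlg.differentiable f) z) ((smoothAlg.differentiable g) z)]; rfl

@[simp] theorem dirDer_val (v : Fin n → ℂ) (f : smoothAlg n) (z : Fin n → ℂ) :
    (dirDer v f).1 z = fderiv ℝ f.1 z v := rfl

theorem dirDer_comm (v w : Fin n → ℂ) (f : smoothAlg n) :
    dirDer v (dirDer w f) = dirDer w (dirDer v f) := by
  have key : ∀ v w z, fderiv ℝ (fun y => fderiv ℝ f.1 y w) z v =
      fderiv ℝ (fderiv ℝ f.1) z v w := by
    intro v w z
    have h := ((smoothAlg.contDiff f).fderiv_right (m := (⊤ : ℕ∞)) (by simp)).differentiable (by simp) z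
    rw [fderiv_clm_apply h (differentiableAt_const w)]
    simp
  apply smoothAlg.ext
  intro z
  change fderiv ℝ (fun y => fderiv ℝ f.1 y w) z v = fderiv ℝ (fun y => fderiv ℝ f.1 y v) z w
  rw [key, key]
  exact ((smoothAlg.contDiff f).contDiffAt.isSymmSndFDerivAt (by
    simp [minSmoothness_of_isRCLikeNormedField]; exact WithTop.coe_le_coe.2 le_top)) v w

theorem dirDer_cj (v : Fin n → ℂ) (f : smoothAlg n) : dirDer v (cj f) = cj (dirDer v f) := by
  apply smoothAlg.ext
  intro z
  change fderiv ℝ (fun y => Complex.conjCLE (f.1 y)) z v = _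
  have h := (Complex.conjCLE.toContinuousLinearMap.hasFDerivAt (x := f.1 z)).comp z
    (smoothAlg.differentiable f z).hasFDerivAt
  exact congrArg (fun T => T v) h.fderiv

/-- The coordinate functions. -/
def zCoord (j : Fin n) : smoothAlg n :=
  smoothAlg.mk (fun z => z j) (contDiff_apply ℝ ℂ j)

@[simp] theorem zCoord_val (j : Fin n) (z : Fin n → ℂ) : (zCoord j).1 z = z j := rfl

/-- The derivation `∂/∂z_j`. -/
def dDer (j : Fin n) : Derivation ℂ (smoothAlg n) (smoothAlg n) :=
  (1 / 2 : ℂ) • (dirDer (Pi.single j 1) - Complex.I • dirDer (Pi.single j Complex.I))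

/-- The derivation `∂/∂z̄_j`. -/
def dbDer (j : Fin n) : Derivation ℂ (smoothAlg n) (smoothAlg n) :=
  (1 / 2 : ℂ) • (dirDer (Pi.single j 1) + Complex.I • dirDer (Pi.single j Complex.I))

theorem dDer_val (j : Fin n) (f : smoothAlg n) (z : Fin n → ℂ) : (dDer j f).1 z = dz j f.1 z := by
  simp [dDer, dz]; ring

theorem dbDer_val (j : Fin n) (f : smoothAlg n) (z : Fin n → ℂ) :
    (dbDer j f).1 z = dzbar j f.1 z := by
  simp [dbDer, dzbar]; ring

theorem dDer_dDer (i j : Fin n) (f : smoothAlg n) : dDer i (dDer j f) = dDer j (dDer i f) := by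
  simp only [dDer, Derivation.smul_apply, Derivation.sub_apply, Derivation.map_smul, Derivation.map_sub,
    dirDer_comm (Pi.single i _)]
  module

theorem dbDer_dbDer (i j : Fin n) (f : smoothAlg n) :
    dbDer i (dbDer j f) = dbDer j (dbDer i f) := by
  simp only [dbDer, Derivation.smul_apply, Derivation.add_apply, Derivation.map_smul, Derivation.map_add,
    dirDer_comm (Pi.single i _)]
  module

theorem dDer_dbDer (i j : Fin n) (f : smoothAlg n) : dDer i (dbDer j f) = dbDer j (dDer i f) := by
  simp only [dDer, dbDer, Derivation.smul_apply, Derivation.sub_apply, Derivation.add_apply,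
    Derivation.map_smul, Derivation.map_add, Derivation.map_sub, dirDer_comm (Pi.single i _)]
  module

theorem cj_add (f g : smoothAlg n) : cj (f + g) = (cj f) + (cj g) :=
  smoothAlg.ext fun z => by simp

theorem cj_sub (f g : smoothAlg n) : cj (f - g) = (cj f) - (cj g) :=
  smoothAlg.ext fun z => by simp

theorem cj_mul (f g : smoothAlg n) : cj (f * g) = (cj f) * (cj g) :=
  smoothAlg.ext fun z => by simp

theorem cj_smul (c : ℂ) (f : smoothAlg n) : cj (c • f) = (starRingEnd ℂ) c • (cj f) :=
  smoothAlg.ext fun z => by simp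

theorem cj_cj (f : smoothAlg n) : cj (cj f) = f :=
  smoothAlg.ext fun z => by simp

theorem cj_sum {κ : Type*} (s : Finset κ) (f : κ → smoothAlg n) :
    cj (∑ j ∈ s, f j) = ∑ j ∈ s, cj (f j) :=
  smoothAlg.ext fun z => by simp

theorem dbDer_cj (j : Fin n) (f : smoothAlg n) : dbDer j (cj f) = cj (dDer j f) := by
  simp [dDer, dbDer, dirDer_cj, cj_smul, cj_sub, Complex.conj_ofNat]

theorem dDer_cj (j : Fin n) (f : smoothAlg n) : dDer j (cj f) = cj (dbDer j f) := by
  rw [← cj_cj (dDer j (cj f)), ← dbDer_cj, cj_cj f]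

theorem dirDer_zCoord (v : Fin n → ℂ) (j : Fin n) : dirDer v (zCoord j) = v j • 1 := by
  apply smoothAlg.ext
  intro z
  have : HasFDerivAt (fun z : Fin n → ℂ => z j)
    (ContinuousLinearMap.proj (R := ℝ) (φ := fun _ : Fin n => ℂ) j) z := hasFDerivAt_apply j z
  change fderiv ℝ (fun z : Fin n → ℂ => z j) z v = _
  rw [this.fderiv]; simp

theorem dDer_zCoord (i j : Fin n) : dDer i (zCoord j) = if i = j then 1 else 0 := by
  simp only [dDer, Derivation.smul_apply, Derivation.sub_apply, dirDer_zCoord, Pi.single_apply,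
    eq_comm (a := j)]
  split_ifs
  · rw [smul_smul, Complex.I_mul_I]; module
  · simp

theorem dbDer_zCoord (i j : Fin n) : dbDer i (zCoord j) = 0 := by
  simp only [dbDer, Derivation.smul_apply, Derivation.add_apply, dirDer_zCoord, Pi.single_apply]
  split_ifs
  · rw [smul_smul, Complex.I_mul_I]; module
  · simp

theorem dbDer_cj_zCoord (i j : Fin n) : dbDer i (cj (zCoord j)) = if i = j then 1 else 0 := by
  rw [dbDer_cj, dDer_zCoord]
  split_ifs <;> exact smoothAlg.ext fun z => by simp

theorem dDer_cj_zCoord (i j : Fin n) : dDer i (cj (zCoord j)) = 0 := by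
  rw [dDer_cj, dbDer_zCoord]
  exact smoothAlg.ext fun z => by simp

theorem fderiv_eq_sum_dz {f : (Fin n → ℂ) → ℂ} (z v : Fin n → ℂ) :
    fderiv ℝ f z v = ∑ j, v j * dz j f z + ∑ j, (starRingEnd ℂ) (v j) * dzbar j f z := by
  have hv : v = ∑ j, ((v j).re • (Pi.single j 1 : Fin n → ℂ) +
      (v j).im • (Pi.single j Complex.I : Fin n → ℂ)) := by
    funext k
    simp only [Finset.sum_apply, Pi.add_apply, Pi.smul_apply, Pi.single_apply]
    rw [Finset.sum_eq_single k]
    · simp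
    · intro b _ hb; simp [hb.symm]
    · simp
  conv_lhs => rw [hv]
  rw [map_sum, ← Finset.sum_add_distrib]
  refine Finset.sum_congr rfl fun j _ => ?_
  rw [map_add, map_smul, map_smul, dz, dzbar, Complex.real_smul, Complex.real_smul]
  have h1 := Complex.re_add_im (v j)
  generalize fderiv ℝ f z (Pi.single j 1) = a
  generalize fderiv ℝ f z (Pi.single j Complex.I) = b
  have h2 : (starRingEnd ℂ) (v j) = (v j).re - (v j).im * Complex.I := by
    exact Complex.ext (by simp) (by simp)
  rw [h2]
  nth_rewrite 3 [← h1]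
  linear_combination ((v j).im * b) * Complex.I_sq

/-- Pull-back of smooth functions under a smooth map. -/
def pullb (γ : Fin n → smoothAlg m) (f : smoothAlg n) : smoothAlg m :=
  smoothAlg.mk (fun ζ => f.1 fun j => (γ j).1 ζ)
    ((smoothAlg.contDiff f).comp (contDiff_pi.2 fun j => (smoothAlg.contDiff (γ j))))

@[simp] theorem pullb_val (γ : Fin n → smoothAlg m) (f : smoothAlg n) (ζ : Fin m → ℂ) :
    (pullb γ f).1 ζ = f.1 fun j => (γ j).1 ζ := rfl

theorem dirDer_pullb (γ : Fin n → smoothAlg m) (f : smoothAlg n) (v : Fin m → ℂ) :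
    dirDer v (pullb γ f) = ∑ j, dirDer v (γ j) * pullb γ (dDer j f) +
      ∑ j, dirDer v (cj (γ j)) * pullb γ (dbDer j f) := by
  apply smoothAlg.ext
  intro ζ
  have h1 : HasFDerivAt (fun ζ => fun j => (γ j).1 ζ)
      (ContinuousLinearMap.pi fun j => fderiv ℝ (γ j).1 ζ) ζ :=
    hasFDerivAt_pi.2 fun j => ((smoothAlg.differentiable (γ j)) ζ).hasFDerivAt
  have h2 := (((smoothAlg.differentiable f) (fun j => (γ j).1 ζ)).hasFDerivAt).comp ζ h1
  have h3 : (dirDer v (pullb γ f)).1 ζ =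
      fderiv ℝ f.1 (fun j => (γ j).1 ζ) (fun j => fderiv ℝ (γ j).1 ζ v) := by
    change fderiv ℝ (f.1 ∘ fun ζ => fun j => (γ j).1 ζ) ζ v = _
    rw [h2.fderiv]; rfl
  rw [h3, fderiv_eq_sum_dz]
  simp [dDer_val, dbDer_val, dirDer_cj]

theorem dDer_pullb (γ : Fin n → smoothAlg m) (hγ : ∀ i j, dbDer i (γ j) = 0) (f : smoothAlg n)
    (i : Fin m) : dDer i (pullb γ f) = ∑ j, dDer i (γ j) * pullb γ (dDer j f) := by
  have h0 : ∀ j, dDer i (cj (γ j)) = 0 := fun j => by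
    rw [dDer_cj, hγ]; exact smoothAlg.ext fun z => by simp
  have : dDer i (pullb γ f) = ∑ j, dDer i (γ j) * pullb γ (dDer j f) +
      ∑ j, dDer i (cj (γ j)) * pullb γ (dbDer j f) := by
    simp only [dDer, Derivation.smul_apply, Derivation.sub_apply, dirDer_pullb, smul_mul_assoc,
      sub_mul, Finset.sum_sub_distrib, Finset.smul_sum, smul_sub, smul_add]
    abel
  rw [this]
  simp [h0]

theorem dbDer_pullb (γ : Fin n → smoothAlg m) (hγ : ∀ i j, dbDer i (γ j) = 0) (f : smoothAlg n)
    (i : Fin m) : dbDer i (pullb γ f) = ∑ j, dbDer i (cj (γ j)) * pullb γ (dbDer j f) := by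
  have : dbDer i (pullb γ f) = ∑ j, dbDer i (γ j) * pullb γ (dDer j f) +
      ∑ j, dbDer i (cj (γ j)) * pullb γ (dbDer j f) := by
    simp only [dbDer, Derivation.smul_apply, Derivation.add_apply, dirDer_pullb, smul_mul_assoc,
      add_mul, Finset.sum_add_distrib, Finset.smul_sum, smul_add]
    abel
  rw [this]
  simp [hγ]

end SmoothAlgebra

section Taylor

theorem norm_le_of_deriv_le {f f' : ℝ → ℂ} (hf : ∀ t, HasDerivAt f (f' t) t) (h0 : f 0 = 0)
    {C : ℝ} {m : ℕ} (hC : 0 ≤ C) (hb : ∀ t, |t| ≤ 1 → ‖f' t‖ ≤ C * |t| ^ m) {t : ℝ}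
    (ht : |t| ≤ 1) : ‖f t‖ ≤ C * |t| ^ (m + 1) := by
  have hs : ∀ s ∈ Set.uIcc 0 t, |s| ≤ |t| := by
    intro s hs
    rcases Set.mem_uIcc.1 hs with h | h
    · rw [abs_of_nonneg h.1, abs_of_nonneg (h.1.trans h.2)]; exact h.2
    · rw [abs_of_nonpos h.2, abs_of_nonpos (h.1.trans h.2)]; linarith [h.1]
  have := Convex.norm_image_sub_le_of_norm_hasDerivWithin_le (f := f) (f' := f')
    (s := Set.uIcc 0 t) (x := 0) (y := t) (C := C * |t| ^ m)
    (fun x _ => (hf x).hasDerivWithinAt)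
    (fun x hx => (hb x ((hs x hx).trans ht)).trans 
      (mul_le_mul_of_nonneg_left (pow_le_pow_left₀ (abs_nonneg _) (hs x hx) m) hC))
    (convex_uIcc 0 t) Set.left_mem_uIcc Set.right_mem_uIcc
  rw [h0, sub_zero, sub_zero, Real.norm_eq_abs] at this
  rw [pow_succ, ← mul_assoc]; exact this

/-- Taylor expansion of order `e` along a chain of derivatives. -/
theorem exists_taylor_bound (e : ℕ) : ∀ (f : ℕ → ℝ → ℂ)
    (_ : ∀ k t, HasDerivAt (f k) (f (k + 1) t) t) (_ : ∀ k < e, f k 0 = 0),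
    ∃ C, 0 ≤ C ∧ ∀ t : ℝ, |t| ≤ 1 →
      ‖f 0 t - f e 0 * (t : ℂ) ^ e / (e.factorial : ℂ)‖ ≤ C * |t| ^ (e + 1) := by
  induction e with
  | zero =>
    intro f hf _
    have hc : ContinuousOn (f 1) (Set.Icc (-1) 1) :=
      fun t _ => (hf 1 t).continuousAt.continuousWithinAt
    obtain ⟨C, hC⟩ := isCompact_Icc.exists_bound_of_continuousOn hc
    refine ⟨|C|, abs_nonneg _, fun t ht => ?_⟩
    have := norm_le_of_deriv_le (f := fun t => f 0 t - f 0 0) (f' := f 1) (C := |C|) (m := 0)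
      (fun t => (hf 0 t).sub_const _) (by simp) (abs_nonneg _)
      (fun t ht => by
        simpa using (hC t (abs_le.1 ht)).trans (le_abs_self C)) ht
    simpa using this
  | succ e ih =>
    intro f hf h0
    obtain ⟨C, hC, hb⟩ := ih (fun k => f (k + 1)) (fun k t => hf (k + 1) t)
      (fun k hk => h0 (k + 1) (by omega))
    refine ⟨C, hC, fun t ht => ?_⟩
    refine norm_le_of_deriv_le (f := fun t => f 0 t - f (e + 1) 0 * (t : ℂ) ^ (e + 1) /
      ((e + 1).factorial : ℂ)) (f' := fun t => f 1 t - f (e + 1) 0 * (t : ℂ) ^ e /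
      (e.factorial : ℂ)) ?_ ?_ hC hb ht
    · intro t
      refine (hf 0 t).sub ?_
      have h1 : HasDerivAt (fun t : ℝ => (t : ℂ) ^ (e + 1)) (((e + 1 : ℕ) : ℂ) * (t : ℂ) ^ e) t := by
        have := (hasDerivAt_pow (e + 1) (t : ℂ)).comp_ofReal
        simpa using this
      have h2 := (h1.const_mul (f (e + 1) 0)).div_const ((e + 1).factorial : ℂ)
      refine h2.congr_deriv ?_
      have : ((e + 1 : ℕ) : ℂ) ≠ 0 := Nat.cast_ne_zero.2 (by omega)
      have h3 : (e.factorial : ℂ) ≠ 0 := Nat.cast_ne_zero.2 (Nat.factorial_ne_zero e)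
      rw [Nat.factorial_succ]
      push_cast at this ⊢
      field_simp
    · simp [h0 0 (by omega)]

/-- A real function whose leading Taylor coefficient has odd order and which is almost nonnegative
has vanishing leading coefficient. -/
theorem leading_coeff_eq_zero {e : ℕ} (he : Odd e) {f : ℕ → ℝ → ℂ}
    (hf : ∀ k t, HasDerivAt (f k) (f (k + 1) t) t) (h0 : ∀ k < e, f k 0 = 0)
    (him : ∀ t, (f 0 t).im = 0) {C : ℝ}
    (hlow : ∀ᶠ t in 𝓝 (0 : ℝ), -C * |t| ^ (e + 1) ≤ (f 0 t).re) : f e 0 = 0 := by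
  obtain ⟨C', hC', hb⟩ := exists_taylor_bound e f hf h0
  set κ := f e 0
  have hfac : (0 : ℝ) < e.factorial := by positivity
  have hexp : ∀ t : ℝ, κ * (t : ℂ) ^ e / (e.factorial : ℂ) =
      ((t ^ e / e.factorial : ℝ) : ℂ) * κ := by intro t; push_cast; ring
  have key : ∀ A : ℝ, ∀ D : ℝ, (∀ᶠ t in 𝓝[>] (0 : ℝ), A * t ^ e ≤ D * t ^ (e + 1)) → A ≤ 0 := by
    intro A D h
    have h1 : ∀ᶠ t in 𝓝[>] (0 : ℝ), A ≤ D * t := by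
      filter_upwards [h, self_mem_nhdsWithin] with t ht ht0
      have : 0 < t ^ e := pow_pos ht0 e
      rw [pow_succ, ← mul_assoc, mul_right_comm] at ht
      exact le_of_mul_le_mul_right ht this
    have h2 : Filter.Tendsto (fun t : ℝ => D * t) (𝓝[>] 0) (𝓝 (D * 0)) :=
      ((continuous_const.mul continuous_id).tendsto 0).mono_left nhdsWithin_le_nhds
    rw [mul_zero] at h2
    exact ge_of_tendsto h2 h1
  have hsmall : ∀ᶠ t in 𝓝[>] (0 : ℝ), |t| ≤ 1 := by
    filter_upwards [Ioc_mem_nhdsGT (zero_lt_one' ℝ)] with t ht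
    rw [abs_of_pos ht.1]; exact ht.2
  have hneg : Filter.Tendsto (fun t : ℝ => -t) (𝓝[>] 0) (𝓝 0) := by
    have : Filter.Tendsto (fun t : ℝ => -t) (𝓝 0) (𝓝 (-0)) := continuous_neg.tendsto 0
    rw [neg_zero] at this
    exact this.mono_left nhdsWithin_le_nhds
  have hre : κ.re = 0 := by
    have hp : -κ.re ≤ 0 := by
      refine key _ ((C + C') * e.factorial) ?_
      filter_upwards [hsmall, nhdsWithin_le_nhds hlow, self_mem_nhdsWithin] with t ht h1 ht0
      have h2 := (Complex.abs_re_le_norm _).trans (hb t ht)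
      rw [hexp, Complex.sub_re, Complex.re_ofReal_mul] at h2
      rw [abs_of_pos (show (0:ℝ) < t from ht0)] at h1 h2
      have h3 := (abs_le.1 h2).2
      have h4 : -(t ^ e / e.factorial * κ.re) ≤ (C + C') * t ^ (e + 1) := by linarith
      have h5 := mul_le_mul_of_nonneg_right h4 hfac.le
      have h6 : -(t ^ e / e.factorial * κ.re) * e.factorial = -κ.re * t ^ e := by field_simp
      rw [h6] at h5; linarith
    have hn : κ.re ≤ 0 := by
      refine key _ ((C + C') * e.factorial) ?_
      filter_upwards [hsmall, hneg.eventually hlow, self_mem_nhdsWithin] with t ht h1 ht0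
      have h2 := (Complex.abs_re_le_norm _).trans (hb (-t) (by rwa [abs_neg]))
      rw [hexp, Complex.sub_re, Complex.re_ofReal_mul, he.neg_pow] at h2
      rw [abs_neg, abs_of_pos (show (0:ℝ) < t from ht0)] at h1 h2
      have h3 := (abs_le.1 h2).2
      have h4 : (t ^ e / e.factorial * κ.re) ≤ (C + C') * t ^ (e + 1) := by
        have : -t ^ e / (e.factorial : ℝ) * κ.re = -(t ^ e / e.factorial * κ.re) := by ring
        linarith
      have h5 := mul_le_mul_of_nonneg_right h4 hfac.le
      have h6 : (t ^ e / e.factorial * κ.re) * e.factorial = κ.re * t ^ e := by field_simp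
      rw [h6] at h5; linarith
    linarith
  have himk : κ.im = 0 := by
    have : ∀ s : ℝ, |s| = 1 → s * κ.im ≤ 0 := by
      intro s hs
      refine key _ (C' * e.factorial) ?_
      filter_upwards [hsmall, self_mem_nhdsWithin] with t ht ht0
      have h2 := (Complex.abs_im_le_norm _).trans (hb t ht)
      rw [hexp, Complex.sub_im, him, Complex.im_ofReal_mul, zero_sub, abs_neg] at h2
      rw [abs_of_pos (show (0:ℝ) < t from ht0)] at h2
      have h3 : s * (t ^ e / e.factorial * κ.im) ≤ C' * t ^ (e + 1) := by
        refine (le_abs_self _).trans ?_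
        rwa [abs_mul, hs, one_mul]
      have h5 := mul_le_mul_of_nonneg_right h3 hfac.le
      have h6 : s * (t ^ e / e.factorial * κ.im) * e.factorial = s * κ.im * t ^ e := by field_simp
      rw [h6] at h5; linarith
    have h1 := this 1 (by simp)
    have h2 := this (-1) (by simp)
    linarith
  exact Complex.ext hre himk

end Taylor

section Jets

variable {n m : ℕ}

/-- Polynomial in the first coordinate of `ℂ²` with prescribed derivatives at the origin. -/
def jetPoly (c : ℕ → ℂ) (N : ℕ) : smoothAlg 2 :=
  ∑ a ∈ Finset.range (N + 1), (c a / (a.factorial : ℂ)) • (zCoord 0) ^ a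

theorem jetPoly_val (c : ℕ → ℂ) (N : ℕ) (x : Fin 2 → ℂ) :
    (jetPoly c N).1 x = ∑ a ∈ Finset.range (N + 1), c a / (a.factorial : ℂ) * x 0 ^ a := by
  rw [jetPoly, smoothAlg.sum_val]; rfl

theorem jetPoly_zero (c : ℕ → ℂ) (N : ℕ) : (jetPoly c N).1 0 = c 0 := by
  rw [jetPoly_val, Finset.sum_range_succ', Finset.sum_eq_zero]
  · simp
  · intro a _; simp

theorem der_pow_zCoord (D : Derivation ℂ (smoothAlg 2) (smoothAlg 2)) (a : ℕ) :
    D ((zCoord 0) ^ a) = (a : ℂ) • ((zCoord 0) ^ (a - 1) * D (zCoord 0)) := by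
  rw [Derivation.leibniz_pow, ← Nat.cast_smul_eq_nsmul ℂ]; rfl

theorem dDer_jetPoly_succ (c : ℕ → ℂ) (N : ℕ) :
    dDer 0 (jetPoly c (N + 1)) = jetPoly (fun a => c (a + 1)) N := by
  rw [jetPoly, Finset.sum_range_succ', map_add, map_sum, jetPoly]
  rw [Derivation.map_smul, der_pow_zCoord]
  simp only [Nat.cast_zero, zero_smul, smul_zero, add_zero]
  refine Finset.sum_congr rfl fun a _ => ?_
  rw [Derivation.map_smul, der_pow_zCoord, dDer_zCoord, smul_smul]
  simp only [if_true, mul_one, Nat.add_sub_cancel]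
  congr 1
  rw [Nat.factorial_succ]
  have h1 : (a.factorial : ℂ) ≠ 0 := Nat.cast_ne_zero.2 (Nat.factorial_ne_zero a)
  have h2 : ((a : ℂ) + 1) ≠ 0 := by exact_mod_cast Nat.succ_ne_zero a
  push_cast
  field_simp

theorem der_jetPoly_eq_zero (D : Derivation ℂ (smoothAlg 2) (smoothAlg 2))
    (hD : D (zCoord 0) = 0) (c : ℕ → ℂ) (N : ℕ) : D (jetPoly c N) = 0 := by
  rw [jetPoly, map_sum]
  refine Finset.sum_eq_zero fun a _ => ?_
  rw [Derivation.map_smul, der_pow_zCoord, hD]; simp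

theorem dbDer_jetPoly (i : Fin 2) (c : ℕ → ℂ) (N : ℕ) : dbDer i (jetPoly c N) = 0 :=
  der_jetPoly_eq_zero _ (dbDer_zCoord _ _) c N

theorem dDer_one_jetPoly (c : ℕ → ℂ) (N : ℕ) : dDer 1 (jetPoly c N) = 0 :=
  der_jetPoly_eq_zero _ (by rw [dDer_zCoord]; simp) c N

theorem eval_wordApp_jetPoly (a : ℕ) : ∀ (c : ℕ → ℂ) (N : ℕ), a ≤ N →
    (wordApp (List.replicate a (dDer 0)) (jetPoly c N)).1 0 = c a := by
  induction a with
  | zero => intro c N _; simp [jetPoly_zero]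
  | succ a ih =>
    intro c N h
    obtain ⟨N, rfl⟩ : ∃ M, N = M + 1 := ⟨N - 1, by omega⟩
    rw [List.replicate_succ', wordApp_append, wordApp_cons, wordApp_nil, dDer_jetPoly_succ,
      ih _ N (by omega)]

theorem dirDer_eq (j : Fin n) (v : ℂ) :
    dirDer (Pi.single j v) = v • dDer j + (starRingEnd ℂ) v • dbDer j := by
  apply Derivation.ext
  intro f
  apply smoothAlg.ext
  intro z
  rw [dirDer_val, fderiv_eq_sum_dz, Finset.sum_eq_single j, Finset.sum_eq_single j]
  · simp [dDer_val, dbDer_val]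
  · intro b _ hb; simp [hb]
  · simp
  · intro b _ hb; simp [hb]
  · simp

/-- Mixed derivatives in the first coordinate at the origin. -/
def mixDer (a b : ℕ) (g : smoothAlg 2) : ℂ :=
  (wordApp (List.replicate a (dDer 0)) (wordApp (List.replicate b (dbDer 0)) g)).1 0

/-- Smooth functions all of whose mixed derivatives in the first coordinate up to order `m`
vanish at the origin. -/
def FlatAt (m : ℕ) (g : smoothAlg 2) : Prop :=
  ∀ a b, a + b ≤ m → mixDer a b g = 0

theorem wordApp_add_arg (S : List (Derivation ℂ (smoothAlg n) (smoothAlg n)))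
    (f g : smoothAlg n) : wordApp S (f + g) = wordApp S f + wordApp S g := by
  induction S with
  | nil => rfl
  | cons X S ih => rw [wordApp_cons, ih, map_add]; rfl

theorem wordApp_smul_arg (S : List (Derivation ℂ (smoothAlg n) (smoothAlg n)))
    (c : ℂ) (f : smoothAlg n) : wordApp S (c • f) = c • wordApp S f := by
  induction S with
  | nil => rfl
  | cons X S ih => rw [wordApp_cons, ih, Derivation.map_smul]; rfl

theorem wordApp_replicate_dbDer_dDer (b : ℕ) (i j : Fin n) (g : smoothAlg n) :
    wordApp (List.replicate b (dbDer i)) (dDer j g) =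
      dDer j (wordApp (List.replicate b (dbDer i)) g) := by
  induction b with
  | zero => rfl
  | succ b ih => rw [List.replicate_succ, wordApp_cons, ih, wordApp_cons, dDer_dbDer]

theorem wordApp_replicate_succ (b : ℕ) (D : Derivation ℂ (smoothAlg n) (smoothAlg n))
    (g : smoothAlg n) :
    wordApp (List.replicate b D) (D g) = wordApp (List.replicate (b + 1) D) g := by
  rw [List.replicate_succ', wordApp_append]; rfl

theorem mixDer_dirDer (v : ℂ) (a b : ℕ) (g : smoothAlg 2) :
    mixDer a b (dirDer (Pi.single 0 v) g) =
      v * mixDer (a + 1) b g + (starRingEnd ℂ) v * mixDer a (b + 1) g := by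
  have h : dirDer (Pi.single 0 v) g = v • dDer 0 g + (starRingEnd ℂ) v • dbDer 0 g := by
    rw [dirDer_eq]; rfl
  rw [mixDer, h, wordApp_add_arg, wordApp_add_arg, wordApp_smul_arg, wordApp_smul_arg,
    wordApp_smul_arg, wordApp_smul_arg, wordApp_replicate_dbDer_dDer, wordApp_replicate_succ,
    wordApp_replicate_succ]
  rfl

theorem FlatAt.dirDer {m : ℕ} {g : smoothAlg 2} (h : FlatAt (m + 1) g) (v : ℂ) :
    FlatAt m (dirDer (Pi.single 0 v) g) := by
  intro a b hab
  rw [mixDer_dirDer, h (a + 1) b (by omega), h a (b + 1) (by omega)]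
  simp

theorem FlatAt.eval {m : ℕ} {g : smoothAlg 2} (h : FlatAt m g) : g.1 0 = 0 := h 0 0 (by omega)

/-- The `k`-th derivative in an imaginary direction. -/
def imDer (g : smoothAlg 2) (k : ℕ) : smoothAlg 2 := (dirDer (Pi.single 0 Complex.I))^[k] g

theorem FlatAt.imDer : ∀ {k m : ℕ} {g : smoothAlg 2} (_ : FlatAt m g) (_ : k ≤ m),
    FlatAt (m - k) (imDer g k)
  | 0, _, _, h, _ => h
  | k + 1, m, g, h, hk => by
    obtain ⟨m, rfl⟩ : ∃ M, m = M + 1 := ⟨m - 1, by omega⟩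
    have := FlatAt.imDer (k := k) (h.dirDer Complex.I) (by omega : k ≤ m)
    rw [show m + 1 - (k + 1) = m - k by omega]
    exact this

/-- If the mixed derivatives of order `e` alternate in sign, the `e`-th derivative in the imaginary
direction is determined by any of them. -/
theorem imDer_of_alternating : ∀ (e : ℕ) (g : smoothAlg 2) (κ : ℂ)
    (_ : ∀ a b, a + b = e → mixDer a b g = (-1) ^ b * κ),
    (imDer g e).1 0 = (2 * Complex.I) ^ e * κ
  | 0, g, κ, h => by simpa [imDer, mixDer] using h 0 0 rfl
  | e + 1, g, κ, h => by
    have := imDer_of_alternating e (dirDer (Pi.single 0 Complex.I) g) (2 * Complex.I * κ) (by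
      intro a b hab
      rw [mixDer_dirDer, h (a + 1) b (by omega), h a (b + 1) (by omega), Complex.conj_I]
      ring)
    rw [pow_succ, mul_assoc, ← this]; rfl

theorem hasDerivAt_imDer (g : smoothAlg 2) (k : ℕ) (t : ℝ) :
    HasDerivAt (fun t : ℝ => (imDer g k).1 (Pi.single 0 (Complex.I * t)))
      ((imDer g (k + 1)).1 (Pi.single 0 (Complex.I * t))) t := by
  have h0 : ∀ t : ℝ, (Pi.single 0 (Complex.I * t) : Fin 2 → ℂ) =
      t • (Pi.single 0 Complex.I : Fin 2 → ℂ) := by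
    intro t
    rw [← Pi.single_smul, Complex.real_smul, mul_comm]
  have h1 : HasDerivAt (fun t : ℝ => (Pi.single 0 (Complex.I * t) : Fin 2 → ℂ))
      (Pi.single 0 Complex.I) t := by
    simp only [h0]
    simpa using (hasDerivAt_id t).smul_const (Pi.single 0 Complex.I : Fin 2 → ℂ)
  have h2 := (smoothAlg.differentiable (imDer g k) (Pi.single 0 (Complex.I * t))).hasFDerivAt
  have h3 := h2.comp_hasDerivAt t h1
  have h4 : (imDer g (k + 1)) = dirDer (Pi.single 0 Complex.I) (imDer g k) :=
    Function.iterate_succ_apply' _ _ _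
  rw [h4]
  exact h3

theorem exists_bound_of_flat {m : ℕ} {g : smoothAlg 2} (h : FlatAt m g) :
    ∃ C, 0 ≤ C ∧ ∀ t : ℝ, |t| ≤ 1 → ‖g.1 (Pi.single 0 (Complex.I * t))‖ ≤ C * |t| ^ (m + 1) := by
  have h0 : ∀ k ≤ m, (imDer g k).1 (Pi.single 0 (Complex.I * (0 : ℝ))) = 0 := by
    intro k hk
    have := (h.imDer hk).eval
    simpa using this
  obtain ⟨C, hC, hb⟩ := exists_taylor_bound m
    (fun k t => (imDer g k).1 (Pi.single 0 (Complex.I * t))) (hasDerivAt_imDer g)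
    (fun k hk => h0 k hk.le)
  refine ⟨C, hC, fun t ht => ?_⟩
  have := hb t ht
  simp only [h0 m le_rfl, zero_mul, zero_div, sub_zero] at this
  exact this

theorem iteratedFDeriv_slice (k : ℕ) : ∀ (g : smoothAlg 2) (t : ℂ) (v : Fin k → ℂ),
    iteratedFDeriv ℝ k (fun t : ℂ => g.1 (Pi.single 0 t)) t v =
      (wordApp (List.ofFn fun i => dirDer (Pi.single 0 (v i))) g).1 (Pi.single 0 t) := by
  have hlin : ∀ t : ℂ, HasFDerivAt (fun t : ℂ => (Pi.single 0 t : Fin 2 → ℂ))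
      (ContinuousLinearMap.single ℝ (fun _ : Fin 2 => ℂ) 0) t :=
    fun t => (ContinuousLinearMap.single ℝ (fun _ : Fin 2 => ℂ) 0).hasFDerivAt
  have hsm : ∀ g : smoothAlg 2, ContDiff ℝ (⊤ : ℕ∞) (fun t : ℂ => g.1 (Pi.single 0 t)) := fun g =>
    (smoothAlg.contDiff g).comp (ContinuousLinearMap.single ℝ (fun _ : Fin 2 => ℂ) 0).contDiff
  induction k with
  | zero => intro g t v; simp
  | succ k ih =>
    intro g t v
    rw [iteratedFDeriv_succ_apply_left, List.ofFn_succ, wordApp_cons]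
    have h1 : DifferentiableAt ℝ (iteratedFDeriv ℝ k (fun t : ℂ => g.1 (Pi.single 0 t))) t :=
      (hsm g).differentiable_iteratedFDeriv (by exact_mod_cast ENat.natCast_lt_top k) t
    have h2 := ((ContinuousMultilinearMap.apply ℝ (fun _ : Fin k => ℂ) ℂ
      (Fin.tail v)).hasFDerivAt.comp t h1.hasFDerivAt).fderiv
    have h4 : fderiv ℝ (iteratedFDeriv ℝ k (fun t : ℂ => g.1 (Pi.single 0 t))) t (v 0)
        (Fin.tail v) = fderiv ℝ (fun y => iteratedFDeriv ℝ k (fun t : ℂ => g.1 (Pi.single 0 t)) y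
          (Fin.tail v)) t (v 0) := (congrArg (fun T => T (v 0)) h2).symm
    rw [h4]
    simp only [ih]
    have h3 : ∀ G : smoothAlg 2, fderiv ℝ (fun t : ℂ => G.1 (Pi.single 0 t)) t (v 0) =
        (dirDer (Pi.single 0 (v 0)) G).1 (Pi.single 0 t) := fun G =>
      congrArg (fun T => T (v 0)) (((smoothAlg.differentiable G
        (Pi.single 0 t)).hasFDerivAt).comp t (hlin t)).fderiv
    exact h3 _

theorem FlatAt.iteratedFDeriv_eq_zero {m : ℕ} {g : smoothAlg 2} (h : FlatAt m g) {k : ℕ}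
    (hk : k ≤ m) : iteratedFDeriv ℝ k (fun t : ℂ => g.1 (Pi.single 0 t)) 0 = 0 := by
  ext v
  rw [iteratedFDeriv_slice]
  have key : ∀ (k : ℕ) (v : Fin k → ℂ), k ≤ m →
      FlatAt (m - k) (wordApp (List.ofFn fun i => _root_.dirDer (Pi.single 0 (v i))) g) := by
    intro k
    induction k with
    | zero => intro v _; simpa using h
    | succ k ih =>
      intro v hk
      rw [List.ofFn_succ, wordApp_cons]
      have := ih (fun i => v i.succ) (by omega)
      rw [show m - k = m - (k + 1) + 1 by omega] at this
      exact this.dirDer (v 0)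
  simpa using (key k v hk).eval

end Jets

section Core

variable {n : ℕ}

/-- The operator representing a derivation on left symbols. -/
def aOp (X : Derivation ℂ (smoothAlg n) (smoothAlg n)) :
    Module.End ℂ (Module.End ℂ (smoothAlg n)) :=
  opA dbDer (fun j => cj (zCoord j)) X

theorem aOp_apply (X : Derivation ℂ (smoothAlg n) (smoothAlg n)) (T : Module.End ℂ (smoothAlg n))
    (f : smoothAlg n) : aOp X T f = X (T f) - ∑ j, X (cj (zCoord j)) * T (dbDer j f) :=
  opA_apply (db := dbDer) (zb := fun j => cj (zCoord j)) X T f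

/-- The symbol functional of `ρ`. -/
def lamOp (ρ : smoothAlg n) :
    Module.End ℂ (Module.End ℂ (smoothAlg n)) →ₗ[ℂ] smoothAlg n :=
  (LinearMap.applyₗ ρ).comp (LinearMap.applyₗ 1)

theorem lamOp_apply (ρ : smoothAlg n) (r : Module.End ℂ (Module.End ℂ (smoothAlg n))) :
    lamOp ρ r = r 1 ρ := rfl

/-- Smooth functions vanishing on `E`. -/
def vanishOn (E : Set (Fin n → ℂ)) : Submodule ℂ (smoothAlg n) where
  carrier := {f | ∀ q ∈ E, f.1 q = 0}
  add_mem' {f g} hf hg := by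
    rw [Set.mem_ofPred_eq] at *
    intro q hq; rw [smoothAlg.add_val, hf q hq, hg q hq, add_zero]
  zero_mem' := by rw [Set.mem_ofPred_eq]; exact fun _ _ => rfl
  smul_mem' c f hf := by
    rw [Set.mem_ofPred_eq] at *
    intro q hq; rw [smoothAlg.smul_val, hf q hq, mul_zero]

theorem mem_vanishOn {E : Set (Fin n → ℂ)} {f : smoothAlg n} :
    f ∈ vanishOn E ↔ ∀ q ∈ E, f.1 q = 0 := by
  change f ∈ {f : smoothAlg n | ∀ q ∈ E, f.1 q = 0} ↔ _
  rw [Set.mem_ofPred_eq]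

theorem cj_mem_vanishOn {E : Set (Fin n → ℂ)} {f : smoothAlg n} (hf : f ∈ vanishOn E) :
    cj f ∈ vanishOn E := by
  rw [mem_vanishOn] at *
  intro q hq; rw [cj_val, hf q hq, map_zero]

/-- Left symbols. -/
abbrev symb (ρ : smoothAlg n) (D : List (Derivation ℂ (smoothAlg n) (smoothAlg n))) :
    smoothAlg n := lamOp ρ (D.map aOp).prod

/-- Mixed symbols. -/
abbrev mixSymb (ρ : smoothAlg n) (D D' : List (Derivation ℂ (smoothAlg n) (smoothAlg n))) :
    smoothAlg n := sig dbDer (fun j => cj (zCoord j)) ρ D D'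

theorem mixSymb_congr {J : Submodule ℂ (smoothAlg n)} {ρ : smoothAlg n}
    (D' : List (Derivation ℂ (smoothAlg n) (smoothAlg n))) :
    ∀ (D : List (Derivation ℂ (smoothAlg n) (smoothAlg n))) (_ : ∀ Y ∈ D', ∀ f ∈ J, Y f ∈ J)
    (_ : ∀ w : List (Derivation ℂ (smoothAlg n) (smoothAlg n)), (∀ Y ∈ w, Y ∈ D') →
      w.length < D'.length → symb ρ (w ++ D) ∈ J),
    mixSymb ρ D D' - (-1 : ℂ) ^ D'.length • symb ρ (D'.reverse ++ D) ∈ J := by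
  induction D' with
  | nil =>
    intro D _ _
    have : mixSymb ρ D [] = symb ρ D := rfl
    simp [this]
  | cons Y D' ih =>
    intro D hpres h
    have h1 := ih D (fun Z hZ => hpres Z (List.mem_cons_of_mem _ hZ)) fun w hw hl =>
      h w (fun Z hZ => List.mem_cons_of_mem _ (hw Z hZ)) (by rw [List.length_cons]; omega)
    have h2 : symb ρ (D'.reverse ++ D) ∈ J := h _
      (fun Z hZ => List.mem_cons_of_mem _ (List.mem_reverse.1 hZ)) (by simp)
    have h3 : mixSymb ρ D D' ∈ J := by
      have := J.add_mem h1 (J.smul_mem ((-1 : ℂ) ^ D'.length) h2)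
      simpa using this
    have h4 := ih (Y :: D) (fun Z hZ => hpres Z (List.mem_cons_of_mem _ hZ)) fun w hw hl => by
      have := h (w ++ [Y]) (fun Z hZ => by
        rcases List.mem_append.1 hZ with h | h
        · exact List.mem_cons_of_mem _ (hw Z h)
        · rw [List.mem_singleton.1 h]; exact List.mem_cons_self) (by simpa using hl)
      simpa using this
    have h5 := J.sub_mem (hpres Y List.mem_cons_self _ h3) h4
    have e1 : mixSymb ρ D (Y :: D') = Y (mixSymb ρ D D') - mixSymb ρ (Y :: D) D' := rfl
    rw [e1, List.length_cons, List.reverse_cons, List.append_assoc, List.singleton_append,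
      pow_succ, mul_neg_one, neg_smul]
    rw [sub_sub_eq_add_sub] at h5
    rw [sub_neg_eq_add, sub_add_eq_add_sub]
    exact h5

/-- Real derivations that preserve the functions vanishing on `E`. -/
structure TangDer (E : Set (Fin n → ℂ)) (X : Derivation ℂ (smoothAlg n) (smoothAlg n)) :
    Prop where
  pres : ∀ f ∈ vanishOn E, X f ∈ vanishOn E
  coeffs : HasCoeffs dDer dbDer zCoord (fun j => cj (zCoord j)) X
  real : ∀ f, X (cj f) = cj (X f)

theorem TangDer.add {E : Set (Fin n → ℂ)} {X Y : Derivation ℂ (smoothAlg n) (smoothAlg n)}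
    (hX : TangDer E X) (hY : TangDer E Y) : TangDer E (X + Y) where
  pres f hf := (vanishOn E).add_mem (hX.pres f hf) (hY.pres f hf)
  coeffs := hX.coeffs.add hY.coeffs
  real f := by rw [Derivation.add_apply, Derivation.add_apply, hX.real, hY.real, cj_add]

theorem TangDer.lie {E : Set (Fin n → ℂ)} {X Y : Derivation ℂ (smoothAlg n) (smoothAlg n)}
    (hX : TangDer E X) (hY : TangDer E Y) : TangDer E ⁅X, Y⁆ where
  pres f hf := by
    rw [Derivation.commutator_apply]
    exact (vanishOn E).sub_mem (hX.pres _ (hY.pres f hf)) (hY.pres _ (hX.pres f hf))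
  coeffs := HasCoeffs.lie (d := dDer) (db := dbDer) (z := zCoord) (zb := fun j => cj (zCoord j))
    dDer_dDer dbDer_dbDer dDer_dbDer hX.coeffs hY.coeffs
  real f := by
    rw [Derivation.commutator_apply, Derivation.commutator_apply, hX.real, hY.real, hX.real,
      hY.real, cj_sub]

/-- The holomorphic two-parameter polynomial map whose jets are given by `X` and `C`. -/
def jetCurve (X C : Derivation ℂ (smoothAlg n) (smoothAlg n)) (p : Fin n → ℂ) (N : ℕ) :
    Fin n → smoothAlg 2 := fun j =>
  jetPoly (fun a => (wordApp (List.replicate a X) (zCoord j)).1 p) N +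
    zCoord 1 * jetPoly (fun a => (wordApp (List.replicate a X) (C (zCoord j))).1 p) N

section

variable (X C : Derivation ℂ (smoothAlg n) (smoothAlg n)) (p : Fin n → ℂ) (N : ℕ)

theorem dDer_one_jetCurve (j : Fin n) : dDer 1 (jetCurve X C p N j) =
    jetPoly (fun a => (wordApp (List.replicate a X) (C (zCoord j))).1 p) N := by
  rw [jetCurve, map_add, dDer_one_jetPoly, Derivation.leibniz, dDer_one_jetPoly, dDer_zCoord]
  simp

theorem dbDer_jetCurve (i : Fin 2) (j : Fin n) : dbDer i (jetCurve X C p N j) = 0 := by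
  rw [jetCurve, map_add, dbDer_jetPoly, Derivation.leibniz, dbDer_jetPoly, dbDer_zCoord]
  simp

theorem dbDer_dDer_jetCurve (i k : Fin 2) (j : Fin n) :
    dbDer i (dDer k (jetCurve X C p N j)) = 0 := by
  rw [← dDer_dbDer, dbDer_jetCurve, map_zero]

theorem jetCurve_zero (j : Fin n) : (jetCurve X C p N j).1 0 = p j := by
  simp [jetCurve, jetPoly_zero]

theorem eval_wordApp_jetCurve {a : ℕ} (ha : a ≤ N) (j : Fin n) :
    (wordApp (List.replicate a (dDer 0)) (jetCurve X C p N j)).1 0 =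
      (wordApp (List.replicate a X) (zCoord j)).1 p := by
  rw [jetCurve, wordApp_add_arg, smoothAlg.add_val, eval_wordApp_jetPoly a _ N ha,
    wordApp_mul_of_kills]
  · simp
  · intro Y hY
    rw [List.eq_of_mem_replicate hY, dDer_zCoord]; simp

/-- The words whose jets are prescribed. -/
def GoodWord (N : ℕ) (u : List (Fin 2)) : Prop :=
  ∃ a ≤ N, u = List.replicate a 0 ∨ u = List.replicate a 0 ++ [1]

theorem GoodWord.sublist {N : ℕ} {u v : List (Fin 2)} (hu : GoodWord N u) (hv : v.Sublist u) :
    GoodWord N v := by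
  obtain ⟨a, ha, rfl | rfl⟩ := hu
  · obtain ⟨b, hb, rfl⟩ := List.sublist_replicate_iff.1 hv
    exact ⟨b, hb.trans ha, Or.inl rfl⟩
  · obtain ⟨v1, v2, rfl, h1, h2⟩ := List.sublist_append_iff.1 hv
    obtain ⟨b, hb, rfl⟩ := List.sublist_replicate_iff.1 h1
    rcases List.sublist_singleton.1 h2 with rfl | rfl
    · exact ⟨b, hb.trans ha, Or.inl (by simp)⟩
    · exact ⟨b, hb.trans ha, Or.inr rfl⟩

/-- Restriction of indexed words. -/
def pairDer : Fin 2 → Derivation ℂ (smoothAlg n) (smoothAlg n) := ![X, C]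

theorem wordApp_cj {m : ℕ} (S T : List (Derivation ℂ (smoothAlg m) (smoothAlg m)))
    (h : List.Forall₂ (fun Y Z => ∀ f, Y (cj f) = cj (Z f)) S T) (f : smoothAlg m) :
    wordApp S (cj f) = cj (wordApp T f) := by
  induction h with
  | nil => rfl
  | cons h _ ih => rw [wordApp_cons, ih, h, wordApp_cons]

theorem jetCurve_jet (w : List (Fin 2)) (i : Fin 2) (j : Fin n) (hw : GoodWord N (w ++ [i])) :
    (wordApp (w.map dDer) (dDer i (jetCurve X C p N j))).1 0 =
      (wordApp (w.map (pairDer X C)) (pairDer X C i (zCoord j))).1 p := by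
  obtain ⟨a, ha, h | h⟩ := hw
  · obtain ⟨b, rfl⟩ : ∃ b, a = b + 1 := by
      cases a with
      | zero => simp at h
      | succ b => exact ⟨b, rfl⟩
    rw [List.replicate_succ'] at h
    obtain ⟨rfl, hi⟩ := List.append_inj' h rfl
    obtain rfl : i = 0 := by simpa using hi
    rw [List.map_replicate, List.map_replicate, wordApp_replicate_succ, wordApp_replicate_succ]
    exact eval_wordApp_jetCurve X C p N ha j
  · obtain ⟨rfl, hi⟩ := List.append_inj' h rfl
    obtain rfl : i = 1 := by simpa using hi
    rw [List.map_replicate, List.map_replicate, dDer_one_jetCurve]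
    exact eval_wordApp_jetPoly a _ N ha

theorem eval_wordApp_jetCurve_pullb {E : Set (Fin n → ℂ)} (hX : TangDer E X) (hC : TangDer E C)
    {u u' : List (Fin 2)} (hu : GoodWord N u) (hu' : GoodWord N u') (f : smoothAlg n) :
    (wordApp (u.map dDer) (wordApp (u'.map dbDer) (pullb (jetCurve X C p N) f))).1 0 =
      (mixSymb f (u.map (pairDer X C)) (u'.map (pairDer X C))).1 p := by
  have hreal : ∀ i f, pairDer X C i (cj f) = cj (pairDer X C i f) := by
    intro i f
    fin_cases i
    · exact hX.real f
    · exact hC.real f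
  refine eval_wordApp_pullback (d := dDer) (db := dbDer) (z := zCoord)
    (zb := fun j => cj (zCoord j)) dDer_dbDer dDer dbDer dDer_dbDer (pullb (jetCurve X C p N))
    (jetCurve X C p N) (fun j => cj (jetCurve X C p N j))
    (fun i f => dDer_pullb _ (dbDer_jetCurve X C p N) f i)
    (fun i f => dbDer_pullb _ (dbDer_jetCurve X C p N) f i)
    (fun i j k => dbDer_dDer_jetCurve X C p N i k j)
    (smoothAlg.ev 0) (smoothAlg.ev p) ?_ (pairDer X C) ?_ (GoodWord N)
    (fun u v hu hv => hu.sublist hv) (fun w i j hw => jetCurve_jet X C p N w i j hw) ?_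
    u u' hu hu' f
  · intro f
    rw [smoothAlg.ev_apply, smoothAlg.ev_apply, pullb_val]
    exact congrArg f.1 (funext fun j => jetCurve_zero X C p N j)
  · intro i
    fin_cases i
    · exact hX.coeffs
    · exact hC.coeffs
  · intro w i j hw
    have h1 := jetCurve_jet X C p N w i j hw
    rw [smoothAlg.ev_apply, smoothAlg.ev_apply, dbDer_cj, hreal,
      wordApp_cj (w.map dbDer) (w.map dDer), wordApp_cj (w.map (pairDer X C)) (w.map (pairDer X C)),
      cj_val, cj_val, h1]
    · exact List.forall₂_map_left_iff.2 (List.forall₂_map_right_iff.2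
        (List.forall₂_same.2 fun i _ f => hreal i f))
    · exact List.forall₂_map_left_iff.2 (List.forall₂_map_right_iff.2
        (List.forall₂_same.2 fun i _ f => dbDer_cj i f))

theorem pairDer_replicate (a : ℕ) :
    (List.replicate a (0 : Fin 2)).map (pairDer X C) = List.replicate a X := by
  rw [List.map_replicate]; rfl

theorem pairDer_replicate_append (a : ℕ) :
    (List.replicate a (0 : Fin 2) ++ [1]).map (pairDer X C) = List.replicate a X ++ [C] := by
  rw [List.map_append, pairDer_replicate]; rfl

variable {X C N}

theorem mixDer_pullb {E : Set (Fin n → ℂ)} (hX : TangDer E X) (hC : TangDer E C) (f : smoothAlg n)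
    {a b : ℕ} (ha : a ≤ N) (hb : b ≤ N) :
    mixDer a b (pullb (jetCurve X C p N) f) =
      (mixSymb f (List.replicate a X) (List.replicate b X)).1 p := by
  have := eval_wordApp_jetCurve_pullb X C p N hX hC ⟨a, ha, Or.inl rfl⟩ ⟨b, hb, Or.inl rfl⟩ f
  rw [pairDer_replicate, pairDer_replicate, List.map_replicate, List.map_replicate] at this
  exact this

theorem mixDer_dDer_pullb {E : Set (Fin n → ℂ)} (hX : TangDer E X) (hC : TangDer E C)
    (f : smoothAlg n) {a b : ℕ} (ha : a ≤ N) (hb : b ≤ N) :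
    mixDer a b (dDer 1 (pullb (jetCurve X C p N) f)) =
      (mixSymb f (List.replicate a X ++ [C]) (List.replicate b X)).1 p := by
  have := eval_wordApp_jetCurve_pullb X C p N hX hC ⟨a, ha, Or.inr rfl⟩ ⟨b, hb, Or.inl rfl⟩ f
  rw [pairDer_replicate, pairDer_replicate_append, List.map_append, List.map_replicate,
    List.map_replicate, wordApp_append] at this
  rw [mixDer, wordApp_replicate_dbDer_dDer]
  exact this

theorem mixDer_dDer_dbDer_pullb {E : Set (Fin n → ℂ)} (hX : TangDer E X) (hC : TangDer E C)
    (f : smoothAlg n) {a b : ℕ} (ha : a ≤ N) (hb : b ≤ N) :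
    mixDer a b (dDer 1 (dbDer 1 (pullb (jetCurve X C p N) f))) =
      (mixSymb f (List.replicate a X ++ [C]) (List.replicate b X ++ [C])).1 p := by
  have := eval_wordApp_jetCurve_pullb X C p N hX hC ⟨a, ha, Or.inr rfl⟩ ⟨b, hb, Or.inr rfl⟩ f
  rw [pairDer_replicate_append, pairDer_replicate_append, List.map_append, List.map_append,
    List.map_replicate, List.map_replicate, wordApp_append, wordApp_append] at this
  rw [mixDer, wordApp_replicate_dbDer_dDer]
  exact this

end

end Core

section CorePositivity

variable {n : ℕ}

/-- The Levi form of a smooth function as a sesquilinear form. -/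
def levA (ρ : smoothAlg n) (v w : Fin n → ℂ) (q : Fin n → ℂ) : ℂ :=
  ∑ j, ∑ k, (dDer j (dbDer k ρ)).1 q * v j * (starRingEnd ℂ) (w k)

theorem conj_dDer_dbDer {ρ : smoothAlg n} (hρ : cj ρ = ρ) (j k : Fin n) (q : Fin n → ℂ) :
    (starRingEnd ℂ) ((dDer j (dbDer k ρ)).1 q) = (dDer k (dbDer j ρ)).1 q := by
  rw [← cj_val, ← dbDer_cj, ← dDer_cj, hρ, dDer_dbDer]

theorem levA_conj {ρ : smoothAlg n} (hρ : cj ρ = ρ) (v w : Fin n → ℂ) (q : Fin n → ℂ) :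
    (starRingEnd ℂ) (levA ρ v w q) = levA ρ w v q := by
  rw [levA, levA, map_sum, Finset.sum_comm]
  simp only [map_sum, map_mul, conj_dDer_dbDer hρ, Complex.conj_conj]
  refine Finset.sum_congr rfl fun j _ => Finset.sum_congr rfl fun k _ => by ring

/-- The derivative of a smooth function along a holomorphic vector. -/
def parA (v : Fin n → ℂ) (ρ : smoothAlg n) (q : Fin n → ℂ) : ℂ := ∑ j, v j * (dDer j ρ).1 q

variable {X C : Derivation ℂ (smoothAlg n) (smoothAlg n)} {p : Fin n → ℂ} {N : ℕ}

/-- The position of the jet curve. -/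
def curvePt (X C : Derivation ℂ (smoothAlg n) (smoothAlg n)) (p : Fin n → ℂ) (N : ℕ)
    (x : Fin 2 → ℂ) : Fin n → ℂ := fun j => (jetCurve X C p N j).1 x

/-- The transversal derivative of the jet curve. -/
def curveVec (X C : Derivation ℂ (smoothAlg n) (smoothAlg n)) (p : Fin n → ℂ) (N : ℕ)
    (x : Fin 2 → ℂ) : Fin n → ℂ := fun j => (dDer 1 (jetCurve X C p N j)).1 x

theorem continuous_curvePt : Continuous (curvePt X C p N) :=
  continuous_pi fun _ => (smoothAlg.contDiff _).continuous

theorem continuous_curveVec : Continuous (curveVec X C p N) :=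
  continuous_pi fun _ => (smoothAlg.contDiff _).continuous

theorem dDer_pullb_jetCurve (f : smoothAlg n) (x : Fin 2 → ℂ) :
    (dDer 1 (pullb (jetCurve X C p N) f)).1 x =
      parA (curveVec X C p N x) f (curvePt X C p N x) := by
  rw [dDer_pullb _ (dbDer_jetCurve X C p N), smoothAlg.sum_val]; rfl

theorem dDer_dbDer_pullb_jetCurve (f : smoothAlg n) (x : Fin 2 → ℂ) :
    (dDer 1 (dbDer 1 (pullb (jetCurve X C p N) f))).1 x =
      levA f (curveVec X C p N x) (curveVec X C p N x) (curvePt X C p N x) := by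
  rw [dbDer_pullb _ (dbDer_jetCurve X C p N), map_sum, levA, Finset.sum_comm, smoothAlg.sum_val]
  refine Finset.sum_congr rfl fun k _ => ?_
  have h0 : dDer 1 (dbDer 1 (cj (jetCurve X C p N k))) = 0 := by
    rw [dbDer_cj, dDer_cj, dbDer_dDer_jetCurve]
    exact smoothAlg.ext fun z => by simp
  rw [Derivation.leibniz, h0, smul_zero, add_zero, smul_eq_mul,
    dDer_pullb _ (dbDer_jetCurve X C p N), smoothAlg.mul_val, smoothAlg.sum_val, Finset.mul_sum]
  refine Finset.sum_congr rfl fun j _ => ?_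
  rw [dbDer_cj, cj_val, smoothAlg.mul_val, pullb_val]
  change (starRingEnd ℂ) (curveVec X C p N x k) * (curveVec X C p N x j *
    (dDer j (dbDer k f)).1 (curvePt X C p N x)) = _
  ring

theorem mixSymb_of_symb_mem {J : Submodule ℂ (smoothAlg n)} {ρ : smoothAlg n}
    {D D' : List (Derivation ℂ (smoothAlg n) (smoothAlg n))}
    (hpres : ∀ Y ∈ D', ∀ f ∈ J, Y f ∈ J)
    (h : ∀ w : List (Derivation ℂ (smoothAlg n) (smoothAlg n)), (∀ Y ∈ w, Y ∈ D') →
      w.length ≤ D'.length → symb ρ (w ++ D) ∈ J) : mixSymb ρ D D' ∈ J := by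
  have h1 := mixSymb_congr (J := J) (ρ := ρ) D' D hpres fun w hw hl => h w hw hl.le
  have h2 := h D'.reverse (fun Y hY => List.mem_reverse.1 hY) (by simp)
  have := J.add_mem h1 (J.smul_mem ((-1 : ℂ) ^ D'.length) h2)
  simpa using this

theorem symb_positivity {E : Set (Fin n → ℂ)} {ρ : smoothAlg n} (hρ : cj ρ = ρ)
    (hX : TangDer E X) (hC : TangDer E C) {e : ℕ} (he : Odd e)
    (H1 : ∀ w, (∀ Y ∈ w, Y = X ∨ Y = C) → w.length ≤ e → symb ρ w ∈ vanishOn E)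
    (H2 : ∀ w, (∀ Y ∈ w, Y = X ∨ Y = C) → w.length ≤ e → symb ρ (w ++ [C]) ∈ vanishOn E)
    (hp : p ∈ E)
    (hlevi : ∀ v₀ : Fin n → ℂ, ∃ K : ℝ, ∀ᶠ x in 𝓝 (p, v₀),
      -K * (‖ρ.1 x.1‖ + ‖parA x.2 ρ x.1‖) ≤ (levA ρ x.2 x.2 x.1).re) :
    (symb ρ (C :: (List.replicate e X ++ [C]))).1 p = 0 := by
  have hpX : ∀ b, ∀ Y ∈ List.replicate b X, ∀ f ∈ vanishOn E, Y f ∈ vanishOn E := by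
    intro b Y hY; rw [List.eq_of_mem_replicate hY]; exact hX.pres
  have hpC : ∀ b, ∀ Y ∈ List.replicate b X ++ [C], ∀ f ∈ vanishOn E, Y f ∈ vanishOn E := by
    intro b Y hY
    rcases List.mem_append.1 hY with h | h
    · exact hpX b Y h
    · rw [List.mem_singleton.1 h]; exact hC.pres
  have hmX : ∀ {w : List (Derivation ℂ (smoothAlg n) (smoothAlg n))} {b : ℕ},
      (∀ Y ∈ w, Y ∈ List.replicate b X) → ∀ Y ∈ w, Y = X ∨ Y = C := fun h Y hY =>
    Or.inl (List.eq_of_mem_replicate (h Y hY))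
  have hmC : ∀ {w : List (Derivation ℂ (smoothAlg n) (smoothAlg n))} {b : ℕ},
      (∀ Y ∈ w, Y ∈ List.replicate b X ++ [C]) → ∀ Y ∈ w, Y = X ∨ Y = C := by
    intro w b h Y hY
    rcases List.mem_append.1 (h Y hY) with h | h
    · exact Or.inl (List.eq_of_mem_replicate h)
    · exact Or.inr (List.mem_singleton.1 h)
  have happ : ∀ {w : List (Derivation ℂ (smoothAlg n) (smoothAlg n))} {a : ℕ},
      (∀ Y ∈ w, Y = X ∨ Y = C) → ∀ Y ∈ w ++ List.replicate a X, Y = X ∨ Y = C := by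
    intro w a h Y hY
    rcases List.mem_append.1 hY with h' | h'
    · exact h Y h'
    · exact Or.inl (List.eq_of_mem_replicate h')
  set Γ := pullb (jetCurve X C p e) ρ with hΓ
  have F1 : FlatAt e Γ := by
    intro a b hab
    rw [mixDer_pullb p hX hC ρ (by omega) (by omega)]
    refine mem_vanishOn.1 (mixSymb_of_symb_mem (hpX b) fun w hw hl => ?_) p hp
    refine H1 _ (happ (hmX hw)) ?_
    simp at hl ⊢; omega
  have F2 : FlatAt e (dDer 1 Γ) := by
    intro a b hab
    rw [mixDer_dDer_pullb p hX hC ρ (by omega) (by omega)]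
    refine mem_vanishOn.1 (mixSymb_of_symb_mem (hpX b) fun w hw hl => ?_) p hp
    rw [← List.append_assoc]
    refine H2 _ (happ (hmX hw)) ?_
    simp at hl ⊢; omega
  set κ := (symb ρ (C :: (List.replicate e X ++ [C]))).1 p with hκ
  have F3 : ∀ a b, a + b ≤ e → mixDer a b (dDer 1 (dbDer 1 Γ)) =
      (-1) ^ (b + 1) * (symb ρ (C :: (List.replicate (a + b) X ++ [C]))).1 p := by
    intro a b hab
    rw [mixDer_dDer_dbDer_pullb p hX hC ρ (by omega) (by omega)]
    have := mixSymb_congr (J := vanishOn E) (ρ := ρ) (List.replicate b X ++ [C])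
      (List.replicate a X ++ [C]) (hpC b) fun w hw hl => by
        rw [← List.append_assoc]
        refine H2 _ (happ (hmC hw)) ?_
        simp at hl ⊢; omega
    have hlist : (List.replicate b X ++ [C]).reverse ++ (List.replicate a X ++ [C]) =
        C :: (List.replicate (a + b) X ++ [C]) := by
      rw [add_comm a b]
      simp only [List.reverse_append, List.reverse_replicate, List.reverse_singleton,
        List.cons_append, List.nil_append, List.replicate_add, List.append_assoc]
    have hlen : (List.replicate b X ++ [C]).length = b + 1 := by simp
    rw [hlist, hlen] at this
    have h2 := mem_vanishOn.1 this p hp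
    rw [smoothAlg.sub_val, sub_eq_zero] at h2
    rw [h2, smoothAlg.smul_val]
  have F4 : ∀ m < e, (imDer (dDer 1 (dbDer 1 Γ)) m).1 0 = 0 := by
    intro m hm
    have hf : FlatAt m (dDer 1 (dbDer 1 Γ)) := by
      intro a b hab
      rw [F3 a b (by omega)]
      have : symb ρ (C :: (List.replicate (a + b) X ++ [C])) ∈ vanishOn E := by
        refine H2 (C :: List.replicate (a + b) X) ?_ ?_
        · intro Y hY
          rcases List.mem_cons.1 hY with h | h
          · exact Or.inr h
          · exact Or.inl (List.eq_of_mem_replicate h)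
        · simp; omega
      rw [mem_vanishOn.1 this p hp, mul_zero]
    exact (hf.imDer le_rfl).eval
  have F5 : (imDer (dDer 1 (dbDer 1 Γ)) e).1 0 = (2 * Complex.I) ^ e * -κ := by
    refine imDer_of_alternating e _ _ fun a b hab => ?_
    rw [F3 a b hab.le, hab]; ring
  obtain ⟨C1, hC1, hb1⟩ := exists_bound_of_flat F1
  obtain ⟨C2, hC2, hb2⟩ := exists_bound_of_flat F2
  obtain ⟨K, hK⟩ := hlevi (curveVec X C p e 0)
  have hcont : Continuous fun t : ℝ => (Pi.single 0 (Complex.I * t) : Fin 2 → ℂ) :=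
    (continuous_single 0).comp (by fun_prop)
  have hcont2 : Filter.Tendsto (fun t : ℝ => (curvePt X C p e (Pi.single 0 (Complex.I * t)),
      curveVec X C p e (Pi.single 0 (Complex.I * t)))) (𝓝 0) (𝓝 (p, curveVec X C p e 0)) := by
    have := ((continuous_curvePt (X := X) (C := C) (p := p) (N := e)).comp hcont).prodMk
      ((continuous_curveVec (X := X) (C := C) (p := p) (N := e)).comp hcont)
    have h2 := this.tendsto 0
    have h3 : curvePt X C p e 0 = p := funext fun j => jetCurve_zero X C p e j
    simp only [Function.comp_apply, Complex.ofReal_zero, mul_zero, Pi.single_zero, h3] at h2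
    exact h2
  have hzero : (Pi.single 0 (Complex.I * (0 : ℝ)) : Fin 2 → ℂ) = 0 := by simp
  have := leading_coeff_eq_zero he
    (f := fun k t => (imDer (dDer 1 (dbDer 1 Γ)) k).1 (Pi.single 0 (Complex.I * t)))
    (hasDerivAt_imDer _) (fun k hk => by rw [hzero]; exact F4 k hk) ?_ (C := |K| * (C1 + C2)) ?_
  · rw [hzero, F5] at this
    have h2 : (2 * Complex.I) ^ e ≠ 0 := pow_ne_zero _ (by simp)
    simpa [h2] using this
  · intro t
    change ((dDer 1 (dbDer 1 Γ)).1 (Pi.single 0 (Complex.I * t))).im = 0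
    rw [hΓ, dDer_dbDer_pullb_jetCurve]
    exact Complex.conj_eq_iff_im.1 (levA_conj hρ _ _ _)
  · filter_upwards [hcont2.eventually hK, Icc_mem_nhds (show (-1 : ℝ) < 0 by norm_num)
      (show (0 : ℝ) < 1 by norm_num)] with t ht ht1
    change _ ≤ ((dDer 1 (dbDer 1 Γ)).1 (Pi.single 0 (Complex.I * t))).re
    have h1 := hb1 t (abs_le.2 ht1)
    have h2 := hb2 t (abs_le.2 ht1)
    rw [hΓ, dDer_pullb_jetCurve] at h2
    rw [hΓ, dDer_dbDer_pullb_jetCurve]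
    refine le_trans ?_ ht
    have h3 : ‖ρ.1 (curvePt X C p e (Pi.single 0 (Complex.I * t)))‖ ≤ C1 * |t| ^ (e + 1) := h1
    have h4 := mul_le_mul_of_nonneg_left (add_le_add h3 h2) (abs_nonneg K)
    have h5 := mul_le_mul_of_nonneg_right (le_abs_self K) (add_nonneg
      (norm_nonneg (ρ.1 (curvePt X C p e (Pi.single 0 (Complex.I * t)))))
      (norm_nonneg (parA (curveVec X C p e (Pi.single 0 (Complex.I * t))) ρ
        (curvePt X C p e (Pi.single 0 (Complex.I * t))))))
    linarith

end CorePositivity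

section CoreFinal

variable {n : ℕ}

/-- The holomorphic derivation with coefficients `L`. -/
def holDer (L : Fin n → smoothAlg n) : Derivation ℂ (smoothAlg n) (smoothAlg n) :=
  ∑ j, L j • dDer j

/-- The antiholomorphic derivation with conjugate coefficients. -/
def antiDer (L : Fin n → smoothAlg n) : Derivation ℂ (smoothAlg n) (smoothAlg n) :=
  ∑ j, cj (L j) • dbDer j

theorem Derivation.finset_sum_apply {R A ι : Type*} [CommRing R] [CommRing A] [Algebra R A]
    (s : Finset ι) (D : ι → Derivation R A A) (f : A) : (∑ j ∈ s, D j) f = ∑ j ∈ s, D j f := by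
  classical
  induction s using Finset.induction_on with
  | empty => simp
  | insert a s ha ih => rw [Finset.sum_insert ha, Finset.sum_insert ha, Derivation.add_apply, ih]

theorem holDer_apply (L : Fin n → smoothAlg n) (f : smoothAlg n) :
    holDer L f = ∑ j, L j * dDer j f := by
  rw [holDer, Derivation.finset_sum_apply]; rfl

theorem antiDer_apply (L : Fin n → smoothAlg n) (f : smoothAlg n) :
    antiDer L f = ∑ j, cj (L j) * dbDer j f := by
  rw [antiDer, Derivation.finset_sum_apply]; rfl

theorem antiDer_cj (L : Fin n → smoothAlg n) (f : smoothAlg n) :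
    antiDer L (cj f) = cj (holDer L f) := by
  rw [antiDer_apply, holDer_apply, cj_sum]
  refine Finset.sum_congr rfl fun j _ => ?_
  rw [dbDer_cj, cj_mul]

theorem holDer_cj (L : Fin n → smoothAlg n) (f : smoothAlg n) :
    holDer L (cj f) = cj (antiDer L f) := by
  rw [← cj_cj (holDer L (cj f)), ← antiDer_cj, cj_cj]

theorem holDer_zCoord (L : Fin n → smoothAlg n) (j : Fin n) : holDer L (zCoord j) = L j := by
  rw [holDer_apply]; simp [dDer_zCoord]

theorem antiDer_zCoord (L : Fin n → smoothAlg n) (j : Fin n) : antiDer L (zCoord j) = 0 := by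
  rw [antiDer_apply]; simp [dbDer_zCoord]

theorem holDer_cj_zCoord (L : Fin n → smoothAlg n) (j : Fin n) :
    holDer L (cj (zCoord j)) = 0 := by
  rw [holDer_apply]; simp [dDer_cj_zCoord]

theorem antiDer_cj_zCoord (L : Fin n → smoothAlg n) (j : Fin n) :
    antiDer L (cj (zCoord j)) = cj (L j) := by
  rw [antiDer_cj, holDer_zCoord]

theorem antiDer_mem {E : Set (Fin n → ℂ)} {L : Fin n → smoothAlg n}
    (h : ∀ f ∈ vanishOn E, holDer L f ∈ vanishOn E) :
    ∀ f ∈ vanishOn E, antiDer L f ∈ vanishOn E := by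
  intro f hf
  rw [← cj_cj f, antiDer_cj]
  exact cj_mem_vanishOn (h _ (cj_mem_vanishOn hf))

theorem tangDer_combination {E : Set (Fin n → ℂ)} {L : Fin n → smoothAlg n}
    (h : ∀ f ∈ vanishOn E, holDer L f ∈ vanishOn E) (c : ℂ) :
    TangDer E (c • holDer L + (starRingEnd ℂ) c • antiDer L) where
  pres f hf := (vanishOn E).add_mem ((vanishOn E).smul_mem _ (h f hf))
    ((vanishOn E).smul_mem _ (antiDer_mem h f hf))
  coeffs f := by
    simp only [Derivation.add_apply, Derivation.smul_apply, holDer_zCoord, antiDer_zCoord,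
      holDer_cj_zCoord, antiDer_cj_zCoord, smul_zero, add_zero, zero_add, smul_mul_assoc,
      ← Finset.smul_sum, ← holDer_apply, ← antiDer_apply]
  real f := by
    simp only [Derivation.add_apply, Derivation.smul_apply, holDer_cj, antiDer_cj, cj_add, cj_smul,
      Complex.conj_conj]
    exact add_comm _ _

theorem tangDer_of_lieGen {E : Set (Fin n → ℂ)} {L : Fin n → smoothAlg n}
    (h : ∀ f ∈ vanishOn E, holDer L f ∈ vanishOn E)
    {C : Derivation ℂ (smoothAlg n) (smoothAlg n)}
    (hC : LieGen (holDer L + antiDer L) (Complex.I • (holDer L - antiDer L)) C) :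
    TangDer E C := by
  induction hC with
  | left =>
    have := tangDer_combination h 1
    rwa [map_one, one_smul, one_smul] at this
  | right =>
    have := tangDer_combination h Complex.I
    rwa [Complex.conj_I, neg_smul, ← sub_eq_add_neg, ← smul_sub] at this
  | add _ _ ih1 ih2 => exact ih1.add ih2
  | lie _ _ ih1 ih2 => exact ih1.lie ih2

theorem aOp_lie (X Y : Derivation ℂ (smoothAlg n) (smoothAlg n)) :
    aOp ⁅X, Y⁆ = aOp X * aOp Y - aOp Y * aOp X :=
  opA_lie (db := dbDer) (zb := fun j => cj (zCoord j)) dbDer_dbDer X Y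

theorem aOp_add (X Y : Derivation ℂ (smoothAlg n) (smoothAlg n)) :
    aOp (X + Y) = aOp X + aOp Y := map_add (opA dbDer fun j => cj (zCoord j)) X Y

theorem aOp_smul_sub (c : ℂ) (X Y : Derivation ℂ (smoothAlg n) (smoothAlg n)) :
    aOp (c • (X - Y)) = c • (aOp X - aOp Y) := by
  rw [aOp, aOp, aOp, map_smul, map_sub]

/-- The operators of the Lie algebra generated by the real and imaginary parts of `L`. -/
def lieOps (L : Fin n → smoothAlg n) : Set (Module.End ℂ (Module.End ℂ (smoothAlg n))) :=
  {x | @LieGen _ LieRing.ofAssociativeRing (aOp (holDer L) + aOp (antiDer L))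
    (Complex.I • (aOp (holDer L) - aOp (antiDer L))) x}

theorem aOp_mem_lieOps {L : Fin n → smoothAlg n} {C : Derivation ℂ (smoothAlg n) (smoothAlg n)}
    (hC : LieGen (holDer L + antiDer L) (Complex.I • (holDer L - antiDer L)) C) :
    aOp C ∈ lieOps L := by
  rw [lieOps, Set.mem_ofPred_eq]
  let _ : LieRing (Module.End ℂ (Module.End ℂ (smoothAlg n))) := LieRing.ofAssociativeRing
  induction hC with
  | left => rw [aOp_add]; exact LieGen.left
  | right => rw [aOp_smul_sub]; exact LieGen.right
  | add _ _ ih1 ih2 => rw [aOp_add]; exact LieGen.add ih1 ih2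
  | lie _ _ ih1 ih2 => rw [aOp_lie]; exact LieGen.lie ih1 ih2

theorem exists_of_mem_lieOps {L : Fin n → smoothAlg n}
    {x : Module.End ℂ (Module.End ℂ (smoothAlg n))} (hx : x ∈ lieOps L) :
    ∃ C, LieGen (holDer L + antiDer L) (Complex.I • (holDer L - antiDer L)) C ∧ aOp C = x := by
  rw [lieOps, Set.mem_ofPred_eq] at hx
  let _ : LieRing (Module.End ℂ (Module.End ℂ (smoothAlg n))) := LieRing.ofAssociativeRing
  induction hx with
  | left => exact ⟨_, LieGen.left, aOp_add _ _⟩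
  | right => exact ⟨_, LieGen.right, aOp_smul_sub _ _ _⟩
  | add _ _ ih1 ih2 =>
    obtain ⟨C, hC, rfl⟩ := ih1
    obtain ⟨D, hD, rfl⟩ := ih2
    exact ⟨_, hC.add hD, aOp_add _ _⟩
  | lie _ _ ih1 ih2 =>
    obtain ⟨C, hC, rfl⟩ := ih1
    obtain ⟨D, hD, rfl⟩ := ih2
    exact ⟨_, hC.lie hD, aOp_lie C D⟩

theorem prod_mem_unitSpan_pow {V : Set (Module.End ℂ (Module.End ℂ (smoothAlg n)))}
    (w : List (Derivation ℂ (smoothAlg n) (smoothAlg n))) (hw : ∀ Y ∈ w, aOp Y ∈ V) :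
    (w.map aOp).prod ∈ unitSpan V ^ w.length := by
  induction w with
  | nil => exact Submodule.one_le.1 (pow_zero _).ge
  | cons Y w ih =>
    rw [List.map_cons, List.prod_cons, List.length_cons, pow_succ']
    exact Submodule.mul_mem_mul (mem_unitSpan (hw Y List.mem_cons_self))
      (ih fun Z hZ => hw Z (List.mem_cons_of_mem _ hZ))

theorem aOp_one_apply {C : Derivation ℂ (smoothAlg n) (smoothAlg n)} 
    (hC : HasCoeffs dDer dbDer zCoord (fun j => cj (zCoord j)) C) (f : smoothAlg n) :
    aOp C 1 f = ∑ j, C (zCoord j) * dDer j f := by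
  rw [aOp_apply, Module.End.one_apply, hC f]
  simp only [Module.End.one_apply]
  exact add_sub_cancel_right _ _

theorem aOp_holDer_apply (L : Fin n → smoothAlg n) (T : Module.End ℂ (smoothAlg n))
    (f : smoothAlg n) : aOp (holDer L) T f = holDer L (T f) := by
  rw [aOp_apply]; simp [holDer_cj_zCoord]

theorem aOp_antiDer_one (L : Fin n → smoothAlg n) : aOp (antiDer L) 1 = 0 := by
  ext1 f
  rw [aOp_apply]
  simp only [antiDer_cj_zCoord]
  rw [Module.End.one_apply, antiDer_apply]
  exact sub_self _

theorem sum_mul_sum_eq_levA (ρ : smoothAlg n) (v w : Fin n → smoothAlg n) (q : Fin n → ℂ) :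
    (∑ j, cj (w j) * ∑ k, v k * dDer k (dbDer j ρ)).1 q =
      levA ρ (fun j => (v j).1 q) (fun j => (w j).1 q) q := by
  rw [levA, Finset.sum_comm, smoothAlg.sum_val]
  refine Finset.sum_congr rfl fun j _ => ?_
  rw [smoothAlg.mul_val, smoothAlg.sum_val, Finset.mul_sum]
  refine Finset.sum_congr rfl fun k _ => ?_
  rw [smoothAlg.mul_val, cj_val]
  ring

theorem symb_mem_vanishOn {E : Set (Fin n → ℂ)} {ρ : smoothAlg n} (hρ : cj ρ = ρ)
    {L : Fin n → smoothAlg n} (hρE : ρ ∈ vanishOn E)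
    (hL : ∀ f ∈ vanishOn E, holDer L f ∈ vanishOn E)
    (hnull : ∀ q ∈ E, ∀ Y, parA Y ρ q = 0 → levA ρ (fun j => (L j).1 q) Y q = 0)
    (hlevi : ∀ p ∈ E, ∀ v₀ : Fin n → ℂ, ∃ K : ℝ, ∀ᶠ x in 𝓝 (p, v₀),
      -K * (‖ρ.1 x.1‖ + ‖parA x.2 ρ x.1‖) ≤ (levA ρ x.2 x.2 x.1).re)
    (w : List (Derivation ℂ (smoothAlg n) (smoothAlg n)))
    (hw : ∀ Y ∈ w, LieGen (holDer L + antiDer L) (Complex.I • (holDer L - antiDer L)) Y) :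
    symb ρ w ∈ vanishOn E := by
  refine unitSpan_pow_le_comap (lamOp ρ) (vanishOn E) (aOp (holDer L)) (aOp (antiDer L))
    (lieOps L) rfl hρE ?_ ?_ ?_ ?_ ?_ w.length
      (prod_mem_unitSpan_pow w fun Y hY => aOp_mem_lieOps (hw Y hY))
  · intro r
    rw [lamOp_apply, Module.End.mul_apply, aOp_antiDer_one, map_zero, LinearMap.zero_apply]
  · intro r hr
    rw [lamOp_apply, Module.End.mul_apply, aOp_holDer_apply]
    exact hL _ hr
  · rw [lamOp_apply, aOp_holDer_apply]
    exact hL _ hρE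
  · intro c hc hcJ
    obtain ⟨C, hC, rfl⟩ := exists_of_mem_lieOps hc
    have hT := tangDer_of_lieGen hL hC
    rw [lamOp_apply, aOp_one_apply hT.coeffs] at hcJ
    have hpar : ∀ q ∈ E, parA (fun j => (C (zCoord j)).1 q) ρ q = 0 := by
      intro q hq
      have := mem_vanishOn.1 hcJ q hq
      rw [smoothAlg.sum_val] at this
      exact this
    constructor
    · rw [lamOp_apply, Module.End.mul_apply, aOp_apply]
      refine (vanishOn E).sub_mem (antiDer_mem hL _ ?_) ?_
      · rw [aOp_one_apply hT.coeffs]; exact hcJ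
      · rw [mem_vanishOn]
        intro q hq
        simp only [aOp_one_apply hT.coeffs, antiDer_cj_zCoord]
        rw [sum_mul_sum_eq_levA ρ (fun k => C (zCoord k)) L, ← levA_conj hρ, hnull q hq _ (hpar q hq),
          map_zero]
    · rw [lamOp_apply, Module.End.mul_apply, aOp_apply]
      refine (vanishOn E).sub_mem (hT.pres _ ?_) ?_
      · rw [aOp_holDer_apply]; exact hL _ hρE
      · rw [mem_vanishOn]
        intro q hq
        simp only [aOp_holDer_apply, Module.End.one_apply, hT.real, holDer_apply]
        rw [sum_mul_sum_eq_levA ρ L (fun k => C (zCoord k)), hnull q hq _ (hpar q hq)]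
  · intro k hk c hc hkc x hx
    obtain ⟨C, hC, rfl⟩ := exists_of_mem_lieOps hc
    obtain ⟨X, hX, rfl⟩ := exists_of_mem_lieOps hx
    have hmem : ∀ w : List (Derivation ℂ (smoothAlg n) (smoothAlg n)), (∀ Y ∈ w, Y = X ∨ Y = C) →
        w.length ≤ 2 * k + 1 → (w.map aOp).prod ∈ unitSpan (lieOps L) ^ (2 * k + 1) := by
      intro w hw hl
      refine unitSpan_pow_mono hl (prod_mem_unitSpan_pow w fun Y hY => ?_)
      rcases hw Y hY with rfl | rfl
      exacts [hx, hc]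
    have e1 : lamOp ρ (aOp C * aOp X ^ (2 * k + 1) * aOp C) =
        symb ρ (C :: (List.replicate (2 * k + 1) X ++ [C])) := by
      simp [symb, mul_assoc]
    rw [e1, mem_vanishOn]
    intro p hp
    refine symb_positivity hρ (tangDer_of_lieGen hL hX) (tangDer_of_lieGen hL hC)
      (odd_two_mul_add_one k) (fun w hw hl => hk (hmem w hw hl)) (fun w hw hl => ?_) hp
      (hlevi p hp)
    have := hkc _ (hmem w hw hl)
    rw [symb, List.map_append, List.prod_append, List.map_singleton, List.prod_singleton]
    exact this

theorem not_finiteTypePt_of_field {E : Set (Fin n → ℂ)} {ρ : smoothAlg n} (hρ : cj ρ = ρ)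
    {L : Fin n → smoothAlg n} (hρE : ρ ∈ vanishOn E)
    (hL : ∀ f ∈ vanishOn E, holDer L f ∈ vanishOn E)
    (hnull : ∀ q ∈ E, ∀ Y, parA Y ρ q = 0 → levA ρ (fun j => (L j).1 q) Y q = 0)
    (hlevi : ∀ p ∈ E, ∀ v₀ : Fin n → ℂ, ∃ K : ℝ, ∀ᶠ x in 𝓝 (p, v₀),
      -K * (‖ρ.1 x.1‖ + ‖parA x.2 ρ x.1‖) ≤ (levA ρ x.2 x.2 x.1).re)
    {p : Fin n → ℂ} (hp : p ∈ E) {j₀ : Fin n} (hj₀ : (L j₀).1 p ≠ 0) :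
    ¬ FiniteTypePt (fun z => (ρ.1 z).re) p := by
  rintro ⟨M, hM⟩
  set X := holDer L + antiDer L with hXdef
  have hX : LieGen (holDer L + antiDer L) (Complex.I • (holDer L - antiDer L)) X := LieGen.left
  have hT := tangDer_of_lieGen hL hX
  set N := M + 1 with hN
  set c : Fin n → ℕ → ℂ := fun j a => (wordApp (List.replicate a X) (zCoord j)).1 p with hc
  set γ : ℂ → Fin n → ℂ := fun t j => (jetCurve X X p N j).1 (Pi.single 0 t) with hγ
  have hγv : ∀ j t, γ t j = ∑ a ∈ Finset.range (N + 1), c j a / (a.factorial : ℂ) * t ^ a := by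
    intro j t
    simp [hγ, jetCurve, jetPoly_val, hc]
  have hγ0 : γ 0 = p := by
    funext j
    simp only [hγ, Pi.single_zero]
    exact jetCurve_zero X X p N j
  have hder : ∀ j, HasDerivAt (fun t => γ t j - p j) ((L j).1 p) 0 := by
    intro j
    have h1 : HasDerivAt (fun t : ℂ => ∑ a ∈ Finset.range (N + 1), c j a / (a.factorial : ℂ) * t ^ a)
        (∑ a ∈ Finset.range (N + 1), c j a / (a.factorial : ℂ) * ((a : ℂ) * 0 ^ (a - 1))) 0 :=
      HasDerivAt.fun_sum fun a _ => (hasDerivAt_pow a (0 : ℂ)).const_mul _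
    have h2 : (∑ a ∈ Finset.range (N + 1), c j a / (a.factorial : ℂ) * ((a : ℂ) * 0 ^ (a - 1))) =
        (L j).1 p := by
      rw [Finset.sum_eq_single 1]
      · have : X (zCoord j) = L j := by
          rw [hXdef, Derivation.add_apply, holDer_zCoord, antiDer_zCoord, add_zero]
        simp [hc, wordApp_cons, wordApp_nil, this]
      · intro a _ ha
        rcases Nat.eq_zero_or_pos a with rfl | h
        · simp
        · rw [zero_pow (by omega)]; simp
      · intro h; exact absurd (Finset.mem_range.2 (by omega)) h
    rw [h2] at h1
    have h3 := h1.sub_const (p j)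
    refine h3.congr_of_eventuallyEq (Filter.Eventually.of_forall fun t => ?_)
    change γ t j - p j = _
    rw [hγv]
  have horder : curveOrder γ p ≤ 1 := by
    refine (iInf_le _ j₀).trans (sInf_le ⟨1, ?_, by simp⟩)
    rw [Set.mem_ofPred_eq, iteratedDeriv_one, (hder j₀).deriv]
    exact hj₀
  have hflat : FlatAt N (pullb (jetCurve X X p N) ρ) := by
    intro a b hab
    rw [mixDer_pullb p hT hT ρ (by omega) (by omega)]
    refine mem_vanishOn.1 (mixSymb_of_symb_mem (fun Y hY => ?_) fun w hw _ => ?_) p hp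
    · rw [List.eq_of_mem_replicate hY]; exact hT.pres
    · refine symb_mem_vanishOn hρ hρE hL hnull hlevi _ fun Y hY => ?_
      rcases List.mem_append.1 hY with h | h
      · rw [List.eq_of_mem_replicate (hw Y h)]; exact hX
      · rw [List.eq_of_mem_replicate h]; exact hX
  have hcont : ContDiff ℝ (⊤ : ℕ∞) fun t : ℂ => (pullb (jetCurve X X p N) ρ).1 (Pi.single 0 t) :=
    (smoothAlg.contDiff _).comp ((ContinuousLinearMap.single ℝ (fun _ : Fin 2 => ℂ) 0).contDiff)
  have hordR : ((N + 1 : ℕ) : ℕ∞) ≤ orderR (fun t => (ρ.1 (γ t)).re) := by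
    refine le_sInf ?_
    rintro _ ⟨k, hk, rfl⟩
    rw [Set.mem_ofPred_eq] at hk
    by_contra hlt
    have hkN : k ≤ N := by
      have : k < N + 1 := ENat.natCast_lt_natCast.1 (not_le.1 hlt)
      omega
    refine hk ?_
    have e : (fun t => (ρ.1 (γ t)).re) = Complex.reCLM ∘
        fun t : ℂ => (pullb (jetCurve X X p N) ρ).1 (Pi.single 0 t) := rfl
    rw [e, ContinuousLinearMap.iteratedFDeriv_comp_left Complex.reCLM (hcont.contDiffAt) 
      (by exact_mod_cast le_top), hflat.iteratedFDeriv_eq_zero hkN]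
    ext; simp
  have hana : ∀ j, AnalyticAt ℂ (fun t => γ t j) 0 := by
    intro j
    simp only [hγv]
    fun_prop
  have hnc : ¬ ∀ᶠ t in nhds (0 : ℂ), γ t = p := by
    intro h
    have h2 : HasDerivAt (fun t => γ t j₀ - p j₀) 0 0 := by
      refine (hasDerivAt_const (0 : ℂ) (0 : ℂ)).congr_of_eventuallyEq ?_
      filter_upwards [h] with t ht
      rw [ht, sub_self]
    exact hj₀ ((hder j₀).unique h2)
  have h1 := hM γ hana hγ0 hnc
  have h2 : ((N + 1 : ℕ) : ℕ∞) ≤ (M : ℕ∞) * 1 :=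
    hordR.trans (h1.trans (mul_le_mul_right horder _))
  rw [mul_one] at h2
  have : N + 1 ≤ M := by exact_mod_cast h2
  omega

end CoreFinal

section RankLemma

/-- On a set where a family of smooth covector fields has a nontrivial common kernel at every point,
there is a smooth section of the common kernel that is nonzero somewhere. -/
theorem exists_smooth_kernel_section {n m : ℕ} {ι : Type*} (θ : ι → Fin m → smoothAlg n)
    {E : Set (Fin n → ℂ)} (hE : E.Nonempty)
    (hker : ∀ p ∈ E, ∃ v : Fin m → ℂ, v ≠ 0 ∧ ∀ i, ∑ j, v j * (θ i j).1 p = 0) :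
    ∃ p ∈ E, ∃ L : Fin m → smoothAlg n, (∃ j, (L j).1 p ≠ 0) ∧
      ∀ q ∈ E, ∀ i, ∑ j, (L j).1 q * (θ i j).1 q = 0 := by
  let P : ℕ → Prop := fun r => ∃ p ∈ E, ∃ (i : Fin r → ι) (c : Fin r → Fin m),
    (Matrix.of fun k l => (θ (i k) (c l)).1 p).det ≠ 0
  have hP0 : P 0 := by
    obtain ⟨p, hp⟩ := hE
    exact ⟨p, hp, Fin.elim0, Fin.elim0, by simp⟩
  have hinj : ∀ {r : ℕ} {p : Fin n → ℂ} {i : Fin r → ι} {c : Fin r → Fin m},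
      (Matrix.of fun k l => (θ (i k) (c l)).1 p).det ≠ 0 → Function.Injective c := by
    intro r p i c h a b hab
    by_contra hne
    exact h (Matrix.det_zero_of_column_eq hne fun k => by simp [hab])
  obtain ⟨r, ⟨p, hp, i, c, hdet⟩, hr1⟩ : ∃ r, P r ∧ ¬ P (r + 1) := by
    by_contra hcon
    push Not at hcon
    have hall : ∀ r, P r := fun r => Nat.rec hP0 (fun k hk => hcon k hk) r
    obtain ⟨p, _, i, c, h⟩ := hall (m + 1)
    have := Fintype.card_le_of_injective c (hinj h)
    simp at this
  obtain ⟨j₀, hj₀⟩ : ∃ j₀, ∀ l, c l ≠ j₀ := by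
    by_contra hcon
    push Not at hcon
    obtain ⟨v, hv, hv0⟩ := hker p hp
    refine hv ?_
    have hvc : (fun l => v (c l)) = 0 := by
      refine Matrix.eq_zero_of_mulVec_eq_zero hdet ?_
      funext k
      rw [Matrix.mulVec, Pi.zero_apply, ← hv0 (i k),
        ← (Equiv.ofBijective c ⟨hinj hdet, hcon⟩).sum_comp]
      exact Finset.sum_congr rfl fun l _ => mul_comm _ _
    funext j
    obtain ⟨l, rfl⟩ := hcon j
    exact congrFun hvc l
  let c' : Fin (r + 1) → Fin m := Fin.cons j₀ c
  let cof : Fin (r + 1) → smoothAlg n := fun l =>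
    (-1) ^ (l : ℕ) * (Matrix.of fun k l' => θ (i k) (c' (l.succAbove l'))).det
  have hcof : ∀ l q, (cof l).1 q = (-1) ^ (l : ℕ) *
      (Matrix.of fun k l' => (θ (i k) (c' (l.succAbove l'))).1 q).det := by
    intro l q
    rw [← smoothAlg.ev_apply]
    simp only [cof, map_mul, map_pow, map_neg, map_one, AlgHom.map_det]
    rfl
  let L : Fin m → smoothAlg n := fun j => ∑ l, if c' l = j then cof l else 0
  have hL : ∀ j q, (L j).1 q = ∑ l, if c' l = j then (cof l).1 q else 0 := by
    intro j q
    simp only [L, smoothAlg.sum_val]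
    refine Finset.sum_congr rfl fun l _ => ?_
    split_ifs <;> rfl
  refine ⟨p, hp, L, ⟨j₀, ?_⟩, ?_⟩
  · rw [hL, Fin.sum_univ_succ]
    have h1 : ∀ l : Fin r, (if c' l.succ = j₀ then (cof l.succ).1 p else 0) = 0 := by
      intro l
      rw [if_neg]; exact hj₀ l
    rw [Finset.sum_congr rfl fun l _ => h1 l, Finset.sum_const_zero, add_zero, if_pos (show c' 0 = j₀ from rfl), hcof]
    simpa [c'] using hdet
  · intro q hq a
    have h1 : (Matrix.of fun k l => (θ ((Fin.cons a i : Fin (r + 1) → ι) k) (c' l)).1 q).det = 0 := by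
      by_contra h
      exact hr1 ⟨q, hq, _, _, h⟩
    rw [Matrix.det_succ_row_zero] at h1
    rw [← h1]
    simp only [hL, Finset.sum_mul]
    rw [Finset.sum_comm]
    refine Finset.sum_congr rfl fun l _ => ?_
    simp only [ite_mul, zero_mul]
    rw [Finset.sum_ite_eq, if_pos (Finset.mem_univ _), hcof]
    simp only [Matrix.of_apply, Fin.cons_zero]
    have e : (Matrix.of fun k l => (θ ((Fin.cons a i : Fin (r + 1) → ι) k) (c' l)).1 q).submatrix
        Fin.succ l.succAbove = Matrix.of fun k l' => (θ (i k) (c' (l.succAbove l'))).1 q := by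
      ext; simp
    rw [e]; ring

end RankLemma

section InfiniteType

variable {n : ℕ}

theorem levA_add_right (ρ : smoothAlg n) (v w w' q : Fin n → ℂ) :
    levA ρ v (w + w') q = levA ρ v w q + levA ρ v w' q := by
  simp [levA, mul_add, Finset.sum_add_distrib]

theorem levA_smul_right (ρ : smoothAlg n) (c : ℂ) (v w q : Fin n → ℂ) :
    levA ρ v (c • w) q = (starRingEnd ℂ) c * levA ρ v w q := by
  simp only [levA, Finset.mul_sum, Pi.smul_apply, smul_eq_mul, map_mul]
  refine Finset.sum_congr rfl fun j _ => Finset.sum_congr rfl fun k _ => by ring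

theorem levA_add_left (ρ : smoothAlg n) (v v' w q : Fin n → ℂ) :
    levA ρ (v + v') w q = levA ρ v w q + levA ρ v' w q := by
  simp [levA, mul_add, add_mul, Finset.sum_add_distrib]

theorem levA_smul_left (ρ : smoothAlg n) (c : ℂ) (v w q : Fin n → ℂ) :
    levA ρ (c • v) w q = c * levA ρ v w q := by
  simp only [levA, Finset.mul_sum, Pi.smul_apply, smul_eq_mul]
  refine Finset.sum_congr rfl fun j _ => Finset.sum_congr rfl fun k _ => by ring

theorem levA_sum_right {κ : Type*} (s : Finset κ) (ρ : smoothAlg n) (v : Fin n → ℂ)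
    (w : κ → Fin n → ℂ) (q : Fin n → ℂ) :
    levA ρ v (∑ k ∈ s, w k) q = ∑ k ∈ s, levA ρ v (w k) q := by
  classical
  induction s using Finset.induction_on with
  | empty => simp [levA]
  | insert a s ha ih => rw [Finset.sum_insert ha, Finset.sum_insert ha, levA_add_right, ih]

/-- A compact-type set over which common null directions exist contains infinite type points. -/
theorem exists_not_finiteTypePt {E : Set (Fin n → ℂ)} (hE : E.Nonempty) {ρ : smoothAlg n}
    (hρ : cj ρ = ρ) (hρE : ρ ∈ vanishOn E) {W : Fin n → smoothAlg n}
    (hW : ∀ q ∈ E, parA (fun j => (W j).1 q) ρ q = 1)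
    (hlevi : ∀ p ∈ E, ∀ v₀ : Fin n → ℂ, ∃ K : ℝ, ∀ᶠ x in 𝓝 (p, v₀),
      -K * (‖ρ.1 x.1‖ + ‖parA x.2 ρ x.1‖) ≤ (levA ρ x.2 x.2 x.1).re)
    (hdir : ∀ p ∈ E, ∃ v : Fin n → ℂ, v ≠ 0 ∧ (∀ f ∈ vanishOn E, parA v f p = 0) ∧
      ∀ Y, parA Y ρ p = 0 → levA ρ v Y p = 0) :
    ∃ p ∈ E, ¬ FiniteTypePt (fun z => (ρ.1 z).re) p := by
  let τ : Fin n → Fin n → smoothAlg n := fun k l =>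
    (if l = k then 1 else 0) - dDer k ρ * W l
  have hτ : ∀ k q, (fun l => (τ k l).1 q) = Pi.single k 1 - (dDer k ρ).1 q • fun l => (W l).1 q := by
    intro k q
    funext l
    simp only [τ, smoothAlg.sub_val, smoothAlg.mul_val, Pi.sub_apply, Pi.smul_apply, smul_eq_mul,
      Pi.single_apply]
    split_ifs <;> rfl
  have hτpar : ∀ k, ∀ q ∈ E, parA (fun l => (τ k l).1 q) ρ q = 0 := by
    intro k q hq
    have h1 : parA (fun l => (τ k l).1 q) ρ q = (dDer k ρ).1 q -
        (dDer k ρ).1 q * parA (fun j => (W j).1 q) ρ q := by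
      rw [hτ]
      simp [parA, sub_mul, Finset.sum_sub_distrib, Finset.mul_sum, mul_assoc, Pi.single_apply]
    rw [h1, hW q hq, mul_one, sub_self]
  have hspan : ∀ q Y, parA Y ρ q = 0 → Y = ∑ k, Y k • fun l => (τ k l).1 q := by
    intro q Y hY
    simp only [hτ, smul_sub, Finset.sum_sub_distrib, smul_smul]
    rw [← Finset.sum_smul]
    change Y = _ - parA Y ρ q • _
    rw [hY, zero_smul, sub_zero]
    funext l
    simp [Finset.sum_apply, Pi.single_apply]
  let θ : (vanishOn E) ⊕ Fin n → Fin n → smoothAlg n := fun i j =>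
    Sum.elim (fun f : vanishOn E => dDer j f.1)
      (fun k => ∑ l, dDer j (dbDer l ρ) * cj (τ k l)) i
  have hθ : ∀ (v : Fin n → ℂ) q k, ∑ j, v j * (θ (Sum.inr k) j).1 q =
      levA ρ v (fun l => (τ k l).1 q) q := by
    intro v q k
    simp only [θ, Sum.elim_inr, smoothAlg.sum_val, smoothAlg.mul_val, cj_val, levA, Finset.mul_sum]
    refine Finset.sum_congr rfl fun j _ => Finset.sum_congr rfl fun l _ => by ring
  obtain ⟨p, hp, L, ⟨j₀, hj₀⟩, hL⟩ := exists_smooth_kernel_section θ hE (by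
    intro p hp
    obtain ⟨v, hv, h1, h2⟩ := hdir p hp
    refine ⟨v, hv, ?_⟩
    rintro (f | k)
    · exact h1 f.1 f.2
    · rw [hθ]; exact h2 _ (hτpar k p hp))
  refine ⟨p, hp, not_finiteTypePt_of_field hρ (L := L) hρE ?_ ?_ hlevi hp hj₀⟩
  · intro f hf
    rw [mem_vanishOn]
    intro q hq
    rw [holDer_apply, smoothAlg.sum_val, ← hL q hq (Sum.inl ⟨f, hf⟩)]
    rfl
  · intro q hq Y hY
    rw [hspan q Y hY, levA_sum_right]
    refine Finset.sum_eq_zero fun k _ => ?_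
    rw [levA_smul_right, ← hθ, hL q hq, mul_zero]

end InfiniteType

section Germs

variable {n : ℕ}

theorem dz_congr {f g : (Fin n → ℂ) → ℂ} {z : Fin n → ℂ} (h : f =ᶠ[𝓝 z] g) (j : Fin n) :
    dz j f z = dz j g z := by
  rw [dz, dz, h.fderiv_eq]

theorem dzbar_congr {f g : (Fin n → ℂ) → ℂ} {z : Fin n → ℂ} (h : f =ᶠ[𝓝 z] g) (j : Fin n) :
    dzbar j f z = dzbar j g z := by
  rw [dzbar, dzbar, h.fderiv_eq]

theorem cplx_congr {f g : (Fin n → ℂ) → ℝ} {z : Fin n → ℂ} (h : f =ᶠ[𝓝 z] g) :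
    cplx f =ᶠ[𝓝 z] cplx g := by
  filter_upwards [h] with w hw
  rw [cplx, cplx, hw]

theorem levi_congr {f g : (Fin n → ℂ) → ℝ} {z : Fin n → ℂ} (h : f =ᶠ[𝓝 z] g) (X Y : Fin n → ℂ) :
    levi f X Y z = levi g X Y z := by
  rw [levi, levi]
  refine Finset.sum_congr rfl fun j _ => Finset.sum_congr rfl fun k _ => ?_
  congr 2
  refine dz_congr ?_ j
  filter_upwards [h.eventuallyEq_nhds] with w hw
  exact dzbar_congr (cplx_congr hw) k

theorem dirDeriv_congr {f g : (Fin n → ℂ) → ℂ} {z : Fin n → ℂ} (h : f =ᶠ[𝓝 z] g)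
    (X : Fin n → ℂ) : dirDeriv X f z = dirDeriv X g z := by
  rw [dirDeriv, dirDeriv]
  exact Finset.sum_congr rfl fun j _ => by rw [dz_congr h]

theorem finiteTypePt_congr {f g : (Fin n → ℂ) → ℝ} {p : Fin n → ℂ} (h : f =ᶠ[𝓝 p] g) :
    FiniteTypePt f p ↔ FiniteTypePt g p := by
  have key : ∀ f g : (Fin n → ℂ) → ℝ, f =ᶠ[𝓝 p] g → FiniteTypePt f p → FiniteTypePt g p := by
    rintro f g h ⟨M, hM⟩
    refine ⟨M, fun γ hγ h0 hc => ?_⟩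
    convert hM γ hγ h0 hc using 1
    have hcont : Filter.Tendsto γ (𝓝 0) (𝓝 p) := by
      have : ContinuousAt γ 0 := continuousAt_pi.2 fun j => (hγ j).continuousAt
      rw [ContinuousAt, h0] at this
      exact this
    have he : (fun t => g (γ t)) =ᶠ[𝓝 0] fun t => f (γ t) := by
      filter_upwards [hcont.eventually h] with t ht using ht.symm
    rw [orderR, orderR]
    simp only [(he.iteratedFDeriv ℝ _).eq_of_nhds]
  exact ⟨key f g h, key g f h.symm⟩

end Germs

section Calculus

variable {n : ℕ}

theorem exists_cutoff {K U : Set (Fin n → ℂ)} (hK : IsClosed K) (hU : IsOpen U) (hKU : K ⊆ U) :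
    ∃ χ : (Fin n → ℂ) → ℝ, ContDiff ℝ (⊤ : ℕ∞) χ ∧ (∀ᶠ x in 𝓝ˢ K, χ x = 1) ∧
      (∀ᶠ x in 𝓝ˢ Uᶜ, χ x = 0) ∧ ∀ x, χ x ∈ Set.Icc (0 : ℝ) 1 := by
  obtain ⟨f, h0, h1, h2⟩ := exists_contMDiffMap_zero_one_nhds_of_isClosed
    (n := (⊤ : ℕ∞)) (modelWithCornersSelf ℝ (Fin n → ℂ)) hU.isClosed_compl hK
    (Set.disjoint_left.2 fun x hx hx' => hx (hKU hx'))
  exact ⟨f, f.contMDiff.contDiff, h1, h0, h2⟩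

theorem contDiff_cutoff_smul {F : Type*} [NormedAddCommGroup F] [NormedSpace ℝ F]
    {U : Set (Fin n → ℂ)} (hU : IsOpen U) {χ : (Fin n → ℂ) → ℝ}
    (hχ : ContDiff ℝ (⊤ : ℕ∞) χ) (h0 : ∀ᶠ x in 𝓝ˢ Uᶜ, χ x = 0) {f : (Fin n → ℂ) → F}
    (hf : ContDiffOn ℝ (⊤ : ℕ∞) f U) : ContDiff ℝ (⊤ : ℕ∞) fun x => χ x • f x := by
  rw [contDiff_iff_contDiffAt]
  intro x
  by_cases hx : x ∈ U
  · exact hχ.contDiffAt.smul (hf.contDiffAt (hU.mem_nhds hx))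
  · have : (fun x => χ x • f x) =ᶠ[𝓝 x] fun _ => 0 := by
      filter_upwards [(Filter.Eventually.filter_mono (nhds_le_nhdsSet hx) h0)] with y hy
      rw [hy, zero_smul]
    exact contDiffAt_const.congr_of_eventuallyEq this

theorem fderiv_cplx {f : (Fin n → ℂ) → ℝ} {z : Fin n → ℂ} (hf : DifferentiableAt ℝ f z)
    (v : Fin n → ℂ) : fderiv ℝ (cplx f) z v = (fderiv ℝ f z v : ℂ) := by
  have := (Complex.ofRealCLM.hasFDerivAt.comp z hf.hasFDerivAt).fderiv
  change fderiv ℝ (fun x => ((f x : ℝ) : ℂ)) z v = _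
  change fderiv ℝ (fun x => ((f x : ℝ) : ℂ)) z = _ at this
  rw [this]; rfl

theorem contDiffAt_cplx {f : (Fin n → ℂ) → ℝ} {z : Fin n → ℂ} {m : WithTop ℕ∞}
    (hf : ContDiffAt ℝ m f z) : ContDiffAt ℝ m (cplx f) z :=
  Complex.ofRealCLM.contDiff.contDiffAt.comp z hf

theorem dzbar_cplx {f : (Fin n → ℂ) → ℝ} {z : Fin n → ℂ} (hf : DifferentiableAt ℝ f z)
    (j : Fin n) : dzbar j (cplx f) z = (starRingEnd ℂ) (dz j (cplx f) z) := by
  rw [dz, dzbar, fderiv_cplx hf, fderiv_cplx hf]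
  simp [Complex.conj_ofNat]

theorem dz_mul {f g : (Fin n → ℂ) → ℂ} {z : Fin n → ℂ} (hf : DifferentiableAt ℝ f z)
    (hg : DifferentiableAt ℝ g z) (j : Fin n) :
    dz j (fun w => f w * g w) z = dz j f z * g z + f z * dz j g z := by
  rw [dz, dz, dz, fderiv_fun_mul hf hg]
  simp only [add_apply, smul_apply, smul_eq_mul]
  ring

theorem fderiv_cplx_comp {f : (Fin n → ℂ) → ℝ} {g : ℝ → ℝ} {z : Fin n → ℂ}
    (hf : DifferentiableAt ℝ f z) (hg : DifferentiableAt ℝ g (f z)) (v : Fin n → ℂ) :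
    fderiv ℝ (cplx fun w => g (f w)) z v = ((deriv g (f z) : ℝ) : ℂ) * fderiv ℝ (cplx f) z v := by
  have h := hg.hasDerivAt.comp_hasFDerivAt z hf.hasFDerivAt
  change HasFDerivAt (fun w => g (f w)) _ _ at h
  rw [fderiv_cplx h.differentiableAt, fderiv_cplx hf, h.fderiv]
  simp

theorem dz_cplx_comp {f : (Fin n → ℂ) → ℝ} {g : ℝ → ℝ} {z : Fin n → ℂ}
    (hf : DifferentiableAt ℝ f z) (hg : DifferentiableAt ℝ g (f z)) (j : Fin n) :
    dz j (cplx fun w => g (f w)) z = ((deriv g (f z) : ℝ) : ℂ) * dz j (cplx f) z := by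
  rw [dz, dz, fderiv_cplx_comp hf hg, fderiv_cplx_comp hf hg]; ring

theorem dzbar_cplx_comp {f : (Fin n → ℂ) → ℝ} {g : ℝ → ℝ} {z : Fin n → ℂ}
    (hf : DifferentiableAt ℝ f z) (hg : DifferentiableAt ℝ g (f z)) (j : Fin n) :
    dzbar j (cplx fun w => g (f w)) z = ((deriv g (f z) : ℝ) : ℂ) * dzbar j (cplx f) z := by
  rw [dzbar, dzbar, fderiv_cplx_comp hf hg, fderiv_cplx_comp hf hg]; ring

theorem contDiffAt_dzbar {f : (Fin n → ℂ) → ℂ} {z : Fin n → ℂ} {m k : WithTop ℕ∞}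
    (hf : ContDiffAt ℝ m f z) (hk : k + 1 ≤ m) (j : Fin n) : ContDiffAt ℝ k (dzbar j f) z := by
  have h := hf.fderiv_right hk
  have h1 : ∀ v, ContDiffAt ℝ k (fun w => fderiv ℝ f w v) z := fun v =>
    h.clm_apply contDiffAt_const
  exact ((h1 _).add (contDiffAt_const.mul (h1 _))).div_const _

/-- The Levi form of a composition with a function of one real variable. -/
theorem levi_comp {f : (Fin n → ℂ) → ℝ} {g : ℝ → ℝ} {z : Fin n → ℂ}
    (hf : ContDiffAt ℝ 2 f z) (hg : ContDiffAt ℝ 2 g (f z)) (X Y : Fin n → ℂ) :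
    levi (fun w => g (f w)) X Y z = ((deriv g (f z) : ℝ) : ℂ) * levi f X Y z +
      ((deriv (deriv g) (f z) : ℝ) : ℂ) * (dirDeriv X (cplx f) z *
        (starRingEnd ℂ) (dirDeriv Y (cplx f) z)) := by
  have hg1 : ContDiffAt ℝ 1 (deriv g) (f z) := by
    have h1 : ContDiffAt ℝ 1 (fun t => fderiv ℝ g t 1) (f z) :=
      (hg.fderiv_right (m := 1) (by norm_num)).clm_apply contDiffAt_const
    exact h1.congr_of_eventuallyEq (Filter.Eventually.of_forall fun t => by simp)
  have hev : ∀ᶠ w in 𝓝 z, DifferentiableAt ℝ f w ∧ DifferentiableAt ℝ g (f w) := by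
    have h1 : ∀ᶠ w in 𝓝 z, ContDiffAt ℝ 1 f w := (hf.of_le (by norm_num)).eventually (by simp)
    have h2 : ∀ᶠ t in 𝓝 (f z), ContDiffAt ℝ 1 g t := (hg.of_le (by norm_num)).eventually (by simp)
    filter_upwards [h1, hf.continuousAt.eventually h2] with w h1 h2
    exact ⟨h1.differentiableAt (by simp), h2.differentiableAt (by simp)⟩
  have hd : DifferentiableAt ℝ f z := hf.differentiableAt (by simp)
  have key : ∀ j k, dz j (fun w => dzbar k (cplx fun w => g (f w)) w) z =
      ((deriv g (f z) : ℝ) : ℂ) * dz j (fun w => dzbar k (cplx f) w) z +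
      ((deriv (deriv g) (f z) : ℝ) : ℂ) * (dz j (cplx f) z * (starRingEnd ℂ) (dz k (cplx f) z)) := by
    intro j k
    have e : (fun w => dzbar k (cplx fun w => g (f w)) w) =ᶠ[𝓝 z]
        fun w => (cplx fun w => deriv g (f w)) w * dzbar k (cplx f) w := by
      filter_upwards [hev] with w hw
      exact dzbar_cplx_comp hw.1 hw.2 k
    have h1 : DifferentiableAt ℝ (cplx fun w => deriv g (f w)) z :=
      (contDiffAt_cplx (hg1.comp z (hf.of_le (by norm_num)))).differentiableAt (by simp)
    have h2 : DifferentiableAt ℝ (fun w => dzbar k (cplx f) w) z :=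
      (contDiffAt_dzbar (k := 1) (contDiffAt_cplx hf) (by norm_num) k).differentiableAt (by simp)
    rw [dz_congr e, dz_mul h1 h2, dz_cplx_comp hd (hg1.differentiableAt (by simp)), ← dzbar_cplx hd]
    simp only [cplx]
    ring
  simp only [levi, key, dirDeriv, map_sum, map_mul, Finset.mul_sum, Finset.sum_mul, add_mul,
    Finset.sum_add_distrib]
  congr 1
  · refine Finset.sum_congr rfl fun j _ => Finset.sum_congr rfl fun k _ => by ring
  · rw [Finset.sum_comm]
    refine Finset.sum_congr rfl fun j _ => Finset.sum_congr rfl fun k _ => by ring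

theorem dirDeriv_comp {f : (Fin n → ℂ) → ℝ} {g : ℝ → ℝ} {z : Fin n → ℂ}
    (hf : DifferentiableAt ℝ f z) (hg : DifferentiableAt ℝ g (f z)) (X : Fin n → ℂ) :
    dirDeriv X (cplx fun w => g (f w)) z = ((deriv g (f z) : ℝ) : ℂ) * dirDeriv X (cplx f) z := by
  simp only [dirDeriv, dz_cplx_comp hf hg, Finset.mul_sum]
  exact Finset.sum_congr rfl fun j _ => by ring

end Calculus

section PositiveFunctional

variable {X : Type*} [TopologicalSpace X]

theorem contMap_nonneg_iff {h : C(X, ℝ)} : 0 ≤ h ↔ ∀ x, 0 ≤ h x := Iff.rfl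

theorem abs_apply_le_of_nonneg {Λ : C(X, ℝ) →ₗ[ℝ] ℝ} (hΛ : ∀ h, 0 ≤ h → 0 ≤ Λ h)
    {h k : C(X, ℝ)} (hk : ∀ x, |h x| ≤ k x) : |Λ h| ≤ Λ k := by
  rw [abs_le]
  constructor
  · have := hΛ (k + h) (contMap_nonneg_iff.2 fun x => by
      have := (abs_le.1 (hk x)).1
      rw [ContinuousMap.add_apply]; linarith)
    rw [map_add] at this; linarith
  · have := hΛ (k - h) (contMap_nonneg_iff.2 fun x => by
      have := (abs_le.1 (hk x)).2
      rw [ContinuousMap.sub_apply]; linarith)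
    rw [map_sub] at this; linarith

variable [CompactSpace X]

/-- The support of a positive functional. -/
def funcSupport (Λ : C(X, ℝ) →ₗ[ℝ] ℝ) : Set X :=
  {x | ∀ h : C(X, ℝ), 0 ≤ h → 0 < h x → 0 < Λ h}

theorem apply_eq_zero_of_eqOn_funcSupport {Λ : C(X, ℝ) →ₗ[ℝ] ℝ} (hΛ : ∀ h, 0 ≤ h → 0 ≤ Λ h)
    {h : C(X, ℝ)} (hh : ∀ x ∈ funcSupport Λ, h x = 0) : Λ h = 0 := by
  have h1 : 0 ≤ Λ 1 := hΛ 1 (contMap_nonneg_iff.2 fun x => by simp)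
  have key : ∀ ε : ℝ, 0 < ε → |Λ h| ≤ ε * Λ 1 := by
    intro ε hε
    have hS : IsCompact {x | ε ≤ |h x|} :=
      (isClosed_le continuous_const h.continuous.abs).isCompact
    have hex : ∀ x : X, ∃ k : C(X, ℝ), 0 ≤ k ∧ Λ k = 0 ∧ (ε ≤ |h x| → 0 < k x) := by
      intro x
      by_cases hx : ε ≤ |h x|
      · have : x ∉ funcSupport Λ := fun hx' => by
          rw [hh x hx', abs_zero] at hx; linarith
        rw [funcSupport, Set.mem_ofPred_eq] at this
        push Not at this
        obtain ⟨k, hk0, hkx, hk⟩ := this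
        exact ⟨k, hk0, le_antisymm hk (hΛ k hk0), fun _ => hkx⟩
      · exact ⟨0, le_refl _, map_zero _, fun h' => absurd h' hx⟩
    choose k hk0 hkΛ hkx using hex
    obtain ⟨t, ht⟩ := hS.elim_finite_subcover (fun x => {y | 0 < k x y})
      (fun x => isOpen_lt continuous_const (k x).continuous) (fun x hx => by
        rw [Set.mem_iUnion]; exact ⟨x, by rw [Set.mem_ofPred_eq] at hx ⊢; exact hkx x hx⟩)
    set H : C(X, ℝ) := ∑ x ∈ t, k x with hH
    have hH0 : ∀ y, 0 ≤ H y := fun y => by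
      rw [hH, ContinuousMap.sum_apply]; exact Finset.sum_nonneg fun x _ => hk0 x y
    have hHΛ : Λ H = 0 := by rw [hH, map_sum]; exact Finset.sum_eq_zero fun x _ => hkΛ x
    have hHpos : ∀ y, ε ≤ |h y| → 0 < H y := fun y hy => by
      obtain ⟨x, hx⟩ := Set.mem_iUnion.1 (ht (show y ∈ {x | ε ≤ |h x|} from by
        rw [Set.mem_ofPred_eq]; exact hy))
      obtain ⟨hxt, hx⟩ := Set.mem_iUnion.1 hx
      rw [Set.mem_ofPred_eq] at hx
      rw [hH, ContinuousMap.sum_apply]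
      exact Finset.sum_pos' (fun x _ => hk0 x y) ⟨x, hxt, hx⟩
    obtain ⟨M, hM⟩ : ∃ M : ℝ, ∀ y, |h y| ≤ ε + M * H y := by
      by_cases hne : ({x | ε ≤ |h x|} : Set X).Nonempty
      · obtain ⟨y₀, hy₀, hmin⟩ := hS.exists_isMinOn hne H.continuous.continuousOn
        rw [Set.mem_ofPred_eq] at hy₀
        have hm := hHpos y₀ hy₀
        refine ⟨‖h‖ / H y₀, fun y => ?_⟩
        by_cases hy : ε ≤ |h y|
        · have h2 : H y₀ ≤ H y := hmin (by rw [Set.mem_ofPred_eq]; exact hy)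
          have h3 : |h y| ≤ ‖h‖ := h.norm_coe_le_norm y
          have h4 : ‖h‖ ≤ ‖h‖ / H y₀ * H y := by
            rw [div_mul_eq_mul_div, le_div_iff₀ hm]
            exact mul_le_mul_of_nonneg_left h2 (norm_nonneg _)
          linarith
        · have : 0 ≤ ‖h‖ / H y₀ * H y := by have := hH0 y; positivity
          linarith
      · refine ⟨0, fun y => ?_⟩
        have : ¬ ε ≤ |h y| := fun hy => hne ⟨y, by rw [Set.mem_ofPred_eq]; exact hy⟩
        linarith
    have := abs_apply_le_of_nonneg hΛ (h := h) (k := ε • 1 + M • H) (fun x => by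
      simpa using hM x)
    rw [map_add, map_smul, map_smul, hHΛ] at this
    simpa using this
  by_contra hne
  have hpos := abs_pos.2 hne
  have := key (|Λ h| / (2 * (Λ 1 + 1))) (by positivity)
  have h2 : |Λ h| / (2 * (Λ 1 + 1)) * Λ 1 ≤ |Λ h| / 2 := by
    rw [div_mul_eq_mul_div, div_le_div_iff₀ (by positivity) (by positivity)]
    nlinarith
  linarith

/-- Either a convex set of functions contains one exceeding `-G`, or a positive functional bounded
above on it charges the set where `G` is small. -/
theorem exists_positive_functional (G : C(X, ℝ)) {t : Set C(X, ℝ)} (ht : Convex ℝ t)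
    (h0 : (0 : C(X, ℝ)) ∈ t) (hno : ∀ h ∈ t, ¬ ∀ x, 0 < h x + G x) {c : ℝ} (hc : 0 < c) :
    ∃ (Λ : C(X, ℝ) →ₗ[ℝ] ℝ) (K₀ : ℝ) (θ : C(X, ℝ)) (S : Set X),
      (∀ h, 0 ≤ h → 0 ≤ Λ h) ∧ (∀ h ∈ t, Λ h ≤ K₀) ∧ 0 ≤ θ ∧ S.Nonempty ∧ (∀ x ∈ S, G x ≤ c) ∧
      (∀ h, (∀ x ∈ S, h x = 0) → Λ (θ * h) = 0) ∧
      ∀ x ∈ S, ∀ h : C(X, ℝ), 0 ≤ h → 0 < h x → 0 < Λ (θ * h) := by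
  set s : Set C(X, ℝ) := {h | ∀ x, 0 < h x + G x} with hs
  have hs_conv : Convex ℝ s := by
    intro f hf g hg a b ha hb hab
    rw [hs, Set.mem_ofPred_eq] at hf hg ⊢
    intro x
    have h1 := hf x
    have h2 := hg x
    have : (a • f + b • g) x + G x = a * (f x + G x) + b * (g x + G x) := by
      simp only [ContinuousMap.add_apply, ContinuousMap.smul_apply, smul_eq_mul]
      linear_combination (-(G x)) * hab
    rw [this]
    rcases ha.lt_or_eq with ha | ha
    · have := mul_pos ha h1; have := mul_nonneg hb h2.le; linarith
    · subst ha
      have : b = 1 := by linarith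
      subst this; linarith
  have hs_open : IsOpen s := by
    have h1 : IsOpen {f : C(X, ℝ) | Set.MapsTo f Set.univ (Set.Ioi 0)} :=
      ContinuousMap.isOpen_setOfPred_mapsTo isCompact_univ isOpen_Ioi
    have h2 := h1.preimage (continuous_add_const G)
    convert h2 using 1
    ext f
    rw [hs, Set.mem_ofPred_eq, Set.mem_preimage, Set.mem_ofPred_eq]
    exact ⟨fun h x _ => h x, fun h x => h (Set.mem_univ x)⟩
  have hdisj : Disjoint s t := Set.disjoint_left.2 fun h h1 h2 => by
    rw [hs, Set.mem_ofPred_eq] at h1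
    exact hno h h2 h1
  obtain ⟨f, u, hfs, hft⟩ := geometric_hahn_banach_open hs_conv hs_open ht hdisj
  have hu : u ≤ 0 := by simpa using hft 0 h0
  set Λ : C(X, ℝ) →ₗ[ℝ] ℝ := -f.toLinearMap with hΛd
  have hΛa : ∀ h, Λ h = - f h := fun h => rfl
  have hΛs : ∀ h : C(X, ℝ), (∀ x, 0 < h x + G x) → 0 < Λ h := fun h hh => by
    rw [hΛa]
    have := hfs h (by rw [hs, Set.mem_ofPred_eq]; exact hh)
    linarith
  have hΛ : ∀ h, 0 ≤ h → 0 ≤ Λ h := by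
    intro h hh
    by_contra hneg
    push Not at hneg
    set N := (Λ (-G + 1)) / (-Λ h) with hN
    have hpos : 0 < Λ (-G + 1) := hΛs _ fun x => by simp
    have hN0 : 0 ≤ N := div_nonneg hpos.le (by linarith)
    have := hΛs (-G + 1 + N • h) fun x => by
      have := mul_nonneg hN0 (contMap_nonneg_iff.1 hh x)
      simp only [ContinuousMap.add_apply, ContinuousMap.neg_apply, ContinuousMap.one_apply,
        ContinuousMap.smul_apply, smul_eq_mul]
      linarith
    rw [map_add, map_smul, smul_eq_mul, hN, div_mul_eq_mul_div, div_neg, mul_div_assoc,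
      div_self hneg.ne] at this
    linarith
  have hΛ1 : 0 < Λ 1 := by
    rcases (hΛ 1 (contMap_nonneg_iff.2 fun x => by simp)).lt_or_eq with h | h
    · exact h
    · have h1 := hΛs (-G + 1) fun x => by simp
      have h2 := abs_apply_le_of_nonneg hΛ (h := -G + 1) (k := ‖-G + 1‖ • 1) (fun x => by
        simpa using (-G + 1).norm_coe_le_norm x)
      rw [map_smul, ← h, smul_zero] at h2
      rw [abs_of_pos h1] at h2
      linarith
  have hΛG : Λ G ≤ 0 := by
    by_contra hpos
    push Not at hpos
    have := hΛs (-G + (Λ G / Λ 1) • 1) fun x => by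
      have : 0 < Λ G / Λ 1 := by positivity
      simp only [ContinuousMap.add_apply, ContinuousMap.neg_apply, ContinuousMap.one_apply,
        ContinuousMap.smul_apply, smul_eq_mul]
      linarith
    rw [map_add, map_neg, map_smul, smul_eq_mul, div_mul_cancel₀ _ hΛ1.ne'] at this
    linarith
  set θ : C(X, ℝ) := (c • 1 - G) ⊔ 0 with hθ
  have hθ0 : 0 ≤ θ := le_sup_right
  set Λ₁ : C(X, ℝ) →ₗ[ℝ] ℝ := Λ ∘ₗ LinearMap.mulLeft ℝ θ with hΛ₁
  have hΛ₁a : ∀ h, Λ₁ h = Λ (θ * h) := fun h => rfl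
  have hΛ₁p : ∀ h, 0 ≤ h → 0 ≤ Λ₁ h := fun h hh => hΛ _ (mul_nonneg hθ0 hh)
  have hΛ₁1 : 0 < Λ₁ 1 := by
    rw [hΛ₁a, mul_one]
    have := hΛ (θ - (c • 1 - G)) (sub_nonneg.2 le_sup_left)
    rw [map_sub, map_sub, map_smul, smul_eq_mul] at this
    have := mul_pos hc hΛ1
    linarith
  refine ⟨Λ, -u, θ, funcSupport Λ₁, hΛ, fun h hh => ?_, hθ0, ?_, ?_, ?_, ?_⟩
  · rw [hΛa]; linarith [hft h hh]
  · by_contra hemp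
    rw [Set.not_nonempty_iff_eq_empty] at hemp
    have := apply_eq_zero_of_eqOn_funcSupport hΛ₁p (h := 1) (by simp [hemp])
    linarith
  · intro x hx
    by_contra hGx
    push Not at hGx
    rw [funcSupport, Set.mem_ofPred_eq] at hx
    have := hx ((G - c • 1) ⊔ 0) le_sup_right (by
      rw [ContinuousMap.sup_apply]
      exact lt_sup_of_lt_left (by simpa using hGx))
    rw [hΛ₁a] at this
    have hz : θ * ((G - c • 1) ⊔ 0) = 0 := by
      ext y
      simp only [hθ, ContinuousMap.mul_apply, ContinuousMap.sup_apply, ContinuousMap.sub_apply,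
        ContinuousMap.smul_apply, ContinuousMap.one_apply, ContinuousMap.coe_zero, Pi.zero_apply,
        smul_eq_mul, mul_one]
      rcases le_total c (G y) with h | h
      · rw [sup_of_le_right (by linarith : c - G y ≤ 0), zero_mul]
      · rw [sup_of_le_right (by linarith : G y - c ≤ 0), mul_zero]
    rw [hz, map_zero] at this
    exact lt_irrefl _ this
  · intro h hh
    exact apply_eq_zero_of_eqOn_funcSupport hΛ₁p hh
  · intro x hx h hh hx'
    rw [funcSupport, Set.mem_ofPred_eq] at hx
    exact hx h hh hx'

end PositiveFunctional

section Links

variable {n : ℕ}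

/-- The real part of a smooth function. -/
def rePart (f : smoothAlg n) (z : Fin n → ℂ) : ℝ := (f.1 z).re

theorem ofReal_rePart {f : smoothAlg n} (hf : cj f = f) (z : Fin n → ℂ) :
    ((rePart f z : ℝ) : ℂ) = f.1 z := by
  have h : (starRingEnd ℂ) (f.1 z) = f.1 z := by rw [← cj_val, hf]
  exact Complex.conj_eq_iff_re.1 h

theorem cplx_rePart {f : smoothAlg n} (hf : cj f = f) : cplx (rePart f) = f.1 :=
  funext fun z => ofReal_rePart hf z

theorem abs_rePart {f : smoothAlg n} (hf : cj f = f) (z : Fin n → ℂ) :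
    |rePart f z| = ‖f.1 z‖ := by
  rw [← ofReal_rePart hf z, Complex.norm_real, Real.norm_eq_abs]

theorem contDiff_rePart (f : smoothAlg n) : ContDiff ℝ (⊤ : ℕ∞) (rePart f) :=
  Complex.reCLM.contDiff.comp (smoothAlg.contDiff f)

theorem levA_eq_levi {f : smoothAlg n} (hf : cj f = f) (v w q : Fin n → ℂ) :
    levA f v w q = levi (rePart f) v w q := by
  rw [levA, levi, cplx_rePart hf]
  refine Finset.sum_congr rfl fun j _ => Finset.sum_congr rfl fun k _ => ?_
  have : (fun w => dzbar k f.1 w) = (dbDer k f).1 := funext fun w => (dbDer_val k f w).symm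
  rw [this, dDer_val]

theorem parA_eq_dirDeriv (f : smoothAlg n) (v q : Fin n → ℂ) : parA v f q = dirDeriv v f.1 q := by
  rw [parA, dirDeriv]
  exact Finset.sum_congr rfl fun j _ => by rw [dDer_val]

theorem parA_eq_dirDeriv_cplx {f : smoothAlg n} (hf : cj f = f) (v q : Fin n → ℂ) :
    parA v f q = dirDeriv v (cplx (rePart f)) q := by
  rw [parA_eq_dirDeriv, cplx_rePart hf]

variable {F : Type*} [NormedAddCommGroup F] [NormedSpace ℝ F]

theorem contDiff_levA (f : smoothAlg n) {q v w : F → Fin n → ℂ}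
    (hq : ContDiff ℝ (⊤ : ℕ∞) q) (hv : ContDiff ℝ (⊤ : ℕ∞) v) (hw : ContDiff ℝ (⊤ : ℕ∞) w) :
    ContDiff ℝ (⊤ : ℕ∞) fun x => levA f (v x) (w x) (q x) := by
  unfold levA
  refine ContDiff.sum fun j _ => ContDiff.sum fun k _ => ?_
  refine (((smoothAlg.contDiff _).comp hq).mul (contDiff_pi.1 hv j)).mul ?_
  exact Complex.conjCLE.contDiff.comp (contDiff_pi.1 hw k)

theorem contDiff_parA (f : smoothAlg n) {q v : F → Fin n → ℂ}
    (hq : ContDiff ℝ (⊤ : ℕ∞) q) (hv : ContDiff ℝ (⊤ : ℕ∞) v) :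
    ContDiff ℝ (⊤ : ℕ∞) fun x => parA (v x) f (q x) := by
  unfold parA
  exact ContDiff.sum fun j _ => (contDiff_pi.1 hv j).mul ((smoothAlg.contDiff _).comp hq)

theorem continuous_levA (f : smoothAlg n) :
    Continuous fun x : (Fin n → ℂ) × (Fin n → ℂ) => levA f x.2 x.2 x.1 :=
  (contDiff_levA f contDiff_fst contDiff_snd contDiff_snd).continuous

theorem continuous_parA (f : smoothAlg n) :
    Continuous fun x : (Fin n → ℂ) × (Fin n → ℂ) => parA x.2 f x.1 :=
  (contDiff_parA f contDiff_fst contDiff_snd).continuous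

theorem levA_add_fun (f g : smoothAlg n) (v w q : Fin n → ℂ) :
    levA (f + g) v w q = levA f v w q + levA g v w q := by
  simp only [levA, map_add, smoothAlg.add_val, add_mul, Finset.sum_add_distrib]

theorem levA_smul_fun (c : ℂ) (f : smoothAlg n) (v w q : Fin n → ℂ) :
    levA (c • f) v w q = c * levA f v w q := by
  simp only [levA, Derivation.map_smul, smoothAlg.smul_val, Finset.mul_sum, mul_assoc]

theorem parA_add_fun (f g : smoothAlg n) (v q : Fin n → ℂ) :
    parA v (f + g) q = parA v f q + parA v g q := by
  simp only [parA, map_add, smoothAlg.add_val, mul_add, Finset.sum_add_distrib]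

theorem parA_smul_fun (c : ℂ) (f : smoothAlg n) (v q : Fin n → ℂ) :
    parA v (c • f) q = c * parA v f q := by
  simp only [parA, Derivation.map_smul, smoothAlg.smul_val, Finset.mul_sum]
  exact Finset.sum_congr rfl fun j _ => by ring

theorem parA_add (f : smoothAlg n) (v w q : Fin n → ℂ) :
    parA (v + w) f q = parA v f q + parA w f q := by
  simp only [parA, Pi.add_apply, add_mul, Finset.sum_add_distrib]

theorem parA_smul (f : smoothAlg n) (c : ℂ) (v q : Fin n → ℂ) :
    parA (c • v) f q = c * parA v f q := by
  simp only [parA, Pi.smul_apply, smul_eq_mul, Finset.mul_sum, mul_assoc]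

/-- Composition of a real smooth function with a smooth function of one variable. -/
def compReal (g : ℝ → ℝ) (hg : ContDiff ℝ (⊤ : ℕ∞) g) (f : smoothAlg n) : smoothAlg n :=
  smoothAlg.mk (fun z => ((g (rePart f z) : ℝ) : ℂ))
    (Complex.ofRealCLM.contDiff.comp (hg.comp (contDiff_rePart f)))

theorem compReal_val (g : ℝ → ℝ) (hg : ContDiff ℝ (⊤ : ℕ∞) g) (f : smoothAlg n)
    (z : Fin n → ℂ) : (compReal g hg f).1 z = ((g (rePart f z) : ℝ) : ℂ) := rfl

theorem cj_compReal (g : ℝ → ℝ) (hg : ContDiff ℝ (⊤ : ℕ∞) g) (f : smoothAlg n) :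
    cj (compReal g hg f) = compReal g hg f :=
  smoothAlg.ext fun z => by rw [cj_val, compReal_val, Complex.conj_ofReal]

theorem levA_compReal (g : ℝ → ℝ) (hg : ContDiff ℝ (⊤ : ℕ∞) g) {f : smoothAlg n} (hf : cj f = f)
    (v w q : Fin n → ℂ) :
    levA (compReal g hg f) v w q = ((deriv g (rePart f q) : ℝ) : ℂ) * levA f v w q +
      ((deriv (deriv g) (rePart f q) : ℝ) : ℂ) *
        (parA v f q * (starRingEnd ℂ) (parA w f q)) := by
  rw [levA_eq_levi (cj_compReal g hg f), levA_eq_levi hf, parA_eq_dirDeriv_cplx hf,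
    parA_eq_dirDeriv_cplx hf]
  have h2 : (2 : WithTop ℕ∞) ≤ ((⊤ : ℕ∞) : WithTop ℕ∞) :=
    WithTop.coe_le_coe.2 (le_top : (2 : ℕ∞) ≤ ⊤)
  exact levi_comp ((contDiff_rePart f).contDiffAt.of_le h2) (hg.contDiffAt.of_le h2) v w

theorem parA_compReal (g : ℝ → ℝ) (hg : ContDiff ℝ (⊤ : ℕ∞) g) {f : smoothAlg n} (hf : cj f = f)
    (v q : Fin n → ℂ) :
    parA v (compReal g hg f) q = ((deriv g (rePart f q) : ℝ) : ℂ) * parA v f q := by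
  rw [parA_eq_dirDeriv_cplx (cj_compReal g hg f), parA_eq_dirDeriv_cplx hf]
  exact dirDeriv_comp ((contDiff_rePart f).differentiable (by simp) q)
    (hg.differentiable (by simp) _) v

end Links

section SmoothAbs

/-- A scaled smooth absolute value. -/
def smoothAbs (ε t : ℝ) : ℝ := ε * Real.sqrt (ε ^ 2 + t ^ 2)

variable {ε : ℝ}

theorem contDiff_smoothAbs (hε : 0 < ε) : ContDiff ℝ (⊤ : ℕ∞) (smoothAbs ε) := by
  unfold smoothAbs
  refine contDiff_const.mul (ContDiff.sqrt (by fun_prop) fun t => by positivity)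

theorem deriv_smoothAbs (hε : 0 < ε) :
    deriv (smoothAbs ε) = fun t => ε * (t / Real.sqrt (ε ^ 2 + t ^ 2)) := by
  funext t
  have h1 : HasDerivAt (fun t : ℝ => ε ^ 2 + t ^ 2) (2 * t) t := by
    simpa using (hasDerivAt_pow 2 t).const_add (ε ^ 2)
  have h2 := (h1.sqrt (by positivity)).const_mul ε
  have h3 : deriv (smoothAbs ε) t = _ := h2.deriv
  rw [h3]
  have : Real.sqrt (ε ^ 2 + t ^ 2) ≠ 0 := by positivity
  field_simp

theorem deriv_deriv_smoothAbs (hε : 0 < ε) (t : ℝ) :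
    deriv (deriv (smoothAbs ε)) t = ε ^ 3 / Real.sqrt (ε ^ 2 + t ^ 2) ^ 3 := by
  have h1 : HasDerivAt (fun t : ℝ => ε ^ 2 + t ^ 2) (2 * t) t := by
    simpa using (hasDerivAt_pow 2 t).const_add (ε ^ 2)
  have hne : Real.sqrt (ε ^ 2 + t ^ 2) ≠ 0 := by positivity
  have h2 := ((hasDerivAt_id t).div (h1.sqrt (by positivity)) hne).const_mul ε
  rw [deriv_smoothAbs hε]
  have h3 : deriv (fun t => ε * (t / Real.sqrt (ε ^ 2 + t ^ 2))) t = _ := h2.deriv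
  rw [h3]
  have hsq : Real.sqrt (ε ^ 2 + t ^ 2) ^ 2 = ε ^ 2 + t ^ 2 := Real.sq_sqrt (by positivity)
  simp only [id]
  field_simp
  rw [hsq]; ring

theorem abs_deriv_smoothAbs_le (hε : 0 < ε) (t : ℝ) : |deriv (smoothAbs ε) t| ≤ ε := by
  rw [deriv_smoothAbs hε]
  have hpos : 0 < Real.sqrt (ε ^ 2 + t ^ 2) := by positivity
  have h1 : |t| ≤ Real.sqrt (ε ^ 2 + t ^ 2) := by
    rw [← Real.sqrt_sq_eq_abs]; exact Real.sqrt_le_sqrt (by nlinarith)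
  rw [abs_mul, abs_div, abs_of_pos hε, abs_of_pos hpos]
  have : |t| / Real.sqrt (ε ^ 2 + t ^ 2) ≤ 1 := (div_le_one hpos).2 h1
  nlinarith

theorem deriv_deriv_smoothAbs_nonneg (hε : 0 < ε) (t : ℝ) :
    0 ≤ deriv (deriv (smoothAbs ε)) t := by
  rw [deriv_deriv_smoothAbs hε]; positivity

theorem deriv_deriv_smoothAbs_zero (hε : 0 < ε) : deriv (deriv (smoothAbs ε)) 0 = 1 := by
  rw [deriv_deriv_smoothAbs hε]
  have : Real.sqrt (ε ^ 2 + 0 ^ 2) = ε := by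
    rw [zero_pow two_ne_zero, add_zero, Real.sqrt_sq hε.le]
  rw [this, div_self (by positivity)]

theorem continuous_deriv_smoothAbs (hε : 0 < ε) : Continuous (deriv (smoothAbs ε)) := by
  rw [deriv_smoothAbs hε]
  refine continuous_const.mul (continuous_id.div (by fun_prop) fun t => by positivity)

theorem continuous_deriv_deriv_smoothAbs (hε : 0 < ε) :
    Continuous (deriv (deriv (smoothAbs ε))) := by
  rw [show deriv (deriv (smoothAbs ε)) = _ from funext (deriv_deriv_smoothAbs hε)]
  refine continuous_const.div (by fun_prop) fun t => by positivity

theorem abs_smoothAbs_le (hε : 0 < ε) (t : ℝ) : |smoothAbs ε t| ≤ ε * (ε + |t|) := by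
  rw [smoothAbs, abs_mul, abs_of_pos hε, abs_of_nonneg (Real.sqrt_nonneg _)]
  refine mul_le_mul_of_nonneg_left ?_ hε.le
  rw [Real.sqrt_le_left (by positivity)]
  nlinarith [abs_nonneg t, sq_abs t, mul_nonneg hε.le (abs_nonneg t)]

end SmoothAbs

section LeviCorrection

variable {n : ℕ}

theorem levA_add_smul_re {ρ : smoothAlg n} (hρ : cj ρ = ρ) (v Y : Fin n → ℂ) (c : ℂ)
    (p : Fin n → ℂ) :
    (levA ρ (v + c • Y) (v + c • Y) p).re = (levA ρ v v p).re +
      2 * ((starRingEnd ℂ) c * levA ρ v Y p).re + Complex.normSq c * (levA ρ Y Y p).re := by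
  rw [levA_add_left, levA_add_right, levA_add_right, levA_smul_left, levA_smul_left,
    levA_smul_right, levA_smul_right, ← levA_conj hρ v Y p]
  simp only [Complex.add_re, Complex.mul_re, Complex.mul_im, Complex.conj_re, Complex.conj_im,
    Complex.normSq_apply]
  ring

/-- Cauchy–Schwarz for the Levi form at a null direction. -/
theorem levA_eq_zero_of_null {ρ : smoothAlg n} (hρ : cj ρ = ρ) {p v : Fin n → ℂ}
    (hpsc : ∀ Y, parA Y ρ p = 0 → 0 ≤ (levA ρ Y Y p).re) (hv : parA v ρ p = 0)
    (h0 : (levA ρ v v p).re = 0) {Y : Fin n → ℂ} (hY : parA Y ρ p = 0) : levA ρ v Y p = 0 := by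
  by_contra hne
  set A := levA ρ v Y p
  set L := (levA ρ Y Y p).re
  have hA : 0 < Complex.normSq A := Complex.normSq_pos.2 hne
  have hL : 0 ≤ L := hpsc Y hY
  have key := hpsc (v + (-((1 / (L + 1) : ℝ) : ℂ) * A) • Y) (by
    rw [parA_add, parA_smul, hv, hY, mul_zero, add_zero])
  rw [levA_add_smul_re hρ, h0] at key
  have e1 : ((starRingEnd ℂ) (-((1 / (L + 1) : ℝ) : ℂ) * A) * A).re =
      -(1 / (L + 1)) * Complex.normSq A := by
    rw [map_mul, map_neg, Complex.conj_ofReal, mul_assoc, ← Complex.normSq_eq_conj_mul_self,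
      ← Complex.ofReal_neg, ← Complex.ofReal_mul, Complex.ofReal_re]
  have e2 : Complex.normSq (-((1 / (L + 1) : ℝ) : ℂ) * A) =
      (1 / (L + 1)) ^ 2 * Complex.normSq A := by
    rw [Complex.normSq_mul, Complex.normSq_neg, Complex.normSq_ofReal, sq]
  rw [e1, e2] at key
  have h3 : (1 / (L + 1)) ^ 2 * Complex.normSq A * L ≤ 1 / (L + 1) * Complex.normSq A := by
    have : 1 / (L + 1) * L ≤ 1 := by rw [one_div_mul_eq_div]; exact (div_le_one (by linarith)).2 (by linarith)
    have h4 : 0 ≤ 1 / (L + 1) * Complex.normSq A := by positivity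
    nlinarith
  have h5 : 0 < 1 / (L + 1) * Complex.normSq A := by positivity
  linarith

/-- Unit null vectors of the Levi form over `K`. -/
def nullSet (K : Set (Fin n → ℂ)) (ρ : smoothAlg n) : Set ((Fin n → ℂ) × (Fin n → ℂ)) :=
  {x | x.1 ∈ K ∧ ‖x.2‖ = 1 ∧ parA x.2 ρ x.1 = 0 ∧ (levA ρ x.2 x.2 x.1).re = 0}

theorem mem_nullSet {K : Set (Fin n → ℂ)} {ρ : smoothAlg n}
    {x : (Fin n → ℂ) × (Fin n → ℂ)} : x ∈ nullSet K ρ ↔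
      x.1 ∈ K ∧ ‖x.2‖ = 1 ∧ parA x.2 ρ x.1 = 0 ∧ (levA ρ x.2 x.2 x.1).re = 0 := by
  rw [nullSet, Set.mem_ofPred_eq]

theorem isCompact_nullSet {K : Set (Fin n → ℂ)} (hK : IsCompact K) (ρ : smoothAlg n) :
    IsCompact (nullSet K ρ) := by
  have h1 : IsCompact (K ×ˢ Metric.sphere (0 : Fin n → ℂ) 1) := hK.prod (isCompact_sphere _ _)
  have h2 : IsClosed {x : (Fin n → ℂ) × (Fin n → ℂ) | parA x.2 ρ x.1 = 0} :=
    isClosed_eq (continuous_parA ρ) continuous_const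
  have h3 : IsClosed {x : (Fin n → ℂ) × (Fin n → ℂ) | (levA ρ x.2 x.2 x.1).re = 0} :=
    isClosed_eq (Complex.continuous_re.comp (continuous_levA ρ)) continuous_const
  convert (h1.inter_right h2).inter_right h3 using 1
  ext x
  rw [mem_nullSet, Set.mem_inter_iff, Set.mem_inter_iff, Set.mem_prod, Set.mem_ofPred_eq,
    Set.mem_ofPred_eq, mem_sphere_zero_iff_norm]
  tauto

/-- Small functions whose Levi form compensates a function positive over infinite type points. -/
theorem exists_levi_correction {K : Set (Fin n → ℂ)} (hK : IsCompact K) {ρ : smoothAlg n}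
    (hρ : cj ρ = ρ) (hρK : ρ ∈ vanishOn K) {W : Fin n → smoothAlg n}
    (hW : ∀ q ∈ K, parA (fun j => (W j).1 q) ρ q = 1)
    (hpsc : ∀ p ∈ K, ∀ v, parA v ρ p = 0 → 0 ≤ (levA ρ v v p).re)
    (hlevi : ∀ p ∈ K, ∀ v₀ : Fin n → ℂ, ∃ C : ℝ, ∀ᶠ x in 𝓝 (p, v₀),
      -C * (‖ρ.1 x.1‖ + ‖parA x.2 ρ x.1‖) ≤ (levA ρ x.2 x.2 x.1).re)
    {G : (Fin n → ℂ) × (Fin n → ℂ) → ℝ} (hG : Continuous G) {c κ : ℝ} (hc : 0 < c) (hκ : 0 < κ)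
    (hGc : ∀ x ∈ nullSet K ρ, ¬ FiniteTypePt (rePart ρ) x.1 → c < G x) :
    ∃ w : smoothAlg n, cj w = w ∧ (∀ p ∈ K, ‖w.1 p‖ ≤ κ) ∧
      ∀ x ∈ nullSet K ρ, 0 < (levA w x.2 x.2 x.1).re + G x := by
  by_contra hcon
  push Not at hcon
  have : CompactSpace (nullSet K ρ) := isCompact_iff_compactSpace.1 (isCompact_nullSet hK ρ)
  let lv : smoothAlg n → C(nullSet K ρ, ℝ) := fun w =>
    ⟨fun x => (levA w x.1.2 x.1.2 x.1.1).re,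
      Complex.continuous_re.comp ((continuous_levA w).comp continuous_subtype_val)⟩
  have hlv : ∀ w x, lv w x = (levA w x.1.2 x.1.2 x.1.1).re := fun w x => rfl
  let pr : smoothAlg n → C(nullSet K ρ, ℝ) := fun w =>
    ⟨fun x => Complex.normSq (parA x.1.2 w x.1.1),
      Complex.continuous_normSq.comp ((continuous_parA w).comp continuous_subtype_val)⟩
  have hpr : ∀ w x, pr w x = Complex.normSq (parA x.1.2 w x.1.1) := fun w x => rfl
  let t : Set C(nullSet K ρ, ℝ) := lv '' {w | cj w = w ∧ ∀ p ∈ K, ‖w.1 p‖ ≤ κ}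
  have lv_add : ∀ (a b : ℝ) (w w' : smoothAlg n),
      lv ((a : ℂ) • w + (b : ℂ) • w') = a • lv w + b • lv w' := by
    intro a b w w'
    ext x
    simp only [hlv, levA_add_fun, levA_smul_fun, Complex.add_re, Complex.re_ofReal_mul,
      ContinuousMap.add_apply, ContinuousMap.smul_apply, smul_eq_mul]
  have ht : Convex ℝ t := by
    rintro _ ⟨w, hw, rfl⟩ _ ⟨w', hw', rfl⟩ a b ha hb hab
    rw [Set.mem_ofPred_eq] at hw hw'
    refine ⟨(a : ℂ) • w + (b : ℂ) • w', ?_, lv_add a b w w'⟩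
    rw [Set.mem_ofPred_eq]
    refine ⟨by rw [cj_add, cj_smul, cj_smul, hw.1, hw'.1, Complex.conj_ofReal,
      Complex.conj_ofReal], fun p hp => ?_⟩
    rw [smoothAlg.add_val, smoothAlg.smul_val, smoothAlg.smul_val]
    refine (norm_add_le _ _).trans ?_
    rw [norm_mul, norm_mul, Complex.norm_real, Complex.norm_real, Real.norm_of_nonneg ha,
      Real.norm_of_nonneg hb]
    have h1 := mul_le_mul_of_nonneg_left (hw.2 p hp) ha
    have h2 := mul_le_mul_of_nonneg_left (hw'.2 p hp) hb
    have h3 : a * κ + b * κ = κ := by rw [← add_mul, hab, one_mul]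
    linarith
  have h0 : (0 : C(nullSet K ρ, ℝ)) ∈ t := by
    refine ⟨0, ?_, ?_⟩
    · rw [Set.mem_ofPred_eq]
      exact ⟨smoothAlg.ext fun z => by simp, fun p _ => by simpa using hκ.le⟩
    · ext x; simp [hlv, levA]
  let G' : C(nullSet K ρ, ℝ) := ⟨fun x => G x.1, hG.comp continuous_subtype_val⟩
  obtain ⟨Λ, K₀, θ, S, hΛ, hΛt, hθ, hS, hSG, hS0, hSpos⟩ :=
    exists_positive_functional G' ht h0 (by
      rintro _ ⟨w, hw, rfl⟩ hpos
      rw [Set.mem_ofPred_eq] at hw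
      obtain ⟨x, hx, hle⟩ := hcon w hw.1 hw.2
      exact absurd (hpos ⟨x, hx⟩) (not_lt.2 hle)) hc
  let E : Set (Fin n → ℂ) := (fun x : nullSet K ρ => x.1.1) '' S
  have hEK : ∀ p ∈ E, p ∈ K := by
    rintro _ ⟨x, _, rfl⟩
    exact (mem_nullSet.1 x.2).1
  have hreal : ∀ f : smoothAlg n, cj f = f → f ∈ vanishOn E →
      ∀ x ∈ S, parA x.1.2 f x.1.1 = 0 := by
    intro f hf hfE x hx
    by_contra hne
    have hpos := hSpos x hx (pr f) (contMap_nonneg_iff.2 fun y => Complex.normSq_nonneg _)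
      (by rw [hpr]; exact Complex.normSq_pos.2 hne)
    obtain ⟨B, hB⟩ := hK.exists_bound_of_continuousOn (smoothAlg.contDiff f).continuous.continuousOn
    have hB0 : 0 ≤ max B 0 := le_max_right _ _
    set B' := max B 0 with hB'
    have hΛ1 : 0 ≤ Λ 1 := hΛ 1 (contMap_nonneg_iff.2 fun x => by simp)
    set C := (K₀ * (1 + B') / κ + ‖lv f‖ * Λ 1) with hC
    have key : ∀ ε : ℝ, 0 < ε → ε ≤ 1 → Λ (θ * pr f) ≤ ‖θ‖ * (ε * C) := by
      intro ε hε hε1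
      set φ := compReal (smoothAbs ε) (contDiff_smoothAbs hε) f with hφ
      let a : C(nullSet K ρ, ℝ) := ⟨fun x => deriv (smoothAbs ε) (rePart f x.1.1),
        (continuous_deriv_smoothAbs hε).comp ((contDiff_rePart f).continuous.comp
          (continuous_fst.comp continuous_subtype_val))⟩
      let b : C(nullSet K ρ, ℝ) := ⟨fun x => deriv (deriv (smoothAbs ε)) (rePart f x.1.1),
        (continuous_deriv_deriv_smoothAbs hε).comp ((contDiff_rePart f).continuous.comp
          (continuous_fst.comp continuous_subtype_val))⟩
      have hφl : lv φ = a * lv f + b * pr f := by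
        ext y
        rw [ContinuousMap.add_apply, ContinuousMap.mul_apply, ContinuousMap.mul_apply, hlv, hlv,
          hpr, hφ, levA_compReal _ _ hf, Complex.mul_conj]
        simp [a, b]
      set μ := κ / (ε * (1 + B')) with hμ
      have hμ0 : 0 < μ := by positivity
      have hmem : lv (((μ : ℝ) : ℂ) • φ + ((0 : ℝ) : ℂ) • φ) ∈ t := by
        refine ⟨_, ?_, rfl⟩
        rw [Set.mem_ofPred_eq]
        refine ⟨by rw [cj_add, cj_smul, cj_smul, cj_compReal, Complex.conj_ofReal,
          Complex.conj_ofReal], fun p hp => ?_⟩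
        rw [Complex.ofReal_zero, zero_smul, add_zero, smoothAlg.smul_val, hφ, compReal_val,
          norm_mul, Complex.norm_real, Complex.norm_real, Real.norm_of_nonneg hμ0.le,
          Real.norm_eq_abs]
        have h1 := abs_smoothAbs_le hε (rePart f p)
        have h2 : |rePart f p| ≤ B' := by
          rw [abs_rePart hf]; exact (hB p hp).trans (le_max_left _ _)
        have h3 : |smoothAbs ε (rePart f p)| ≤ ε * (1 + B') := by
          refine h1.trans (mul_le_mul_of_nonneg_left (by linarith) hε.le)
        calc μ * |smoothAbs ε (rePart f p)| ≤ μ * (ε * (1 + B')) :=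
              mul_le_mul_of_nonneg_left h3 hμ0.le
          _ = κ := by rw [hμ]; field_simp
      have h1 := hΛt _ hmem
      rw [lv_add, zero_smul, add_zero, map_smul, smul_eq_mul, hφl, map_add] at h1
      have h2 : |Λ (a * lv f)| ≤ Λ ((ε * ‖lv f‖) • 1) := by
        refine abs_apply_le_of_nonneg hΛ fun y => ?_
        rw [ContinuousMap.mul_apply, abs_mul]
        have := mul_le_mul (abs_deriv_smoothAbs_le hε (rePart f y.1.1))
          ((lv f).norm_coe_le_norm y) (norm_nonneg _) hε.le
        simpa [a] using this
      rw [map_smul, smul_eq_mul] at h2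
      have h3 : Λ (b * pr f) ≤ ε * C := by
        have h4 : Λ (a * lv f) + Λ (b * pr f) ≤ K₀ / μ := by
          rw [le_div_iff₀ hμ0]; linarith
        have h5 : K₀ / μ = ε * (K₀ * (1 + B') / κ) := by rw [hμ]; field_simp
        have h6 := (abs_le.1 h2).1
        rw [h5] at h4
        rw [hC]; linarith
      have h4 : Λ (θ * pr f) = Λ (θ * (b * pr f)) := by
        have := hS0 (pr f - b * pr f) fun y hy => by
          have hfy : rePart f y.1.1 = 0 := by
            rw [rePart, mem_vanishOn.1 hfE _ ⟨y, hy, rfl⟩, Complex.zero_re]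
          have hb : b y = 1 := by
            change deriv (deriv (smoothAbs ε)) (rePart f y.1.1) = 1
            rw [hfy, deriv_deriv_smoothAbs_zero hε]
          rw [ContinuousMap.sub_apply, ContinuousMap.mul_apply, hb, one_mul, sub_self]
        rw [mul_sub, map_sub] at this
        linarith
      have h5 : Λ (θ * (b * pr f)) ≤ ‖θ‖ * Λ (b * pr f) := by
        have hb0 : ∀ y, 0 ≤ (b * pr f) y := fun y =>
          mul_nonneg (deriv_deriv_smoothAbs_nonneg hε _) (Complex.normSq_nonneg _)
        have := abs_apply_le_of_nonneg hΛ (h := θ * (b * pr f)) (k := ‖θ‖ • (b * pr f))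
          fun y => by
            rw [ContinuousMap.mul_apply, abs_mul, abs_of_nonneg (hb0 y)]
            exact mul_le_mul_of_nonneg_right (θ.norm_coe_le_norm y) (hb0 y)
        rw [map_smul, smul_eq_mul] at this
        exact (le_abs_self _).trans this
      rw [h4]
      exact h5.trans (mul_le_mul_of_nonneg_left h3 (norm_nonneg _))
    set P := Λ (θ * pr f) with hP
    have hD : 0 < ‖θ‖ * C := by simpa using lt_of_lt_of_le hpos (key 1 one_pos le_rfl)
    have h1 := key (min 1 (P / (2 * (‖θ‖ * C)))) (lt_min one_pos (by positivity)) (min_le_left _ _)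
    have h2 : ‖θ‖ * (min 1 (P / (2 * (‖θ‖ * C))) * C) ≤ P / 2 := by
      have h3 : min 1 (P / (2 * (‖θ‖ * C))) * (‖θ‖ * C) ≤ P / (2 * (‖θ‖ * C)) * (‖θ‖ * C) :=
        mul_le_mul_of_nonneg_right (min_le_right _ _) hD.le
      have h4 : P / (2 * (‖θ‖ * C)) * (‖θ‖ * C) = P / 2 := by
        rw [div_mul_eq_mul_div, div_eq_div_iff (by positivity) two_ne_zero]; ring
      linarith
    linarith
  obtain ⟨p, hp, hpinf⟩ := exists_not_finiteTypePt (E := E) (hS.image _) hρ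
    (mem_vanishOn.2 fun q hq => mem_vanishOn.1 hρK q (hEK q hq)) (fun q hq => hW q (hEK q hq))
    (fun p hp => hlevi p (hEK p hp)) (by
      rintro _ ⟨x, hx, rfl⟩
      obtain ⟨hxK, hx1, hx2, hx3⟩ := mem_nullSet.1 x.2
      refine ⟨x.1.2, fun h => ?_, fun f hf => ?_, fun Y hY =>
        levA_eq_zero_of_null hρ (hpsc _ hxK) hx2 hx3 hY⟩
      · rw [h, norm_zero] at hx1; exact zero_ne_one hx1
      · have e : f = (1 / 2 : ℂ) • (f + cj f) + (1 / 2 * Complex.I) • (Complex.I • (cj f - f)) :=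
          smoothAlg.ext fun z => by
            simp only [smoothAlg.add_val, smoothAlg.smul_val, smoothAlg.sub_val]
            linear_combination (-(1 / 2) * ((cj f).1 z - f.1 z)) * Complex.I_mul_I
        have h1 := hreal (f + cj f) (by rw [cj_add, cj_cj, add_comm])
          (Submodule.add_mem _ hf (cj_mem_vanishOn hf)) x hx
        have h2 := hreal (Complex.I • (cj f - f)) (by
            rw [cj_smul, cj_sub, cj_cj, Complex.conj_I, neg_smul, ← smul_neg, neg_sub])
          (Submodule.smul_mem _ _ (Submodule.sub_mem _ (cj_mem_vanishOn hf) hf)) x hx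
        rw [e, parA_add_fun, parA_smul_fun, parA_smul_fun, h1, h2]
        simp)
  obtain ⟨x, hx, rfl⟩ := hp
  exact absurd (hGc x.1 x.2 hpinf) (not_lt.2 (hSG x hx))

end LeviCorrection

section BoundaryData

variable {n : ℕ}

theorem eventually_nhds_of_nhdsSet {X : Type*} [TopologicalSpace X] {s : Set X} {P : X → Prop}
    (h : ∀ᶠ z in 𝓝ˢ s, P z) {p : X} (hp : p ∈ s) : ∀ᶠ z in 𝓝 p, P z :=
  h.filter_mono (nhds_le_nhdsSet hp)

theorem fderiv_rePart {f : smoothAlg n} (hf : cj f = f) (z v : Fin n → ℂ) :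
    fderiv ℝ (rePart f) z v = 2 * (parA v f z).re := by
  have h1 := fderiv_cplx ((contDiff_rePart f).differentiable (by simp) z) v
  rw [cplx_rePart hf, fderiv_eq_sum_dz] at h1
  have h2 : ∑ j, v j * dz j f.1 z = parA v f z := by rw [parA_eq_dirDeriv]; rfl
  have h3 : ∑ j, (starRingEnd ℂ) (v j) * dzbar j f.1 z = (starRingEnd ℂ) (parA v f z) := by
    rw [parA, map_sum]
    refine Finset.sum_congr rfl fun j _ => ?_
    rw [map_mul, ← cj_val, ← dbDer_cj, hf, dbDer_val]
  rw [h2, h3, Complex.add_conj] at h1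
  exact_mod_cast h1.symm

/-- Value of a vector field with smooth coefficients. -/
def fieldAt (W : Fin n → smoothAlg n) (q : Fin n → ℂ) : Fin n → ℂ := fun j => (W j).1 q

theorem contDiff_fieldAt (W : Fin n → smoothAlg n) : ContDiff ℝ (⊤ : ℕ∞) (fieldAt W) :=
  contDiff_pi.2 fun j => smoothAlg.contDiff (W j)

/-- Projection of a vector to the complex tangent space along a transverse field. -/
def tanProj (ρ : smoothAlg n) (W : Fin n → smoothAlg n) (x : (Fin n → ℂ) × (Fin n → ℂ)) :
    Fin n → ℂ := x.2 - parA x.2 ρ x.1 • fieldAt W x.1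

theorem contDiff_tanProj (ρ : smoothAlg n) (W : Fin n → smoothAlg n) :
    ContDiff ℝ (⊤ : ℕ∞) (tanProj ρ W) :=
  contDiff_snd.sub ((contDiff_parA ρ contDiff_fst contDiff_snd).smul
    ((contDiff_fieldAt W).comp contDiff_fst))

/-- The Levi form of the tangential projection. -/
def leviTan (ρ : smoothAlg n) (W : Fin n → smoothAlg n) (x : (Fin n → ℂ) × (Fin n → ℂ)) : ℝ :=
  (levA ρ (tanProj ρ W x) (tanProj ρ W x) x.1).re

theorem contDiff_leviTan (ρ : smoothAlg n) (W : Fin n → smoothAlg n) :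
    ContDiff ℝ (⊤ : ℕ∞) (leviTan ρ W) :=
  Complex.reCLM.contDiff.comp (contDiff_levA ρ contDiff_fst (contDiff_tanProj ρ W)
    (contDiff_tanProj ρ W))

/-- The normal derivative of the tangential Levi form. -/
def normDer (ρ : smoothAlg n) (W : Fin n → smoothAlg n) (x : (Fin n → ℂ) × (Fin n → ℂ)) : ℝ :=
  fderiv ℝ (leviTan ρ W) x ((2 : ℝ)⁻¹ • fieldAt W x.1, 0)

theorem continuous_normDer (ρ : smoothAlg n) (W : Fin n → smoothAlg n) :
    Continuous (normDer ρ W) := by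
  refine Continuous.clm_apply ((contDiff_leviTan ρ W).continuous_fderiv (by simp)) ?_
  exact (((contDiff_fieldAt W).continuous.comp continuous_fst).const_smul (2 : ℝ)⁻¹).prodMk
    continuous_const

/-- The mixed term of the Levi form. -/
def mixTerm (ρ : smoothAlg n) (W : Fin n → smoothAlg n) (x : (Fin n → ℂ) × (Fin n → ℂ)) : ℂ :=
  levA ρ x.2 (fieldAt W x.1) x.1

theorem continuous_mixTerm (ρ : smoothAlg n) (W : Fin n → smoothAlg n) :
    Continuous (mixTerm ρ W) :=
  (contDiff_levA ρ contDiff_fst contDiff_snd ((contDiff_fieldAt W).comp contDiff_fst)).continuous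

/-- A global smooth function which near `∂Ω` is a defining function, with a transverse field. -/
structure BdryData (Ω : Set (Fin n → ℂ)) (ρ : smoothAlg n) (W : Fin n → smoothAlg n) : Prop where
  isOpen : IsOpen Ω
  isCompact : IsCompact (frontier Ω)
  real : cj ρ = ρ
  neg : ∀ᶠ z in 𝓝ˢ (frontier Ω), (z ∈ Ω ↔ rePart ρ z < 0)
  norm : ∀ᶠ z in 𝓝ˢ (frontier Ω), parA (fieldAt W z) ρ z = 1

namespace BdryData

variable {Ω : Set (Fin n → ℂ)} {ρ : smoothAlg n} {W : Fin n → smoothAlg n}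

theorem parA_field (h : BdryData Ω ρ W) {p : Fin n → ℂ} (hp : p ∈ frontier Ω) :
    parA (fieldAt W p) ρ p = 1 := h.norm.self_of_nhdsSet p hp

theorem notMem (h : BdryData Ω ρ W) {p : Fin n → ℂ} (hp : p ∈ frontier Ω) : p ∉ Ω := by
  rw [h.isOpen.frontier_eq] at hp
  exact hp.2

theorem rho_eq_zero (h : BdryData Ω ρ W) {p : Fin n → ℂ} (hp : p ∈ frontier Ω) :
    rePart ρ p = 0 := by
  refine le_antisymm ?_ (not_lt.1 fun hlt => h.notMem hp
    ((h.neg.self_of_nhdsSet p hp).2 hlt))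
  by_contra hpos
  push Not at hpos
  have h1 : ∀ᶠ z in 𝓝 p, 0 < rePart ρ z :=
    (contDiff_rePart ρ).continuous.continuousAt.eventually (lt_mem_nhds hpos)
  have h2 : ∃ᶠ z in 𝓝 p, z ∈ Ω := mem_closure_iff_frequently.1 hp.1
  obtain ⟨z, hz, hz1, hz2⟩ :=
    (h2.and_eventually (h1.and (eventually_nhds_of_nhdsSet h.neg hp))).exists
  exact lt_asymm hz1 (hz2.1 hz)

theorem mem_vanishOn (h : BdryData Ω ρ W) : ρ ∈ vanishOn (frontier Ω) :=
  _root_.mem_vanishOn.2 fun q hq => by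
    rw [← ofReal_rePart h.real, h.rho_eq_zero hq, Complex.ofReal_zero]

theorem hasFDerivAt_rho (q : Fin n → ℂ) :
    HasFDerivAt (rePart ρ) (fderiv ℝ (rePart ρ) q) q :=
  ((contDiff_rePart ρ).differentiable (by simp) q).hasFDerivAt

theorem fderiv_field (h : BdryData Ω ρ W) {q : Fin n → ℂ} (hq : parA (fieldAt W q) ρ q = 1) :
    fderiv ℝ (rePart ρ) q ((2 : ℝ)⁻¹ • fieldAt W q) = 1 := by
  rw [map_smul, fderiv_rePart h.real, hq, Complex.one_re, smul_eq_mul]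
  norm_num

theorem hasDerivAt_line (q v : Fin n → ℂ) :
    HasDerivAt (fun t : ℝ => rePart ρ (q + t • v)) (fderiv ℝ (rePart ρ) q v) 0 := by
  have h1 : HasDerivAt (fun t : ℝ => q + t • v) v 0 := by
    simpa using ((hasDerivAt_id (0 : ℝ)).smul_const v).const_add q
  have h2 : HasFDerivAt (rePart ρ) (fderiv ℝ (rePart ρ) q) (q + (0 : ℝ) • v) := by
    rw [zero_smul, add_zero]; exact hasFDerivAt_rho q
  exact h2.comp_hasDerivAt (0 : ℝ) h1

theorem mem_frontier_of_zero (h : BdryData Ω ρ W) :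
    ∀ᶠ q in 𝓝ˢ (frontier Ω), rePart ρ q = 0 → q ∈ frontier Ω := by
  filter_upwards [h.neg.eventually_nhdsSet, h.norm] with q hq1 hq2 h0
  have hq1' : ∀ᶠ z in 𝓝 q, (z ∈ Ω ↔ rePart ρ z < 0) := hq1
  rw [h.isOpen.frontier_eq]
  refine ⟨?_, fun hq => by have := hq1'.self_of_nhds.1 hq; linarith⟩
  rw [mem_closure_iff_frequently]
  have hd := hasDerivAt_line (ρ := ρ) q (-((2 : ℝ)⁻¹ • fieldAt W q))
  rw [map_neg, h.fderiv_field hq2] at hd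
  have hneg : ∀ᶠ t in 𝓝[>] (0 : ℝ), rePart ρ (q + t • (-((2 : ℝ)⁻¹ • fieldAt W q))) < 0 := by
    have h1 := (hasDerivAt_iff_tendsto_slope.1 hd).eventually (gt_mem_nhds (show (-1 : ℝ) < 0 by norm_num))
    have h2 : ∀ᶠ t in 𝓝[>] (0 : ℝ), slope (fun t : ℝ => rePart ρ (q + t • (-((2 : ℝ)⁻¹ • fieldAt W q)))) 0 t < 0 :=
      Filter.Eventually.filter_mono (nhdsWithin_mono _ fun t ht => (ne_of_gt ht)) h1
    filter_upwards [h2, self_mem_nhdsWithin] with t ht ht0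
    rw [slope_def_field, zero_smul, add_zero, h0, sub_zero, sub_zero] at ht
    have ht0' : (0 : ℝ) < t := ht0
    rw [div_lt_iff₀ ht0', zero_mul] at ht
    exact ht
  have hc : Filter.Tendsto (fun t : ℝ => q + t • (-((2 : ℝ)⁻¹ • fieldAt W q))) (𝓝[>] 0) (𝓝 q) := by
    have : Continuous fun t : ℝ => q + t • (-((2 : ℝ)⁻¹ • fieldAt W q)) := by fun_prop
    have h2 := this.tendsto 0
    rw [zero_smul, add_zero] at h2
    exact h2.mono_left nhdsWithin_le_nhds
  refine hc.frequently (Filter.Eventually.frequently ?_)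
  filter_upwards [hneg, hc.eventually hq1'] with t h1 h2 using h2.2 h1

theorem notMem_closure_iff (h : BdryData Ω ρ W) :
    ∀ᶠ q in 𝓝ˢ (frontier Ω), (q ∉ closure Ω ↔ 0 < rePart ρ q) := by
  filter_upwards [h.neg.eventually_nhdsSet, h.mem_frontier_of_zero] with q hq1 hq2
  have hq1' : ∀ᶠ z in 𝓝 q, (z ∈ Ω ↔ rePart ρ z < 0) := hq1
  constructor
  · intro hq
    have h1 : ¬ rePart ρ q < 0 := fun hlt => hq (subset_closure (hq1'.self_of_nhds.2 hlt))
    rcases (not_lt.1 h1).lt_or_eq with h2 | h2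
    · exact h2
    · exact absurd (hq2 h2.symm).1 hq
  · intro hpos hq
    have h1 : ∀ᶠ z in 𝓝 q, 0 < rePart ρ z :=
      (contDiff_rePart ρ).continuous.continuousAt.eventually (lt_mem_nhds hpos)
    obtain ⟨z, hz, hz1, hz2⟩ :=
      ((mem_closure_iff_frequently.1 hq).and_eventually (h1.and hq1')).exists
    exact lt_asymm hz1 (hz2.1 hz)

theorem tanProj_tangent {x : (Fin n → ℂ) × (Fin n → ℂ)}
    (hx : parA (fieldAt W x.1) ρ x.1 = 1) : parA (tanProj ρ W x) ρ x.1 = 0 := by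
  have := parA_add ρ (tanProj ρ W x) (parA x.2 ρ x.1 • fieldAt W x.1) x.1
  rw [parA_smul, hx, tanProj, sub_add_cancel] at this
  rw [tanProj]
  linear_combination -this

theorem leviTan_nonneg (h : BdryData Ω ρ W)
    (hpsc : ∀ p ∈ frontier Ω, ∀ v, parA v ρ p = 0 → 0 ≤ (levA ρ v v p).re)
    {x : (Fin n → ℂ) × (Fin n → ℂ)} (hx : x.1 ∈ frontier Ω) : 0 ≤ leviTan ρ W x :=
  hpsc _ hx _ (tanProj_tangent (h.parA_field hx))

/-- Approximate projection to the boundary along the normal direction. -/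
theorem exists_proj (h : BdryData Ω ρ W) {p : Fin n → ℂ} (hp : p ∈ frontier Ω) {ε : ℝ}
    (hε : 0 < ε) : ∀ᶠ q in 𝓝 p, ∃ s : ℝ, |rePart ρ q - s| ≤ ε * |s| ∧ |s| ≤ 2 * |rePart ρ q| ∧
      q - s • ((2 : ℝ)⁻¹ • fieldAt W p) ∈ frontier Ω := by
  wlog hε2 : ε ≤ 1 / 2 generalizing ε
  · filter_upwards [this (ε := 1 / 2) (by norm_num) le_rfl] with q hq
    obtain ⟨s, h1, h2, h3⟩ := hq
    push Not at hε2
    exact ⟨s, h1.trans (mul_le_mul_of_nonneg_right hε2.le (abs_nonneg _)), h2, h3⟩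
  set ν := (2 : ℝ)⁻¹ • fieldAt W p with hν
  have hν1 : fderiv ℝ (rePart ρ) p ν = 1 := h.fderiv_field (h.parA_field hp)
  have hst : HasStrictFDerivAt (rePart ρ) (fderiv ℝ (rePart ρ) p) p :=
    (contDiff_rePart ρ).contDiffAt.hasStrictFDerivAt (by simp)
  set c := ε / (‖ν‖ + 1) with hcdef
  have hc : 0 < c := by positivity
  have h1 := hst.isLittleO.def hc
  obtain ⟨r, hr, hball⟩ := Metric.eventually_nhds_iff_ball.1
    (h1.and ((continuous_snd.tendsto (p, p)).eventually
      (eventually_nhds_of_nhdsSet h.mem_frontier_of_zero hp)))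
  have hρc : Continuous (rePart ρ) := (contDiff_rePart ρ).continuous
  have hsmall : ∀ᶠ q in 𝓝 p, dist q p < r / 2 ∧ 2 * |rePart ρ q| * ‖ν‖ < r / 2 := by
    refine Filter.Eventually.and (Metric.ball_mem_nhds p (half_pos hr)) ?_
    have : Continuous fun q => 2 * |rePart ρ q| * ‖ν‖ := by fun_prop
    refine this.continuousAt.eventually (gt_mem_nhds ?_)
    change 2 * |rePart ρ p| * ‖ν‖ < r / 2
    rw [h.rho_eq_zero hp]; simp [hr]
  filter_upwards [hsmall] with q hq
  have hmem : ∀ s : ℝ, |s| ≤ 2 * |rePart ρ q| → q - s • ν ∈ Metric.ball p r := by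
    intro s hs
    rw [Metric.mem_ball]
    have h2 : dist (q - s • ν) q = |s| * ‖ν‖ := by
      rw [dist_eq_norm, sub_sub_cancel_left, norm_neg, norm_smul, Real.norm_eq_abs]
    have h3 := dist_triangle (q - s • ν) q p
    have h4 : |s| * ‖ν‖ ≤ 2 * |rePart ρ q| * ‖ν‖ := mul_le_mul_of_nonneg_right hs (norm_nonneg _)
    linarith [hq.1, hq.2]
  have hest : ∀ s : ℝ, |s| ≤ 2 * |rePart ρ q| →
      |rePart ρ q - rePart ρ (q - s • ν) - s| ≤ ε * |s| := by
    intro s hs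
    have hmem' : (q, q - s • ν) ∈ Metric.ball (p, p) r := by
      rw [← ball_prod_same]
      exact ⟨by rw [Metric.mem_ball]; linarith [hq.1], hmem s hs⟩
    have h2 := (hball _ hmem').1
    simp only [sub_sub_cancel, map_smul, hν1, smul_eq_mul, mul_one, norm_smul,
      Real.norm_eq_abs] at h2
    refine h2.trans ?_
    have : c * ‖ν‖ ≤ ε := by
      rw [hcdef, div_mul_eq_mul_div, div_le_iff₀ (by positivity)]
      nlinarith [norm_nonneg ν]
    nlinarith [abs_nonneg s]
  set R := |rePart ρ q| with hR
  have hR0 : 0 ≤ R := abs_nonneg _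
  have hcont : ContinuousOn (fun s : ℝ => rePart ρ (q - s • ν)) (Set.Icc (-(2 * R)) (2 * R)) :=
    (hρc.comp (by fun_prop)).continuousOn
  obtain ⟨s, hs, hs0⟩ : (0 : ℝ) ∈ (fun s : ℝ => rePart ρ (q - s • ν)) ''
      Set.Icc (-(2 * R)) (2 * R) := by
    refine intermediate_value_Icc' (by linarith) hcont ⟨?_, ?_⟩
    · have h2 := hest (2 * R) (by rw [abs_of_nonneg (by linarith)])
      rw [abs_of_nonneg (by linarith : (0 : ℝ) ≤ 2 * R)] at h2
      have h3 := (abs_le.1 h2).1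
      have h4 : rePart ρ q ≤ R := le_abs_self _
      change rePart ρ (q - (2 * R) • ν) ≤ 0
      nlinarith
    · have h2 := hest (-(2 * R)) (by rw [abs_neg, abs_of_nonneg (by linarith)])
      rw [abs_neg, abs_of_nonneg (by linarith : (0 : ℝ) ≤ 2 * R)] at h2
      have h3 := (abs_le.1 h2).2
      have h4 : -R ≤ rePart ρ q := neg_abs_le _
      change 0 ≤ rePart ρ (q - (-(2 * R)) • ν)
      nlinarith
  have hs' : |s| ≤ 2 * R := abs_le.2 hs
  have hs0' : rePart ρ (q - s • ν) = 0 := hs0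
  refine ⟨s, ?_, hs', ?_⟩
  · have := hest s hs'
    rwa [hs0', sub_zero] at this
  · have hmem' : (q, q - s • ν) ∈ Metric.ball (p, p) r := by
      rw [← ball_prod_same]
      exact ⟨by rw [Metric.mem_ball]; linarith [hq.1], hmem s hs'⟩
    exact (hball _ hmem').2 hs0'

end BdryData

end BoundaryData

section LocalEstimates

variable {n : ℕ} {Ω : Set (Fin n → ℂ)} {ρ : smoothAlg n} {W : Fin n → smoothAlg n}

theorem levA_eq_leviTan (hρ : cj ρ = ρ) (W : Fin n → smoothAlg n)
    (x : (Fin n → ℂ) × (Fin n → ℂ)) :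
    (levA ρ x.2 x.2 x.1).re = leviTan ρ W x +
      2 * ((starRingEnd ℂ) (parA x.2 ρ x.1) * levA ρ (tanProj ρ W x) (fieldAt W x.1) x.1).re +
      Complex.normSq (parA x.2 ρ x.1) * (levA ρ (fieldAt W x.1) (fieldAt W x.1) x.1).re := by
  have h := levA_add_smul_re hρ (tanProj ρ W x) (fieldAt W x.1) (parA x.2 ρ x.1) x.1
  have h2 : tanProj ρ W x + parA x.2 ρ x.1 • fieldAt W x.1 = x.2 := by
    rw [tanProj, sub_add_cancel]
  rwa [h2] at h

theorem tanProj_of_tangent {x : (Fin n → ℂ) × (Fin n → ℂ)} (hx : parA x.2 ρ x.1 = 0) :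
    tanProj ρ W x = x.2 := by
  rw [tanProj, hx, zero_smul, sub_zero]

namespace BdryData

/-- Lower bound for the tangential Levi form near the boundary. -/
theorem leviTan_lower (h : BdryData Ω ρ W)
    (hpsc : ∀ p ∈ frontier Ω, ∀ v, parA v ρ p = 0 → 0 ≤ (levA ρ v v p).re)
    {p : Fin n → ℂ} (hp : p ∈ frontier Ω) (v : Fin n → ℂ) {ε : ℝ} (hε : 0 < ε) :
    ∀ᶠ x in 𝓝 (p, v), ∃ s : ℝ, |rePart ρ x.1 - s| ≤ ε * |s| ∧ |s| ≤ 2 * |rePart ρ x.1| ∧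
      s * normDer ρ W (p, v) - ε * |s| ≤ leviTan ρ W x := by
  set ν := (2 : ℝ)⁻¹ • fieldAt W p with hν
  have hst : HasStrictFDerivAt (leviTan ρ W) (fderiv ℝ (leviTan ρ W) (p, v)) (p, v) :=
    (contDiff_leviTan ρ W).contDiffAt.hasStrictFDerivAt (by simp)
  set c := ε / (‖ν‖ + 1) with hcdef
  have hc : 0 < c := by positivity
  obtain ⟨r, hr, hball⟩ := Metric.eventually_nhds_iff_ball.1 (hst.isLittleO.def hc)
  have hρc : Continuous (rePart ρ) := (contDiff_rePart ρ).continuous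
  have hsmall : ∀ᶠ x in 𝓝 (p, v), dist x (p, v) < r / 2 ∧
      2 * |rePart ρ x.1| * ‖ν‖ < r / 2 := by
    refine Filter.Eventually.and (Metric.ball_mem_nhds (p, v) (half_pos hr)) ?_
    have : Continuous fun x : (Fin n → ℂ) × (Fin n → ℂ) => 2 * |rePart ρ x.1| * ‖ν‖ := by
      fun_prop
    refine this.continuousAt.eventually (gt_mem_nhds ?_)
    change 2 * |rePart ρ p| * ‖ν‖ < r / 2
    rw [h.rho_eq_zero hp]
    simp [hr]
  have hproj := (continuous_fst.tendsto (p, v)).eventually (h.exists_proj hp hε)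
  filter_upwards [hsmall, hproj] with x hx hpr
  obtain ⟨s, hs1, hs2, hs3⟩ := hpr
  refine ⟨s, hs1, hs2, ?_⟩
  have hdist : dist ((x.1 - s • ν, x.2) : (Fin n → ℂ) × (Fin n → ℂ)) x = |s| * ‖ν‖ := by
    rw [Prod.dist_eq, dist_self, dist_eq_norm, sub_sub_cancel_left, norm_neg, norm_smul,
      Real.norm_eq_abs, max_eq_left (by positivity)]
  have hmem : (x, ((x.1 - s • ν, x.2) : (Fin n → ℂ) × (Fin n → ℂ))) ∈
      Metric.ball ((p, v), (p, v)) r := by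
    rw [← ball_prod_same]
    refine ⟨by rw [Metric.mem_ball]; linarith [hx.1], ?_⟩
    rw [Metric.mem_ball]
    have h3 := dist_triangle ((x.1 - s • ν, x.2) : (Fin n → ℂ) × (Fin n → ℂ)) x (p, v)
    have h4 : |s| * ‖ν‖ ≤ 2 * |rePart ρ x.1| * ‖ν‖ :=
      mul_le_mul_of_nonneg_right hs2 (norm_nonneg _)
    linarith [hx.1, hx.2]
  have h2 := hball _ hmem
  have hsub : x - ((x.1 - s • ν, x.2) : (Fin n → ℂ) × (Fin n → ℂ)) = s • (ν, 0) := by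
    ext1 <;> simp
  have hpos : 0 ≤ leviTan ρ W (x.1 - s • ν, x.2) := h.leviTan_nonneg hpsc hs3
  simp only [hsub, map_smul, norm_smul, Real.norm_eq_abs, smul_eq_mul] at h2
  have hn : ‖((ν, 0) : (Fin n → ℂ) × (Fin n → ℂ))‖ = ‖ν‖ := by
    rw [Prod.norm_def]; simp
  rw [hn] at h2
  have hD : fderiv ℝ (leviTan ρ W) (p, v) (ν, 0) = normDer ρ W (p, v) := rfl
  rw [hD] at h2
  have h5 : c * ‖ν‖ ≤ ε := by
    rw [hcdef, div_mul_eq_mul_div, div_le_iff₀ (by positivity)]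
    nlinarith [norm_nonneg ν]
  have h6 := (abs_le.1 h2).1
  nlinarith [abs_nonneg s]

theorem levi_lower (h : BdryData Ω ρ W)
    (hpsc : ∀ p ∈ frontier Ω, ∀ v, parA v ρ p = 0 → 0 ≤ (levA ρ v v p).re)
    {p : Fin n → ℂ} (hp : p ∈ frontier Ω) (v : Fin n → ℂ) :
    ∃ C : ℝ, ∀ᶠ x in 𝓝 (p, v),
      -C * (‖ρ.1 x.1‖ + ‖parA x.2 ρ x.1‖) ≤ (levA ρ x.2 x.2 x.1).re := by
  let b : (Fin n → ℂ) × (Fin n → ℂ) → ℝ := fun x =>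
    2 * ‖levA ρ (tanProj ρ W x) (fieldAt W x.1) x.1‖ +
      ‖parA x.2 ρ x.1‖ * |(levA ρ (fieldAt W x.1) (fieldAt W x.1) x.1).re|
  have hb : Continuous b := by
    have h1 : Continuous fun x : (Fin n → ℂ) × (Fin n → ℂ) =>
        levA ρ (tanProj ρ W x) (fieldAt W x.1) x.1 :=
      (contDiff_levA ρ contDiff_fst (contDiff_tanProj ρ W)
        ((contDiff_fieldAt W).comp contDiff_fst)).continuous
    have h2 : Continuous fun x : (Fin n → ℂ) × (Fin n → ℂ) =>
        levA ρ (fieldAt W x.1) (fieldAt W x.1) x.1 :=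
      (contDiff_levA ρ contDiff_fst ((contDiff_fieldAt W).comp contDiff_fst)
        ((contDiff_fieldAt W).comp contDiff_fst)).continuous
    exact (continuous_const.mul h1.norm).add
      ((continuous_parA ρ).norm.mul (Complex.continuous_re.comp h2).abs)
  set D := normDer ρ W (p, v) with hD
  refine ⟨2 * (|D| + 1) + (|b (p, v)| + 1), ?_⟩
  have hbb : ∀ᶠ x in 𝓝 (p, v), b x < |b (p, v)| + 1 :=
    hb.continuousAt.eventually (gt_mem_nhds (by linarith [le_abs_self (b (p, v))]))
  filter_upwards [hbb, h.leviTan_lower hpsc hp v one_pos] with x hx hx2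
  obtain ⟨s, -, hs2, hs3⟩ := hx2
  rw [← hD] at hs3
  rw [levA_eq_leviTan h.real W x, ← abs_rePart h.real]
  set R := |rePart ρ x.1|
  set α := parA x.2 ρ x.1
  have hF : -(2 * (|D| + 1)) * R ≤ leviTan ρ W x := by
    have h1 : -(|s| * |D|) ≤ s * D := by rw [← abs_mul]; exact neg_abs_le _
    have h2 : |s| * (|D| + 1) ≤ 2 * R * (|D| + 1) :=
      mul_le_mul_of_nonneg_right hs2 (by positivity)
    linarith
  have hA : -(‖α‖ * ‖levA ρ (tanProj ρ W x) (fieldAt W x.1) x.1‖) ≤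
      ((starRingEnd ℂ) α * levA ρ (tanProj ρ W x) (fieldAt W x.1) x.1).re := by
    have h1 := Complex.abs_re_le_norm
      ((starRingEnd ℂ) α * levA ρ (tanProj ρ W x) (fieldAt W x.1) x.1)
    rw [norm_mul, RCLike.norm_conj] at h1
    exact (abs_le.1 h1).1
  have hL : -(‖α‖ * (‖α‖ * |(levA ρ (fieldAt W x.1) (fieldAt W x.1) x.1).re|)) ≤
      Complex.normSq α * (levA ρ (fieldAt W x.1) (fieldAt W x.1) x.1).re := by
    rw [Complex.normSq_eq_norm_sq]
    have h1 := neg_abs_le (levA ρ (fieldAt W x.1) (fieldAt W x.1) x.1).re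
    nlinarith [sq_nonneg ‖α‖]
  have hα : ‖α‖ * b x ≤ ‖α‖ * (|b (p, v)| + 1) :=
    mul_le_mul_of_nonneg_left hx.le (norm_nonneg _)
  have hbx : ‖α‖ * b x = 2 * (‖α‖ * ‖levA ρ (tanProj ρ W x) (fieldAt W x.1) x.1‖) +
      ‖α‖ * (‖α‖ * |(levA ρ (fieldAt W x.1) (fieldAt W x.1) x.1).re|) := by
    simp only [b, α]; ring
  have hR : 0 ≤ R := abs_nonneg _
  have h7 : 0 ≤ (|b (p, v)| + 1) * R := by positivity
  have h8 : 0 ≤ (2 * (|D| + 1)) * ‖α‖ := by positivity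
  nlinarith

end BdryData

end LocalEstimates

section PshNear

variable {n : ℕ} {Ω : Set (Fin n → ℂ)} {ρ : smoothAlg n} {W : Fin n → smoothAlg n}

/-- The Levi form of `(ρ e^ψ)^η`, up to a positive factor, where `ρ > 0`. -/
def powForm (ρ ψ : smoothAlg n) (η : ℝ) (x : (Fin n → ℂ) × (Fin n → ℂ)) : ℝ :=
  (levA ρ x.2 x.2 x.1).re + (η - 1) * Complex.normSq (parA x.2 ρ x.1) / rePart ρ x.1 +
    2 * η * (parA x.2 ρ x.1 * (starRingEnd ℂ) (parA x.2 ψ x.1)).re +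
    rePart ρ x.1 * ((levA ψ x.2 x.2 x.1).re + η * Complex.normSq (parA x.2 ψ x.1))

theorem pos_of_quadratic {r F D ε Q L η : ℝ} {α A B β : ℂ} (hr : 0 < r)
    (hF : r * (D - ε) ≤ F) (hB : B = A + η * β) (ha : 0 < η - 1 + r * L)
    (hg : Complex.normSq B < (η - 1 + r * L) * (D - ε + Q)) :
    0 < F + 2 * ((starRingEnd ℂ) α * A).re + Complex.normSq α * L +
      (η - 1) * Complex.normSq α / r + 2 * η * (α * (starRingEnd ℂ) β).re + r * Q := by
  set a := η - 1 + r * L with hadef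
  have h1 : 0 < a * (r * (F + 2 * ((starRingEnd ℂ) α * A).re + Complex.normSq α * L +
      (η - 1) * Complex.normSq α / r + 2 * η * (α * (starRingEnd ℂ) β).re + r * Q)) := by
    have h2 : r * (F + 2 * ((starRingEnd ℂ) α * A).re + Complex.normSq α * L +
      (η - 1) * Complex.normSq α / r + 2 * η * (α * (starRingEnd ℂ) β).re + r * Q) =
      r * F + r * (2 * ((starRingEnd ℂ) α * B).re) + Complex.normSq α * a + r ^ 2 * Q := by
      rw [hB, hadef]
      have : r * ((η - 1) * Complex.normSq α / r) = (η - 1) * Complex.normSq α := by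
        field_simp
      simp only [mul_add, this]
      simp only [Complex.mul_re, Complex.mul_im, Complex.conj_re, Complex.conj_im,
        Complex.add_re, Complex.ofReal_re, Complex.ofReal_im]
      ring
    rw [h2]
    have h3 : 0 ≤ (a * α.re + r * B.re) ^ 2 + (a * α.im + r * B.im) ^ 2 := by positivity
    have h4 : 0 < r ^ 2 * (a * (D - ε + Q) - Complex.normSq B) :=
      mul_pos (pow_pos hr 2) (sub_pos.2 hg)
    have h5 : a * (r * (r * (D - ε))) ≤ a * (r * F) :=
      mul_le_mul_of_nonneg_left (mul_le_mul_of_nonneg_left hF hr.le) ha.le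
    simp only [Complex.normSq_apply, Complex.mul_re, Complex.conj_re, Complex.conj_im] at h4 ⊢
    nlinarith
  exact pos_of_mul_pos_right (pos_of_mul_pos_right h1 ha.le) hr.le

namespace BdryData

theorem powForm_pos_nhds (h : BdryData Ω ρ W)
    (hpsc : ∀ p ∈ frontier Ω, ∀ v, parA v ρ p = 0 → 0 ≤ (levA ρ v v p).re)
    (ψ : smoothAlg n) {η : ℝ} (hη : 1 < η) {p : Fin n → ℂ} (hp : p ∈ frontier Ω)
    (v : Fin n → ℂ)
    (hnull : parA v ρ p = 0 → (levA ρ v v p).re = 0 →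
      Complex.normSq (mixTerm ρ W (p, v) + η * parA v ψ p) <
        (η - 1) * (normDer ρ W (p, v) +
          ((levA ψ v v p).re + η * Complex.normSq (parA v ψ p)))) :
    ∀ᶠ x in 𝓝 (p, v), 0 < rePart ρ x.1 → 0 < powForm ρ ψ η x := by
  have hη0 : 0 < η - 1 := by linarith
  have hr : Continuous fun x : (Fin n → ℂ) × (Fin n → ℂ) => rePart ρ x.1 :=
    (contDiff_rePart ρ).continuous.comp continuous_fst
  have hα := continuous_parA ρ
  have hβ := continuous_parA ψ
  have hαn := Complex.continuous_normSq.comp hα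
  have hl := Complex.continuous_re.comp (continuous_levA ρ)
  have hQ : Continuous fun x : (Fin n → ℂ) × (Fin n → ℂ) =>
      (levA ψ x.2 x.2 x.1).re + η * Complex.normSq (parA x.2 ψ x.1) :=
    (Complex.continuous_re.comp (continuous_levA ψ)).add
      (continuous_const.mul (Complex.continuous_normSq.comp hβ))
  have hM : Continuous fun x : (Fin n → ℂ) × (Fin n → ℂ) =>
      2 * η * (parA x.2 ρ x.1 * (starRingEnd ℂ) (parA x.2 ψ x.1)).re :=
    continuous_const.mul (Complex.continuous_re.comp
      (hα.mul (Complex.continuous_conj.comp hβ)))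
  have hr0 : rePart ρ p = 0 := h.rho_eq_zero hp
  by_cases hα0 : parA v ρ p = 0
  swap
  · have hc : Continuous fun x : (Fin n → ℂ) × (Fin n → ℂ) =>
        rePart ρ x.1 * ((levA ρ x.2 x.2 x.1).re +
          2 * η * (parA x.2 ρ x.1 * (starRingEnd ℂ) (parA x.2 ψ x.1)).re +
          rePart ρ x.1 * ((levA ψ x.2 x.2 x.1).re + η * Complex.normSq (parA x.2 ψ x.1))) +
        (η - 1) * Complex.normSq (parA x.2 ρ x.1) :=
      (hr.mul ((hl.add hM).add (hr.mul hQ))).add (continuous_const.mul hαn)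
    have h0 : 0 < (fun x : (Fin n → ℂ) × (Fin n → ℂ) =>
        rePart ρ x.1 * ((levA ρ x.2 x.2 x.1).re +
          2 * η * (parA x.2 ρ x.1 * (starRingEnd ℂ) (parA x.2 ψ x.1)).re +
          rePart ρ x.1 * ((levA ψ x.2 x.2 x.1).re + η * Complex.normSq (parA x.2 ψ x.1))) +
        (η - 1) * Complex.normSq (parA x.2 ρ x.1)) (p, v) := by
      simp only [hr0, zero_mul, zero_add]
      exact mul_pos hη0 (Complex.normSq_pos.2 hα0)
    filter_upwards [hc.continuousAt.eventually (lt_mem_nhds h0)] with x hx hrx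
    refine pos_of_mul_pos_right (a := rePart ρ x.1) ?_ hrx.le
    refine hx.trans_eq ?_
    rw [powForm]
    field_simp
    ring
  by_cases hl0 : (levA ρ v v p).re = 0
  swap
  · have hc : Continuous fun x : (Fin n → ℂ) × (Fin n → ℂ) =>
        (levA ρ x.2 x.2 x.1).re +
          2 * η * (parA x.2 ρ x.1 * (starRingEnd ℂ) (parA x.2 ψ x.1)).re +
          rePart ρ x.1 * ((levA ψ x.2 x.2 x.1).re + η * Complex.normSq (parA x.2 ψ x.1)) :=
      (hl.add hM).add (hr.mul hQ)
    have h0 : 0 < (fun x : (Fin n → ℂ) × (Fin n → ℂ) =>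
        (levA ρ x.2 x.2 x.1).re +
          2 * η * (parA x.2 ρ x.1 * (starRingEnd ℂ) (parA x.2 ψ x.1)).re +
          rePart ρ x.1 * ((levA ψ x.2 x.2 x.1).re + η * Complex.normSq (parA x.2 ψ x.1)))
        (p, v) := by
      simp only [hr0, hα0, zero_mul, Complex.zero_re, mul_zero, add_zero]
      exact lt_of_le_of_ne (hpsc p hp v hα0) (Ne.symm hl0)
    filter_upwards [hc.continuousAt.eventually (lt_mem_nhds h0)] with x hx hrx
    have h2 : 0 ≤ (η - 1) * Complex.normSq (parA x.2 ρ x.1) / rePart ρ x.1 :=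
      div_nonneg (mul_nonneg hη0.le (Complex.normSq_nonneg _)) hrx.le
    rw [powForm]
    have hx' : 0 < (levA ρ x.2 x.2 x.1).re +
          2 * η * (parA x.2 ρ x.1 * (starRingEnd ℂ) (parA x.2 ψ x.1)).re +
          rePart ρ x.1 * ((levA ψ x.2 x.2 x.1).re + η * Complex.normSq (parA x.2 ψ x.1)) := hx
    linarith
  have hn := hnull hα0 hl0
  set D := normDer ρ W (p, v) with hD
  obtain ⟨ε, hε, hε2⟩ : ∃ ε : ℝ, 0 < ε ∧
      Complex.normSq (mixTerm ρ W (p, v) + η * parA v ψ p) <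
        (η - 1) * (D - ε + ((levA ψ v v p).re + η * Complex.normSq (parA v ψ p))) := by
    refine ⟨((η - 1) * (D + ((levA ψ v v p).re + η * Complex.normSq (parA v ψ p))) -
      Complex.normSq (mixTerm ρ W (p, v) + η * parA v ψ p)) / (2 * (η - 1)), ?_, ?_⟩
    · exact div_pos (sub_pos.2 hn) (by linarith)
    · set N := Complex.normSq (mixTerm ρ W (p, v) + η * parA v ψ p)
      set Q := (levA ψ v v p).re + η * Complex.normSq (parA v ψ p)
      have : (η - 1) * (D - ((η - 1) * (D + Q) - N) / (2 * (η - 1)) + Q) =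
          ((η - 1) * (D + Q) + N) / 2 := by
        field_simp
        ring
      rw [this]
      linarith
  have hfield : Continuous fun x : (Fin n → ℂ) × (Fin n → ℂ) =>
      levA ρ (tanProj ρ W x) (fieldAt W x.1) x.1 :=
    (contDiff_levA ρ contDiff_fst (contDiff_tanProj ρ W)
      ((contDiff_fieldAt W).comp contDiff_fst)).continuous
  have hLW : Continuous fun x : (Fin n → ℂ) × (Fin n → ℂ) =>
      (levA ρ (fieldAt W x.1) (fieldAt W x.1) x.1).re :=
    Complex.continuous_re.comp (contDiff_levA ρ contDiff_fst
      ((contDiff_fieldAt W).comp contDiff_fst)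
        ((contDiff_fieldAt W).comp contDiff_fst)).continuous
  have hB : Continuous fun x : (Fin n → ℂ) × (Fin n → ℂ) =>
      levA ρ (tanProj ρ W x) (fieldAt W x.1) x.1 + η * parA x.2 ψ x.1 :=
    hfield.add (continuous_const.mul hβ)
  have ha : Continuous fun x : (Fin n → ℂ) × (Fin n → ℂ) =>
      η - 1 + rePart ρ x.1 * (levA ρ (fieldAt W x.1) (fieldAt W x.1) x.1).re :=
    continuous_const.add (hr.mul hLW)
  have e1 : ∀ᶠ x in 𝓝 (p, v),
      0 < η - 1 + rePart ρ x.1 * (levA ρ (fieldAt W x.1) (fieldAt W x.1) x.1).re := by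
    refine ha.continuousAt.eventually (lt_mem_nhds ?_)
    change 0 < η - 1 + rePart ρ p * _
    rw [hr0, zero_mul, add_zero]
    exact hη0
  have e2 : ∀ᶠ x in 𝓝 (p, v), Complex.normSq (levA ρ (tanProj ρ W x) (fieldAt W x.1) x.1 +
      η * parA x.2 ψ x.1) <
      (η - 1 + rePart ρ x.1 * (levA ρ (fieldAt W x.1) (fieldAt W x.1) x.1).re) *
      (D - ε + ((levA ψ x.2 x.2 x.1).re + η * Complex.normSq (parA x.2 ψ x.1))) := by
    refine Filter.Tendsto.eventually_lt
      (f := fun x => Complex.normSq (levA ρ (tanProj ρ W x) (fieldAt W x.1) x.1 +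
        η * parA x.2 ψ x.1))
      (Complex.continuous_normSq.comp hB).continuousAt
      (ha.mul (continuous_const.add hQ)).continuousAt ?_
    change Complex.normSq (levA ρ (tanProj ρ W (p, v)) (fieldAt W p) p +
      η * parA v ψ p) <
      (η - 1 + rePart ρ p * (levA ρ (fieldAt W p) (fieldAt W p) p).re) *
      (D - ε + ((levA ψ v v p).re + η * Complex.normSq (parA v ψ p)))
    rw [tanProj_of_tangent hα0, hr0, zero_mul, add_zero]
    exact hε2
  obtain ⟨ε', hε', hεε'⟩ : ∃ ε' : ℝ, 0 < ε' ∧ ε' ≤ 1 / 2 ∧ 2 * ε' * (|D| + 1) ≤ ε := by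
    refine ⟨min (1 / 2) (ε / (2 * (|D| + 1))), by positivity, min_le_left _ _, ?_⟩
    have h1 := min_le_right (1 / 2) (ε / (2 * (|D| + 1)))
    rw [le_div_iff₀ (by positivity)] at h1
    linarith
  filter_upwards [e1, e2, h.leviTan_lower hpsc hp v hε'] with x hx1 hx2 hx3 hrx
  obtain ⟨s, hs1, hs2, hs3⟩ := hx3
  rw [← hD] at hs3
  set R := rePart ρ x.1 with hR
  have hs0 : 0 < s := by
    by_contra hneg
    push Not at hneg
    rw [abs_of_nonpos hneg] at hs1
    have := (abs_le.1 hs1).2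
    nlinarith [hεε'.1]
  rw [abs_of_pos hs0] at hs1 hs2 hs3
  rw [abs_of_pos hrx] at hs2
  have hF : R * (D - ε) ≤ leviTan ρ W x := by
    refine le_trans ?_ hs3
    have h1 := abs_le.1 hs1
    have h2 : |(R - s) * D| ≤ ε' * s * |D| := by
      rw [abs_mul]; exact mul_le_mul_of_nonneg_right hs1 (abs_nonneg _)
    have h3 := (abs_le.1 h2).2
    have h4 : ε' * s * (|D| + 1) ≤ ε' * (2 * R) * (|D| + 1) := by gcongr
    have h5 : R * (2 * ε' * (|D| + 1)) ≤ R * ε := mul_le_mul_of_nonneg_left hεε'.2 hrx.le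
    nlinarith
  rw [powForm, levA_eq_leviTan h.real W x]
  have := pos_of_quadratic (α := parA x.2 ρ x.1) hrx hF rfl hx1 hx2
  linarith

/-- Positivity on a full neighbourhood of the boundary. -/
theorem powForm_pos_nhdsSet (h : BdryData Ω ρ W)
    (hpsc : ∀ p ∈ frontier Ω, ∀ v, parA v ρ p = 0 → 0 ≤ (levA ρ v v p).re)
    (ψ : smoothAlg n) {η : ℝ} (hη : 1 < η)
    (hnull : ∀ x ∈ nullSet (frontier Ω) ρ,
      Complex.normSq (mixTerm ρ W x + η * parA x.2 ψ x.1) <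
        (η - 1) * (normDer ρ W x +
          ((levA ψ x.2 x.2 x.1).re + η * Complex.normSq (parA x.2 ψ x.1)))) :
    ∀ᶠ q in 𝓝ˢ (frontier Ω), 0 < rePart ρ q → ∀ v, ‖v‖ = 1 → 0 < powForm ρ ψ η (q, v) := by
  have h1 : ∀ᶠ x in 𝓝ˢ (frontier Ω ×ˢ Metric.sphere (0 : Fin n → ℂ) 1),
      0 < rePart ρ x.1 → 0 < powForm ρ ψ η x := by
    rw [Filter.Eventually, mem_nhdsSet_iff_forall]
    rintro ⟨p, v⟩ ⟨hp, hv⟩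
    refine h.powForm_pos_nhds hpsc ψ hη hp v fun h1 h2 => hnull (p, v) ?_
    exact mem_nullSet.2 ⟨hp, mem_sphere_zero_iff_norm.1 hv, h1, h2⟩
  obtain ⟨U, hU, hKU, hUP⟩ := eventually_nhdsSet_iff_exists.1 h1
  obtain ⟨u, v, hu, hv, hKu, hSv, huv⟩ :=
    generalized_tube_lemma h.isCompact (isCompact_sphere (0 : Fin n → ℂ) 1) hU hKU
  refine eventually_nhdsSet_iff_exists.2 ⟨u, hu, hKu, fun q hq hr w hw => ?_⟩
  exact hUP (q, w) (huv ⟨hq, hSv (mem_sphere_zero_iff_norm.2 hw)⟩) hr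

end BdryData

end PshNear

section ChoiceOfWeight

variable {n : ℕ} {Ω : Set (Fin n → ℂ)} {ρ : smoothAlg n} {W : Fin n → smoothAlg n}

/-- The squared Euclidean norm. -/
def sqNorm (n : ℕ) : smoothAlg n := ∑ j, zCoord j * cj (zCoord j)

theorem cj_sqNorm : cj (sqNorm n) = sqNorm n := by
  rw [sqNorm, cj_sum]
  refine Finset.sum_congr rfl fun j _ => ?_
  rw [cj_mul, cj_cj, mul_comm]

theorem rePart_sqNorm_nonneg (z : Fin n → ℂ) : 0 ≤ rePart (sqNorm n) z := by
  rw [rePart, sqNorm, smoothAlg.sum_val, Complex.re_sum]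
  refine Finset.sum_nonneg fun j _ => ?_
  rw [smoothAlg.mul_val, cj_val, Complex.mul_conj, Complex.ofReal_re]
  exact Complex.normSq_nonneg _

theorem levA_sqNorm (v q : Fin n → ℂ) :
    levA (sqNorm n) v v q = ((∑ j, Complex.normSq (v j) : ℝ) : ℂ) := by
  have h1 : ∀ j k : Fin n, dDer j (dbDer k (sqNorm n)) = if j = k then 1 else 0 := by
    intro j k
    have : dbDer k (sqNorm n) = zCoord k := by
      rw [sqNorm, map_sum]
      simp only [Derivation.leibniz, dbDer_cj_zCoord, dbDer_zCoord, add_zero,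
        smul_eq_mul, mul_ite, mul_one, mul_zero, Finset.sum_ite_eq, Finset.mem_univ, if_true]
    rw [this, dDer_zCoord]
  rw [levA, Complex.ofReal_sum]
  refine Finset.sum_congr rfl fun j _ => ?_
  rw [Finset.sum_eq_single j]
  · rw [h1, if_pos rfl, smoothAlg.one_val, one_mul, Complex.mul_conj]
  · intro k _ hk
    rw [h1, if_neg (Ne.symm hk), smoothAlg.zero_val, zero_mul, zero_mul]
  · intro hj; exact absurd (Finset.mem_univ j) hj

theorem one_le_sum_normSq {v : Fin n → ℂ} (hv : ‖v‖ = 1) : 1 ≤ ∑ j, Complex.normSq (v j) := by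
  by_contra hcon
  push Not at hcon
  have h1 : ∀ j, ‖v j‖ < 1 := fun j => by
    have h2 : Complex.normSq (v j) ≤ ∑ j, Complex.normSq (v j) :=
      Finset.single_le_sum (f := fun j => Complex.normSq (v j))
        (fun i _ => Complex.normSq_nonneg _) (Finset.mem_univ j)
    rw [Complex.normSq_eq_norm_sq] at h2
    nlinarith [norm_nonneg (v j)]
  exact absurd hv (ne_of_lt ((pi_norm_lt_iff one_pos).2 h1))

theorem normSq_add_le {s η : ℝ} (hs : 0 < s) (A β : ℂ) :
    Complex.normSq (A + η * β) ≤
      (1 + s) * Complex.normSq A + (1 + 1 / s) * η ^ 2 * Complex.normSq β := by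
  have h1 : (1 + s) * Complex.normSq A + (1 + 1 / s) * η ^ 2 * Complex.normSq β -
      Complex.normSq (A + η * β) =
      ((s * A.re - η * β.re) ^ 2 + (s * A.im - η * β.im) ^ 2) / s := by
    simp only [Complex.normSq_apply, Complex.add_re, Complex.add_im, Complex.re_ofReal_mul,
      Complex.im_ofReal_mul]
    field_simp
    ring
  have h2 : 0 ≤ ((s * A.re - η * β.re) ^ 2 + (s * A.im - η * β.im) ^ 2) / s := by positivity
  linarith

theorem weight_ineq {η₂ η a t D l N : ℝ} {A b : ℂ} (h2 : 1 < η₂) (hη : η₂ < η)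
    (ha : 0 < a) (haC : (1 + (η₂ - 1) / (η - η₂)) * η ^ 2 / (η - 1) * a * (9 / 4) ≤ 2)
    (ht : |t| ≤ 1 / 4) (hN : N = Complex.normSq b)
    (hl : 0 < l + (D - Complex.normSq A / (η₂ - 1)) * (1 / (a * (1 + 2 * t)))) :
    Complex.normSq (A + η * ((a * (1 + 2 * t) : ℝ) * b)) <
      (η - 1) * (D + ((a * (1 + 2 * t) * l + 2 * a * N) +
        η * Complex.normSq ((a * (1 + 2 * t) : ℝ) * b))) := by
  have ht' := abs_le.1 ht
  have hg : 0 < a * (1 + 2 * t) := mul_pos ha (by linarith)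
  have hη1 : 0 < η - 1 := by linarith
  have hη2 : 0 < η₂ - 1 := by linarith
  have hd : 0 < η - η₂ := by linarith
  set g := a * (1 + 2 * t) with hgdef
  have h1 : 0 < g * l + (D - Complex.normSq A / (η₂ - 1)) := by
    have h3 := mul_pos hg hl
    have h4 : g * (l + (D - Complex.normSq A / (η₂ - 1)) * (1 / g)) =
      g * l + (D - Complex.normSq A / (η₂ - 1)) := by field_simp
    rwa [h4] at h3
  have hs : 0 < (η - η₂) / (η₂ - 1) := div_pos hd hη2
  have h3 := normSq_add_le (η := η) hs A ((g : ℝ) * b)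
  have h4 : 1 / ((η - η₂) / (η₂ - 1)) = (η₂ - 1) / (η - η₂) := one_div_div _ _
  rw [h4] at h3
  set C := (1 + (η₂ - 1) / (η - η₂)) * η ^ 2 / (η - 1) with hC
  have hC0 : 0 < C := by
    have : 0 < η := by linarith
    positivity
  have h5 : (1 + (η₂ - 1) / (η - η₂)) * η ^ 2 = C * (η - 1) := by
    rw [hC]; field_simp
  have h6 : (1 + (η - η₂) / (η₂ - 1)) * Complex.normSq A =
      (η - 1) * (Complex.normSq A / (η₂ - 1)) := by field_simp; ring
  rw [h5, h6] at h3
  refine h3.trans_lt ?_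
  have hnb : Complex.normSq ((g : ℝ) * b) = g ^ 2 * N := by
    rw [Complex.normSq_mul, Complex.normSq_ofReal, hN]; ring
  rw [hnb]
  have hN0 : 0 ≤ N := hN ▸ Complex.normSq_nonneg _
  have h7 : C * g ^ 2 ≤ 2 * a := by
    have h8 : (1 + 2 * t) ^ 2 ≤ 9 / 4 := by nlinarith
    have h9 : C * g ^ 2 = (C * a * (1 + 2 * t) ^ 2) * a := by rw [hgdef]; ring
    rw [h9]
    refine mul_le_mul_of_nonneg_right (le_trans ?_ haC) ha.le
    exact mul_le_mul_of_nonneg_left h8 (by positivity)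
  have h10 : C * g ^ 2 * N ≤ 2 * a * N := mul_le_mul_of_nonneg_right h7 hN0
  have h11 : 0 ≤ η * (g ^ 2 * N) := mul_nonneg (by linarith) (by positivity)
  have h12 : (η - 1) * (C * g ^ 2 * N) ≤ (η - 1) * (2 * a * N + η * (g ^ 2 * N)) :=
    mul_le_mul_of_nonneg_left (by linarith) hη1.le
  have h13 := mul_pos hη1 h1
  nlinarith

/-- A quadratic polynomial function. -/
def quadFun (a t : ℝ) : ℝ := a * (t + t ^ 2)

theorem contDiff_quadFun (a : ℝ) : ContDiff ℝ (⊤ : ℕ∞) (quadFun a) := by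
  unfold quadFun; fun_prop

theorem deriv_quadFun (a : ℝ) : deriv (quadFun a) = fun t => a * (1 + 2 * t) := by
  funext t
  have h : HasDerivAt (quadFun a) (a * (1 + 2 * t)) t := by
    have h1 : HasDerivAt (fun t : ℝ => a * (t + t ^ 2)) (a * (1 + 2 * t)) t := by
      have := ((hasDerivAt_id' t).add (hasDerivAt_pow 2 t)).const_mul a
      simpa using this
    exact h1
  exact h.deriv

theorem deriv_deriv_quadFun (a : ℝ) : deriv (deriv (quadFun a)) = fun _ => 2 * a := by
  rw [deriv_quadFun]
  funext t
  have h : HasDerivAt (fun t : ℝ => a * (1 + 2 * t)) (a * (2 * 1)) t :=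
    (((hasDerivAt_id t).const_mul 2).const_add 1).const_mul a
  rw [h.deriv]; ring

theorem inv_diff_bound {a t t₀ κ H M : ℝ} (ha : 0 < a) (ht : |t| ≤ 1 / 4) (ht₀ : 0 ≤ t₀)
    (hκ : |t - t₀| ≤ κ) (hH : |H| ≤ M) :
    H * (1 / (a * (1 + 2 * t₀))) - 4 * M * κ / a ≤ H * (1 / (a * (1 + 2 * t))) := by
  have ht' := abs_le.1 ht
  have h1 : 0 < 1 + 2 * t := by linarith
  have h0 : 0 < 1 + 2 * t₀ := by linarith
  have hd : H * (1 / (a * (1 + 2 * t))) - H * (1 / (a * (1 + 2 * t₀))) =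
      (H * (t₀ - t)) * (2 / (a * ((1 + 2 * t) * (1 + 2 * t₀)))) := by
    field_simp; ring
  have hM : 0 ≤ M := (abs_nonneg _).trans hH
  have hb : |H * (t₀ - t)| ≤ M * κ := by
    rw [abs_mul, abs_sub_comm]
    exact mul_le_mul hH hκ (abs_nonneg _) hM
  have h2 : 2 / (a * ((1 + 2 * t) * (1 + 2 * t₀))) ≤ 4 / a := by
    rw [div_le_div_iff₀ (by positivity) ha]
    have : 1 / 2 ≤ (1 + 2 * t) * (1 + 2 * t₀) := by nlinarith
    nlinarith
  have h3 : |(H * (t₀ - t)) * (2 / (a * ((1 + 2 * t) * (1 + 2 * t₀))))| ≤ M * κ * (4 / a) := by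
    rw [abs_mul, abs_of_pos (a := 2 / (a * ((1 + 2 * t) * (1 + 2 * t₀)))) (by positivity)]
    exact mul_le_mul hb h2 (by positivity) (by linarith [abs_nonneg (H * (t₀ - t))])
  have h4 := (abs_le.1 h3).1
  have h5 : M * κ * (4 / a) = 4 * M * κ / a := by ring
  linarith

theorem BdryData.exists_weight (h : BdryData Ω ρ W)
    (hpsc : ∀ p ∈ frontier Ω, ∀ v, parA v ρ p = 0 → 0 ≤ (levA ρ v v p).re)
    {η₂ η : ℝ} (h2 : 1 < η₂) (hη : η₂ < η)
    (hkey : ∀ x ∈ nullSet (frontier Ω) ρ, ¬ FiniteTypePt (rePart ρ) x.1 →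
      Complex.normSq (mixTerm ρ W x) / (η₂ - 1) ≤ normDer ρ W x) :
    ∃ ψ : smoothAlg n, cj ψ = ψ ∧ ∀ x ∈ nullSet (frontier Ω) ρ,
      Complex.normSq (mixTerm ρ W x + η * parA x.2 ψ x.1) <
        (η - 1) * (normDer ρ W x +
          ((levA ψ x.2 x.2 x.1).re + η * Complex.normSq (parA x.2 ψ x.1))) := by
  set C := (1 + (η₂ - 1) / (η - η₂)) * η ^ 2 / (η - 1) with hC
  have hη1 : 0 < η - 1 := by linarith
  have hη2 : 0 < η₂ - 1 := by linarith
  have hd : 0 < η - η₂ := by linarith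
  have hη0 : 0 < η := by linarith
  have hC0 : 0 < C := by positivity
  set a := 8 / (9 * C) with ha
  have ha0 : 0 < a := by positivity
  have haC : C * a * (9 / 4) ≤ 2 := by
    have : C * a * (9 / 4) = 2 := by rw [ha]; field_simp; norm_num
    exact this.le
  let H : (Fin n → ℂ) × (Fin n → ℂ) → ℝ := fun x =>
    normDer ρ W x - Complex.normSq (mixTerm ρ W x) / (η₂ - 1)
  have hH : Continuous H := (continuous_normDer ρ W).sub
    ((Complex.continuous_normSq.comp (continuous_mixTerm ρ W)).div_const _)
  have hsq : Continuous (rePart (sqNorm n)) := (contDiff_rePart _).continuous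
  obtain ⟨M₀, hM₀⟩ := h.isCompact.bddAbove_image hsq.continuousOn
  obtain ⟨M₁, hM₁⟩ := (isCompact_nullSet h.isCompact ρ).bddAbove_image
    (f := fun x => |H x|) hH.abs.continuousOn
  set M := |M₁| with hM
  set δ := 1 / (8 * (|M₀| + 1)) with hδ
  have hδ0 : 0 < δ := by positivity
  have hδM : ∀ p ∈ frontier Ω, δ * rePart (sqNorm n) p ≤ 1 / 8 := by
    intro p hp
    have h1 : rePart (sqNorm n) p ≤ |M₀| + 1 := by
      have := hM₀ (Set.mem_image_of_mem _ hp)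
      linarith [le_abs_self M₀]
    have h3 : δ * (|M₀| + 1) = 1 / 8 := by rw [hδ]; field_simp
    rw [← h3]
    exact mul_le_mul_of_nonneg_left h1 hδ0.le
  set κ := min (1 / 8) (a * δ / (8 * (M + 1))) with hκ
  have hM0 : 0 ≤ M := abs_nonneg _
  have hκ0 : 0 < κ := by positivity
  have hκ1 : κ ≤ 1 / 8 := min_le_left _ _
  have hκ2 : 4 * M * κ / a ≤ δ / 2 := by
    have h1 : κ ≤ a * δ / (8 * (M + 1)) := min_le_right _ _
    rw [le_div_iff₀ (by positivity)] at h1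
    rw [div_le_iff₀ ha0]
    nlinarith
  let G : (Fin n → ℂ) × (Fin n → ℂ) → ℝ := fun x =>
    H x * (1 / (a * (1 + 2 * (δ * rePart (sqNorm n) x.1)))) + δ / 2
  have hden : ∀ z : Fin n → ℂ, 0 < a * (1 + 2 * (δ * rePart (sqNorm n) z)) := fun z => by
    have := rePart_sqNorm_nonneg z
    positivity
  have hG : Continuous G := by
    refine (hH.mul (Continuous.div continuous_const ?_ fun x => (hden x.1).ne')).add
      continuous_const
    have := hsq.comp (continuous_fst (X := Fin n → ℂ) (Y := Fin n → ℂ))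
    exact continuous_const.mul (continuous_const.add (continuous_const.mul
      (continuous_const.mul this)))
  obtain ⟨w', hw'1, hw'2, hw'3⟩ := exists_levi_correction h.isCompact h.real h.mem_vanishOn
    (fun q hq => h.parA_field hq) hpsc (fun p hp v => h.levi_lower hpsc hp v) hG
    (c := δ / 4) (by linarith) hκ0 (fun x hx hxt => by
      have h1 : 0 ≤ H x := sub_nonneg.2 (hkey x hx hxt)
      have h3 : 0 ≤ H x * (1 / (a * (1 + 2 * (δ * rePart (sqNorm n) x.1)))) :=
        mul_nonneg h1 (one_div_nonneg.2 (hden x.1).le)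
      simp only [G]
      linarith)
  set w := ((δ : ℝ) : ℂ) • sqNorm n + w' with hw
  have hwr : cj w = w := by
    rw [hw, cj_add, cj_smul, cj_sqNorm, hw'1, Complex.conj_ofReal]
  refine ⟨compReal (quadFun a) (contDiff_quadFun a) w, cj_compReal _ _ _, fun x hx => ?_⟩
  have hxm := mem_nullSet.1 hx
  set t := rePart w x.1 with ht
  have ht1 : t = δ * rePart (sqNorm n) x.1 + rePart w' x.1 := by
    rw [ht, hw]
    simp only [rePart, smoothAlg.add_val, smoothAlg.smul_val, Complex.add_re,
      Complex.re_ofReal_mul]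
  have ht2 : |t - δ * rePart (sqNorm n) x.1| ≤ κ := by
    rw [ht1, add_sub_cancel_left, abs_rePart hw'1]
    exact hw'2 _ hxm.1
  have hs0 : 0 ≤ δ * rePart (sqNorm n) x.1 := mul_nonneg hδ0.le (rePart_sqNorm_nonneg _)
  have ht3 : |t| ≤ 1 / 4 := by
    have h1 := abs_le.1 ht2
    have h3 := hδM _ hxm.1
    exact abs_le.2 ⟨by linarith, by linarith⟩
  have hHM : |H x| ≤ M := (hM₁ (Set.mem_image_of_mem _ hx)).trans (le_abs_self _)
  have hinv := inv_diff_bound ha0 ht3 hs0 ht2 hHM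
  have hlev : (levA w x.2 x.2 x.1).re =
      δ * (∑ j, Complex.normSq (x.2 j)) + (levA w' x.2 x.2 x.1).re := by
    rw [hw, levA_add_fun, levA_smul_fun, levA_sqNorm, Complex.add_re, Complex.re_ofReal_mul,
      Complex.ofReal_re]
  have hl : 0 < (levA w x.2 x.2 x.1).re + H x * (1 / (a * (1 + 2 * t))) := by
    have h1 : 0 < (levA w' x.2 x.2 x.1).re + G x := hw'3 x hx
    have h3 : δ * 1 ≤ δ * (∑ j, Complex.normSq (x.2 j)) :=
      mul_le_mul_of_nonneg_left (one_le_sum_normSq hxm.2.1) hδ0.le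
    simp only [G] at h1
    rw [hlev]
    linarith
  have hmain := weight_ineq (b := parA x.2 w x.1) h2 hη ha0 haC ht3 rfl hl
  rw [levA_compReal _ _ hwr, parA_compReal _ _ hwr, deriv_deriv_quadFun, deriv_quadFun, ← ht]
  convert hmain using 3
  rw [Complex.add_re, Complex.re_ofReal_mul, Complex.re_ofReal_mul, Complex.mul_conj,
    Complex.ofReal_re]

end ChoiceOfWeight

section DefiningData

variable {n : ℕ} {Ω V : Set (Fin n → ℂ)} {ρ₀ : (Fin n → ℂ) → ℝ} {ρ : smoothAlg n}
  {W : Fin n → smoothAlg n}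

/-- A defining function together with a global smooth function equal to it near the boundary
and a transverse field proportional to its complex normal field. -/
structure DefData (Ω : Set (Fin n → ℂ)) (ρ₀ : (Fin n → ℂ) → ℝ) (ρ : smoothAlg n)
    (W : Fin n → smoothAlg n) : Prop extends BdryData Ω ρ W where
  eq : ∀ᶠ z in 𝓝ˢ (frontier Ω), rePart ρ z = ρ₀ z
  normal : ∀ p ∈ frontier Ω, ∃ c : ℝ, 0 < c ∧ nfield ρ₀ p = (c : ℂ) • fieldAt W p ∧
    gradNorm ρ₀ p = 2 * c

/-- The squared norm of the complex gradient. -/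
def gradSq (ρ : smoothAlg n) (z : Fin n → ℂ) : ℝ := ∑ k, Complex.normSq ((dDer k ρ).1 z)

theorem contDiff_gradSq (ρ : smoothAlg n) : ContDiff ℝ (⊤ : ℕ∞) (gradSq ρ) := by
  unfold gradSq
  refine ContDiff.sum fun k _ => ?_
  have h := smoothAlg.contDiff (dDer k ρ)
  have h1 : ContDiff ℝ (⊤ : ℕ∞) fun z => ((dDer k ρ).1 z).re := Complex.reCLM.contDiff.comp h
  have h2 : ContDiff ℝ (⊤ : ℕ∞) fun z => ((dDer k ρ).1 z).im := Complex.imCLM.contDiff.comp h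
  simp only [Complex.normSq_apply]
  exact (h1.mul h1).add (h2.mul h2)

theorem fderiv_eq_zero_of_gradSq (hρ : cj ρ = ρ) {z : Fin n → ℂ} (h : gradSq ρ z = 0) :
    fderiv ℝ (rePart ρ) z = 0 := by
  have h1 : ∀ k, (dDer k ρ).1 z = 0 := fun k => by
    have := (Finset.sum_eq_zero_iff_of_nonneg fun k _ => Complex.normSq_nonneg _).1 h k
      (Finset.mem_univ k)
    exact Complex.normSq_eq_zero.1 this
  ext v
  rw [fderiv_rePart hρ, parA]
  simp [h1]

theorem IsDefFn.frontier_subset (h : IsDefFn Ω V ρ₀) : frontier Ω ⊆ V :=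
  frontier_subset_closure.trans h.subset

theorem IsDefFn.exists_smoothAlg (h : IsDefFn Ω V ρ₀) :
    ∃ ρ : smoothAlg n, cj ρ = ρ ∧ ∀ᶠ z in 𝓝ˢ (frontier Ω), rePart ρ z = ρ₀ z := by
  obtain ⟨χ, hχ, h1, h0, -⟩ := exists_cutoff isClosed_frontier h.isOpen h.frontier_subset
  have hs := contDiff_cutoff_smul h.isOpen hχ h0 h.smooth
  refine ⟨smoothAlg.mk (fun z => ((χ z • ρ₀ z : ℝ) : ℂ)) (Complex.ofRealCLM.contDiff.comp hs),
    smoothAlg.ext fun z => Complex.conj_ofReal _, ?_⟩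
  filter_upwards [h1] with z hz
  change ((χ z • ρ₀ z : ℝ) : ℂ).re = ρ₀ z
  rw [Complex.ofReal_re, hz, one_smul]

/-- The field `conj ∂ρ / |∂ρ|²`, cut off to a neighbourhood of a closed set. -/
theorem exists_field (ρ : smoothAlg n) {K : Set (Fin n → ℂ)} (hK : IsClosed K)
    (hg : ∀ z ∈ K, gradSq ρ z ≠ 0) :
    ∃ W : Fin n → smoothAlg n, ∀ᶠ z in 𝓝ˢ K, gradSq ρ z ≠ 0 ∧
      ∀ j, (W j).1 z = (((gradSq ρ z)⁻¹ : ℝ) : ℂ) * (starRingEnd ℂ) ((dDer j ρ).1 z) := by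
  have hU : IsOpen {z | gradSq ρ z ≠ 0} :=
    isOpen_ne_fun (contDiff_gradSq ρ).continuous continuous_const
  have hKU : K ⊆ {z | gradSq ρ z ≠ 0} := fun z hz => hg z hz
  obtain ⟨χ, hχ, h1, h0, -⟩ := exists_cutoff hK hU hKU
  have hs : ∀ j, ContDiff ℝ (⊤ : ℕ∞) fun z => χ z •
      ((((gradSq ρ z)⁻¹ : ℝ) : ℂ) * (starRingEnd ℂ) ((dDer j ρ).1 z)) := fun j =>
    contDiff_cutoff_smul hU hχ h0
      ((Complex.ofRealCLM.contDiff.comp_contDiffOn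
        ((contDiff_gradSq ρ).contDiffOn.inv fun z hz => hz)).mul
        (Complex.conjCLE.contDiff.comp (smoothAlg.contDiff _)).contDiffOn)
  refine ⟨fun j => smoothAlg.mk _ (hs j), ?_⟩
  filter_upwards [h1, hU.mem_nhdsSet.2 hKU] with z hz hz2
  refine ⟨hz2, fun j => ?_⟩
  change χ z • _ = _
  rw [hz, one_smul]

theorem IsDefFn.exists_defData (h : IsDefFn Ω V ρ₀) (hΩ : IsOpen Ω)
    (hbd : Bornology.IsBounded Ω) : ∃ ρ W, DefData Ω ρ₀ ρ W := by
  obtain ⟨ρ, hρ, heq⟩ := h.exists_smoothAlg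
  have hgerm : ∀ p ∈ frontier Ω, rePart ρ =ᶠ[𝓝 p] ρ₀ := fun p hp =>
    eventually_nhds_of_nhdsSet heq hp
  obtain ⟨W, hW⟩ := exists_field ρ (isClosed_frontier (s := Ω)) fun z hz h0 =>
    h.grad_ne z hz (by rw [← (hgerm z hz).fderiv_eq, fderiv_eq_zero_of_gradSq hρ h0])
  have hK : IsCompact (frontier Ω) :=
    Metric.isCompact_of_isClosed_isBounded isClosed_frontier
      (hbd.closure.subset frontier_subset_closure)
  refine ⟨ρ, W, ⟨hΩ, hK, hρ, ?_, ?_⟩, heq, fun p hp => ?_⟩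
  · filter_upwards [heq, h.isOpen.mem_nhdsSet.2 h.frontier_subset] with z hz hzV
    rw [hz, h.eq, Set.mem_ofPred_eq]
    exact ⟨fun hh => hh.2, fun hh => ⟨hzV, hh⟩⟩
  · filter_upwards [hW] with z hz
    rw [parA]
    simp only [fieldAt, hz.2]
    have : ∀ j, ((((gradSq ρ z)⁻¹ : ℝ) : ℂ) * (starRingEnd ℂ) ((dDer j ρ).1 z)) *
        (dDer j ρ).1 z = (((gradSq ρ z)⁻¹ * Complex.normSq ((dDer j ρ).1 z) : ℝ) : ℂ) := by
      intro j
      rw [Complex.ofReal_mul, ← Complex.mul_conj]; ring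
    simp only [this]
    rw [← Complex.ofReal_sum, ← Finset.mul_sum, ← gradSq, inv_mul_cancel₀ hz.1,
      Complex.ofReal_one]
  · obtain ⟨hne, hWp⟩ := hW.self_of_nhdsSet p hp
    have hpos : 0 < gradSq ρ p :=
      lt_of_le_of_ne (Finset.sum_nonneg fun k _ => Complex.normSq_nonneg _) (Ne.symm hne)
    have hdz : ∀ k, dz k (cplx ρ₀) p = (dDer k ρ).1 p := fun k => by
      rw [← dz_congr (cplx_congr (hgerm p hp)), cplx_rePart hρ, dDer_val]
    have hdzb : ∀ k, dzbar k (cplx ρ₀) p = (starRingEnd ℂ) ((dDer k ρ).1 p) := fun k => by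
      rw [← dzbar_congr (cplx_congr (hgerm p hp)), cplx_rePart hρ, ← dbDer_val, ← cj_val,
        ← dbDer_cj, hρ]
    have hsum : ∑ k, Complex.normSq (dz k (cplx ρ₀) p) = gradSq ρ p := by
      simp only [hdz]; rfl
    refine ⟨Real.sqrt (gradSq ρ p), Real.sqrt_pos.2 hpos, ?_, ?_⟩
    · funext j
      rw [nfield, hsum, hdzb, Pi.smul_apply, smul_eq_mul, fieldAt, hWp, ← mul_assoc,
        ← Complex.ofReal_inv, ← Complex.ofReal_mul]
      congr 2
      have h2 := Real.mul_self_sqrt hpos.le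
      have h3 := (Real.sqrt_pos.2 hpos).ne'
      field_simp
      rw [sq, h2]
    · rw [gradNorm, ← (hgerm p hp).fderiv_eq]
      have : ∀ j, (fderiv ℝ (rePart ρ) p (Pi.single j 1)) ^ 2 +
          (fderiv ℝ (rePart ρ) p (Pi.single j Complex.I)) ^ 2 =
          4 * Complex.normSq ((dDer j ρ).1 p) := by
        intro j
        rw [fderiv_rePart hρ, fderiv_rePart hρ, parA, parA]
        simp only [Pi.single_apply, ite_mul, zero_mul, Finset.sum_ite_eq', Finset.mem_univ,
          if_true, Complex.normSq_apply, one_mul, Complex.I_mul_re]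
        ring
      simp only [this]
      rw [← Finset.mul_sum, ← gradSq, Real.sqrt_mul (by norm_num),
        show (4 : ℝ) = 2 ^ 2 by norm_num, Real.sqrt_sq (by norm_num)]

namespace DefData

theorem germ (h : DefData Ω ρ₀ ρ W) {p : Fin n → ℂ} (hp : p ∈ frontier Ω) :
    rePart ρ =ᶠ[𝓝 p] ρ₀ := eventually_nhds_of_nhdsSet h.eq hp

theorem levi_eq (h : DefData Ω ρ₀ ρ W) {q : Fin n → ℂ} (hq : rePart ρ =ᶠ[𝓝 q] ρ₀)
    (v w : Fin n → ℂ) : levi ρ₀ v w q = levA ρ v w q := by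
  rw [← levi_congr hq, levA_eq_levi h.real]

theorem dirDeriv_eq (h : DefData Ω ρ₀ ρ W) {q : Fin n → ℂ} (hq : rePart ρ =ᶠ[𝓝 q] ρ₀)
    (v : Fin n → ℂ) : dirDeriv v (cplx ρ₀) q = parA v ρ q := by
  rw [← dirDeriv_congr (cplx_congr hq), ← parA_eq_dirDeriv_cplx h.real]

/-- Along null vectors the fibre derivative of the tangential Levi form vanishes. -/
theorem _root_.BdryData.fderiv_leviTan_fibre (h : BdryData Ω ρ W)
    (hpsc : ∀ p ∈ frontier Ω, ∀ v, parA v ρ p = 0 → 0 ≤ (levA ρ v v p).re)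
    {p v : Fin n → ℂ} (hp : p ∈ frontier Ω) (hv : leviTan ρ W (p, v) = 0) (u : Fin n → ℂ) :
    fderiv ℝ (leviTan ρ W) (p, v) (0, u) = 0 := by
  have h1 : HasFDerivAt (leviTan ρ W) (fderiv ℝ (leviTan ρ W) (p, v)) (p, v) :=
    ((contDiff_leviTan ρ W).differentiable (by simp) _).hasFDerivAt
  have h2 : HasDerivAt (fun t : ℝ => ((p, v) : (Fin n → ℂ) × (Fin n → ℂ)) + t • (0, u))
      (0, u) 0 := by
    simpa using ((hasDerivAt_id (0 : ℝ)).smul_const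
      ((0, u) : (Fin n → ℂ) × (Fin n → ℂ))).const_add (p, v)
  have h3 : HasDerivAt (fun t : ℝ => leviTan ρ W ((p, v) + t • (0, u)))
      (fderiv ℝ (leviTan ρ W) (p, v) (0, u)) 0 := by
    have h1' : HasFDerivAt (leviTan ρ W) (fderiv ℝ (leviTan ρ W) (p, v))
        ((p, v) + (0 : ℝ) • ((0, u) : (Fin n → ℂ) × (Fin n → ℂ))) := by
      rw [zero_smul, add_zero]; exact h1
    exact h1'.comp_hasDerivAt (0 : ℝ) h2
  have h4 : IsLocalMin (fun t : ℝ => leviTan ρ W ((p, v) + t • (0, u))) 0 := by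
    refine Filter.Eventually.of_forall fun t => ?_
    change leviTan ρ W ((p, v) + (0 : ℝ) • (0, u)) ≤ leviTan ρ W ((p, v) + t • (0, u))
    rw [zero_smul, add_zero, hv]
    refine h.leviTan_nonneg hpsc ?_
    simpa using hp
  exact h4.hasDerivAt_eq_zero h3

/-- The key inequality in terms of the normal derivative of the tangential Levi form. -/
theorem keyIneqAt_iff (h : DefData Ω ρ₀ ρ W)
    (hpsc : ∀ p ∈ frontier Ω, ∀ v, parA v ρ p = 0 → 0 ≤ (levA ρ v v p).re)
    {U : Set (Fin n → ℂ)} (hU : IsOpen U) {L : (Fin n → ℂ) → (Fin n → ℂ)}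
    (hL : IsTangentField ρ₀ L U) {p : Fin n → ℂ} (hp : p ∈ frontier Ω) (hpU : p ∈ U)
    (h0 : levi ρ₀ (L p) (L p) p = 0) {η₂ : ℝ} :
    keyIneqAt ρ₀ L η₂ p ↔
      Complex.normSq (mixTerm ρ W (p, L p)) / (η₂ - 1) ≤ normDer ρ W (p, L p) := by
  obtain ⟨c, hc, hN, hg⟩ := h.normal p hp
  have htan : ∀ q ∈ U, rePart ρ =ᶠ[𝓝 q] ρ₀ → parA (L q) ρ q = 0 := fun q hq hq2 => by
    rw [← h.dirDeriv_eq hq2]; exact hL.2 q hq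
  have hgerm : (fun w => levi ρ₀ (L w) (L w) w) =ᶠ[𝓝 p]
      cplx fun w => leviTan ρ W (w, L w) := by
    filter_upwards [(h.germ hp).eventuallyEq_nhds, hU.mem_nhds hpU] with q hq hqU
    rw [h.levi_eq hq, cplx, leviTan, tanProj_of_tangent (htan q hqU hq)]
    exact (Complex.conj_eq_iff_re.1 (levA_conj h.real _ _ _)).symm
  have hnull : leviTan ρ W (p, L p) = 0 := by
    have h1 : levi ρ₀ (L p) (L p) p = ((leviTan ρ W (p, L p) : ℝ) : ℂ) := hgerm.self_of_nhds
    rw [h0] at h1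
    exact_mod_cast h1.symm
  have hLd : DifferentiableAt ℝ L p :=
    (hL.1.contDiffAt (hU.mem_nhds hpU)).differentiableAt (by simp)
  have hcomp : HasFDerivAt (fun w => leviTan ρ W (w, L w))
      ((fderiv ℝ (leviTan ρ W) (p, L p)).comp
        ((ContinuousLinearMap.id ℝ (Fin n → ℂ)).prod (fderiv ℝ L p))) p := by
    have h1 : HasFDerivAt (leviTan ρ W) (fderiv ℝ (leviTan ρ W) (p, L p)) (p, L p) :=
      ((contDiff_leviTan ρ W).differentiable (by simp) _).hasFDerivAt
    exact HasFDerivAt.comp p h1 ((hasFDerivAt_id p).prodMk hLd.hasFDerivAt)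
  have hder : (dirDeriv (fieldAt W p) (cplx fun w => leviTan ρ W (w, L w)) p).re =
      normDer ρ W (p, L p) := by
    have h1 := fderiv_cplx hcomp.differentiableAt ((2 : ℝ)⁻¹ • fieldAt W p)
    have h2 : fderiv ℝ (fun w => leviTan ρ W (w, L w)) p ((2 : ℝ)⁻¹ • fieldAt W p) =
        normDer ρ W (p, L p) := by
      rw [hcomp.fderiv]
      change fderiv ℝ (leviTan ρ W) (p, L p) ((2 : ℝ)⁻¹ • fieldAt W p,
        fderiv ℝ L p ((2 : ℝ)⁻¹ • fieldAt W p)) = _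
      have h3 : (((2 : ℝ)⁻¹ • fieldAt W p, fderiv ℝ L p ((2 : ℝ)⁻¹ • fieldAt W p)) :
          (Fin n → ℂ) × (Fin n → ℂ)) = ((2 : ℝ)⁻¹ • fieldAt W p, 0) +
          (0, fderiv ℝ L p ((2 : ℝ)⁻¹ • fieldAt W p)) := by
        rw [Prod.mk_add_mk, add_zero, zero_add]
      rw [h3, map_add, h.toBdryData.fderiv_leviTan_fibre hpsc hp hnull, add_zero]
      rfl
    rw [h2, fderiv_eq_sum_dz] at h1
    have h4 : ∀ j, dzbar j (cplx fun w => leviTan ρ W (w, L w)) p =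
        (starRingEnd ℂ) (dz j (cplx fun w => leviTan ρ W (w, L w)) p) := fun j =>
      dzbar_cplx hcomp.differentiableAt j
    have h5 := congrArg Complex.re h1
    rw [Complex.ofReal_re] at h5
    rw [← h5, dirDeriv, Complex.add_re, Complex.re_sum, Complex.re_sum, Complex.re_sum,
      ← Finset.sum_add_distrib]
    refine Finset.sum_congr rfl fun j _ => ?_
    rw [h4, ← map_mul, Complex.conj_re, Pi.smul_apply, smul_mul_assoc, Complex.smul_re,
      smul_eq_mul]
    ring
  have hD : (fieldDeriv (nfield ρ₀) (fun w => levi ρ₀ (L w) (L w) w) p).re =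
      c * normDer ρ W (p, L p) := by
    rw [fieldDeriv, dirDeriv_congr hgerm, hN, ← hder, dirDeriv, dirDeriv,
      ← Complex.re_ofReal_mul, Finset.mul_sum]
    simp only [Pi.smul_apply, smul_eq_mul, mul_assoc]
  have hM : levi ρ₀ (L p) (nfield ρ₀ p) p = (c : ℂ) * mixTerm ρ W (p, L p) := by
    rw [h.levi_eq (h.germ hp), hN, levA_smul_right, Complex.conj_ofReal]
    rfl
  rw [keyIneqAt, hD, hM, hg, Complex.normSq_mul, Complex.normSq_ofReal]
  have : 1 / (η₂ - 1) * (c * c * Complex.normSq (mixTerm ρ W (p, L p))) / (2 * c) ^ 2 -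
      1 / 2 * (c * normDer ρ W (p, L p)) / (2 * c) =
      (Complex.normSq (mixTerm ρ W (p, L p)) / (η₂ - 1) - normDer ρ W (p, L p)) / 4 := by
    field_simp
    ring
  rw [this]
  constructor
  · intro hh; linarith
  · intro hh; linarith

end DefData

end DefiningData

section PscTransfer

variable {n : ℕ}

theorem IsLocalMax.deriv_deriv_nonpos {f : ℝ → ℝ} {a : ℝ} (h : IsLocalMax f a)
    (hc : ContinuousAt f a) : deriv (deriv f) a ≤ 0 := by
  by_contra hcon
  push Not at hcon
  have h1 := isLocalMin_of_deriv_deriv_pos hcon h.deriv_eq_zero hc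
  have h2 : f =ᶠ[𝓝 a] fun _ => f a := by
    filter_upwards [h, h1] with x hx hx1
    exact le_antisymm hx hx1
  have h3 := h2.deriv.deriv_eq
  rw [h3] at hcon
  simp at hcon

/-- The parabola through `p` with velocity `ξ` and acceleration `2u`. -/
def parabola (p ξ u : Fin n → ℂ) (t : ℝ) : Fin n → ℂ := p + (t • ξ + t ^ 2 • u)

theorem parabola_zero (p ξ u : Fin n → ℂ) : parabola p ξ u 0 = p := by
  simp [parabola]

theorem hasDerivAt_parabola (p ξ u : Fin n → ℂ) (t : ℝ) :
    HasDerivAt (parabola p ξ u) (ξ + (2 * t) • u) t := by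
  have h1 := (((hasDerivAt_id' t).smul_const ξ).add
    (((hasDerivAt_pow 2 t)).smul_const u)).const_add p
  have h2 : HasDerivAt (parabola p ξ u) ((1 : ℝ) • ξ + ((2 : ℕ) * t ^ (2 - 1)) • u) t := h1
  simpa using h2

/-- The real Hessian of `rePart f`. -/
def hessR (f : smoothAlg n) (p ξ : Fin n → ℂ) : ℝ :=
  fderiv ℝ (fderiv ℝ (rePart f)) p ξ ξ

theorem hasDerivAt_rePart_parabola (f : smoothAlg n) (p ξ u : Fin n → ℂ) (t : ℝ) :
    HasDerivAt (fun t => rePart f (parabola p ξ u t))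
      (fderiv ℝ (rePart f) (parabola p ξ u t) (ξ + (2 * t) • u)) t :=
  ((contDiff_rePart f).differentiable (by simp) _).hasFDerivAt.comp_hasDerivAt t
    (hasDerivAt_parabola p ξ u t)

theorem deriv_rePart_parabola (f : smoothAlg n) (p ξ u : Fin n → ℂ) :
    deriv (fun t => rePart f (parabola p ξ u t)) 0 = fderiv ℝ (rePart f) p ξ := by
  rw [(hasDerivAt_rePart_parabola f p ξ u 0).deriv, parabola_zero]
  simp

theorem deriv_deriv_rePart_parabola (f : smoothAlg n) (p ξ u : Fin n → ℂ) :
    deriv (deriv fun t => rePart f (parabola p ξ u t)) 0 =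
      hessR f p ξ + 2 * fderiv ℝ (rePart f) p u := by
  have h1 : deriv (fun t => rePart f (parabola p ξ u t)) =
      fun t => fderiv ℝ (rePart f) (parabola p ξ u t) (ξ + (2 * t) • u) :=
    funext fun t => (hasDerivAt_rePart_parabola f p ξ u t).deriv
  rw [h1]
  have h2 : HasFDerivAt (fderiv ℝ (rePart f)) (fderiv ℝ (fderiv ℝ (rePart f)) p)
      (parabola p ξ u 0) := by
    rw [parabola_zero]
    exact (((contDiff_rePart f).fderiv_right (m := 1)
      (WithTop.coe_le_coe.2 le_top)).differentiable (by simp) p).hasFDerivAt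
  have h3 := h2.comp_hasDerivAt (0 : ℝ) (hasDerivAt_parabola p ξ u 0)
  have h4 : HasDerivAt (fun t : ℝ => ξ + (2 * t) • u) ((2 : ℝ) • u) 0 := by
    simpa using (((hasDerivAt_id (0 : ℝ)).const_mul 2).smul_const u).const_add ξ
  have h5 := h3.clm_apply h4
  have h6 := h5.deriv
  simp only [mul_zero, zero_smul, add_zero, Function.comp_apply, parabola_zero, map_smul,
    smul_eq_mul] at h6
  exact h6

theorem hessR_add_hessR {f : smoothAlg n} (hf : cj f = f) (p v : Fin n → ℂ) :
    hessR f p v + hessR f p (Complex.I • v) = 4 * (levA f v v p).re := by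
  have hfd : ∀ z w, fderiv ℝ (rePart f) z w =
      2 * (∑ k, (starRingEnd ℂ) (w k) * (dbDer k f).1 z).re := by
    intro z w
    rw [fderiv_rePart hf, ← Complex.conj_re (parA w f z), parA, map_sum]
    congr 2
    refine Finset.sum_congr rfl fun k _ => ?_
    rw [map_mul, ← cj_val, ← dbDer_cj, hf]
  have hess : ∀ w, hessR f p w = 2 * (∑ k, (starRingEnd ℂ) (w k) *
      (∑ j, w j * (dDer j (dbDer k f)).1 p +
        ∑ j, (starRingEnd ℂ) (w j) * (dbDer j (dbDer k f)).1 p)).re := by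
    intro w
    have h2 : HasFDerivAt (fderiv ℝ (rePart f)) (fderiv ℝ (fderiv ℝ (rePart f)) p) p :=
      (((contDiff_rePart f).fderiv_right (m := 1)
        (WithTop.coe_le_coe.2 le_top)).differentiable (by simp) p).hasFDerivAt
    have h3 : HasFDerivAt (fun z => fderiv ℝ (rePart f) z w)
        ((fderiv ℝ (fderiv ℝ (rePart f)) p).flip w) p := by
      simpa using h2.clm_apply (hasFDerivAt_const w p)
    have h4 : HasFDerivAt (fun z => ∑ k, (starRingEnd ℂ) (w k) * (dbDer k f).1 z)
        (∑ k, (starRingEnd ℂ) (w k) • fderiv ℝ (dbDer k f).1 p) p := by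
      refine HasFDerivAt.fun_sum fun k _ => ?_
      exact ((smoothAlg.differentiable (dbDer k f) p).hasFDerivAt).const_mul _
    have h5 := (Complex.reCLM.hasFDerivAt.comp p h4).const_mul 2
    have h6 : (fun z => fderiv ℝ (rePart f) z w) = fun z => 2 * (Complex.reCLM ∘
        fun z => ∑ k, (starRingEnd ℂ) (w k) * (dbDer k f).1 z) z := by
      funext z
      rw [hfd]; rfl
    rw [← h6] at h5
    have h7 := congrArg (fun T => T w) (h3.unique h5)
    change hessR f p w = 2 * ((∑ k, (starRingEnd ℂ) (w k) • fderiv ℝ (dbDer k f).1 p) w).re at h7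
    rw [h7, sum_apply]
    congr 2
    refine Finset.sum_congr rfl fun k _ => ?_
    rw [smul_apply, fderiv_eq_sum_dz, smul_eq_mul]
    simp only [dDer_val, dbDer_val]
  have hsum : ∑ k, (starRingEnd ℂ) (v k) *
      (∑ j, v j * (dDer j (dbDer k f)).1 p +
        ∑ j, (starRingEnd ℂ) (v j) * (dbDer j (dbDer k f)).1 p) +
      ∑ k, (starRingEnd ℂ) ((Complex.I • v) k) *
      (∑ j, (Complex.I • v) j * (dDer j (dbDer k f)).1 p +
        ∑ j, (starRingEnd ℂ) ((Complex.I • v) j) * (dbDer j (dbDer k f)).1 p) =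
      2 * levA f v v p := by
    rw [levA, Finset.sum_comm, Finset.mul_sum, ← Finset.sum_add_distrib]
    refine Finset.sum_congr rfl fun k _ => ?_
    simp only [Pi.smul_apply, smul_eq_mul, map_mul, Complex.conj_I, mul_assoc, neg_mul,
      Finset.sum_neg_distrib, ← Finset.mul_sum]
    simp only [mul_add, mul_neg]
    have h1 : ∑ j, (dDer j (dbDer k f)).1 p * (v j * (starRingEnd ℂ) (v k)) =
        (starRingEnd ℂ) (v k) * ∑ j, v j * (dDer j (dbDer k f)).1 p := by
      rw [Finset.mul_sum]
      exact Finset.sum_congr rfl fun j _ => by ring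
    rw [h1]
    linear_combination (-(starRingEnd ℂ) (v k) * (∑ j, v j * (dDer j (dbDer k f)).1 p) +
      (starRingEnd ℂ) (v k) * ∑ j, (starRingEnd ℂ) (v j) * (dbDer j (dbDer k f)).1 p) *
        Complex.I_mul_I
  have h := congrArg Complex.re hsum
  rw [hess, hess]
  rw [Complex.add_re, show (2 : ℂ) = ((2 : ℝ) : ℂ) by norm_num, Complex.re_ofReal_mul] at h
  linarith

namespace BdryData

variable {Ω : Set (Fin n → ℂ)} {ρ ρ₁ : smoothAlg n} {W W₁ : Fin n → smoothAlg n}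

/-- Parabolas bending into the domain give one-sided information on every defining function. -/
theorem parabola_compare (h : BdryData Ω ρ W) (h₁ : BdryData Ω ρ₁ W₁) {p : Fin n → ℂ}
    (hp : p ∈ frontier Ω) {ξ u : Fin n → ℂ} (hξ : fderiv ℝ (rePart ρ) p ξ = 0)
    (hu : hessR ρ p ξ + 2 * fderiv ℝ (rePart ρ) p u < 0) :
    fderiv ℝ (rePart ρ₁) p ξ = 0 ∧ hessR ρ₁ p ξ + 2 * fderiv ℝ (rePart ρ₁) p u ≤ 0 := by
  have hc : ∀ f : smoothAlg n, ContinuousAt (fun t => rePart f (parabola p ξ u t)) 0 :=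
    fun f => (hasDerivAt_rePart_parabola f p ξ u 0).continuousAt
  have hmax : IsLocalMax (fun t => rePart ρ (parabola p ξ u t)) 0 := by
    refine isLocalMax_of_deriv_deriv_neg ?_ ?_ (hc ρ)
    · rw [deriv_deriv_rePart_parabola]; exact hu
    · rw [deriv_rePart_parabola, hξ]
  have hcp : Filter.Tendsto (parabola p ξ u) (𝓝 0) (𝓝 p) := by
    have := (hasDerivAt_parabola p ξ u 0).continuousAt.tendsto
    rwa [parabola_zero] at this
  have hmax₁ : IsLocalMax (fun t => rePart ρ₁ (parabola p ξ u t)) 0 := by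
    filter_upwards [hmax, hcp.eventually (eventually_nhds_of_nhdsSet h.notMem_closure_iff hp),
      hcp.eventually (eventually_nhds_of_nhdsSet h₁.notMem_closure_iff hp)] with t ht h1 h2
    rw [parabola_zero, h₁.rho_eq_zero hp]
    rw [parabola_zero, h.rho_eq_zero hp] at ht
    by_contra hcon
    exact absurd (h1.1 (h2.2 (not_le.1 hcon))) (not_lt.2 ht)
  refine ⟨?_, ?_⟩
  · rw [← deriv_rePart_parabola ρ₁ p ξ u]; exact hmax₁.deriv_eq_zero
  · rw [← deriv_deriv_rePart_parabola]; exact hmax₁.deriv_deriv_nonpos (hc ρ₁)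

/-- Pseudoconvexity does not depend on the defining function. -/
theorem psc_transfer (h : BdryData Ω ρ W) (h₁ : BdryData Ω ρ₁ W₁)
    (hpsc : ∀ p ∈ frontier Ω, ∀ v, parA v ρ₁ p = 0 → 0 ≤ (levA ρ₁ v v p).re) :
    ∀ p ∈ frontier Ω, ∀ v, parA v ρ p = 0 → 0 ≤ (levA ρ v v p).re := by
  intro p hp v hv
  set ν := (2 : ℝ)⁻¹ • fieldAt W p with hν
  have hν1 : fderiv ℝ (rePart ρ) p ν = 1 := h.fderiv_field (h.parA_field hp)
  have key : ∀ ξ, fderiv ℝ (rePart ρ) p ξ = 0 → ∀ a : ℝ, hessR ρ p ξ + 2 * a < 0 →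
      fderiv ℝ (rePart ρ₁) p ξ = 0 ∧
        hessR ρ₁ p ξ + 2 * (a * fderiv ℝ (rePart ρ₁) p ν) ≤ 0 := by
    intro ξ hξ a ha
    have := h.parabola_compare h₁ hp (u := a • ν) hξ
      (by rw [map_smul, hν1, smul_eq_mul, mul_one]; exact ha)
    rwa [map_smul, smul_eq_mul] at this
  have hker : ∀ ξ, fderiv ℝ (rePart ρ) p ξ = 0 → fderiv ℝ (rePart ρ₁) p ξ = 0 := fun ξ hξ =>
    (key ξ hξ (-(hessR ρ p ξ) / 2 - 1) (by linarith)).1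
  set lam := fderiv ℝ (rePart ρ₁) p ν with hlam
  have hlam0 : 0 ≤ lam := by
    have h0 : ∀ f : smoothAlg n, hessR f p 0 = 0 := fun f => by simp [hessR]
    have := (key 0 (map_zero _) (-1) (by rw [h0]; norm_num)).2
    rw [h0] at this
    linarith
  have hlam1 : lam ≠ 0 := by
    intro hl
    set ν₁ := (2 : ℝ)⁻¹ • fieldAt W₁ p with hν₁
    have h1 := hker (ν₁ - fderiv ℝ (rePart ρ) p ν₁ • ν)
      (by rw [map_sub, map_smul (fderiv ℝ (rePart ρ) p) _ ν, hν1]; simp)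
    rw [map_sub, map_smul (fderiv ℝ (rePart ρ₁) p) _ ν, ← hlam, hl,
      h₁.fderiv_field (h₁.parA_field hp)] at h1
    simp at h1
  have hlam2 : 0 < lam := lt_of_le_of_ne hlam0 (Ne.symm hlam1)
  have e1 : fderiv ℝ (rePart ρ) p v = 0 := by rw [fderiv_rePart h.real, hv]; simp
  have e2 : fderiv ℝ (rePart ρ) p (Complex.I • v) = 0 := by
    rw [fderiv_rePart h.real, parA_smul, hv]; simp
  have hv₁ : parA v ρ₁ p = 0 := by
    have f1 := hker _ e1
    have f2 := hker _ e2
    rw [fderiv_rePart h₁.real] at f1 f2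
    rw [parA_smul, Complex.I_mul_re] at f2
    exact Complex.ext (by simpa using f1) (by simpa using f2)
  have hn := hpsc p hp v hv₁
  by_contra hcon
  push Not at hcon
  have s0 := hessR_add_hessR h.real p v
  have s1 := hessR_add_hessR h₁.real p v
  set d := -(levA ρ v v p).re / 4 with hd
  have hd0 : 0 < d := by rw [hd]; linarith
  have k1 := (key v e1 (-(hessR ρ p v) / 2 - d) (by linarith)).2
  have k2 := (key _ e2 (-(hessR ρ p (Complex.I • v)) / 2 - d) (by linarith)).2
  have hd' : (levA ρ v v p).re = -4 * d := by rw [hd]; ring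
  have : 0 < lam * d := mul_pos hlam2 hd0
  have e3 : lam * (hessR ρ p v + hessR ρ p (Complex.I • v)) = lam * (-16 * d) := by
    rw [s0, hd']; ring
  nlinarith

end BdryData

end PscTransfer

section Necessity

variable {n : ℕ} {Ω V : Set (Fin n → ℂ)} {ρ₀ : (Fin n → ℂ) → ℝ} {ρ : smoothAlg n}
  {W : Fin n → smoothAlg n}

/-- The Levi form of a power of a positive function. -/
theorem levi_rpow (hρ : cj ρ = ρ) {q : Fin n → ℂ} (hq : rePart ρ =ᶠ[𝓝 q] ρ₀)
    (hr : 0 < rePart ρ q) (η : ℝ) (X : Fin n → ℂ) :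
    (levi (fun z => ρ₀ z ^ η) X X q).re = η * rePart ρ q ^ (η - 1 - 1) *
      (rePart ρ q * (levA ρ X X q).re + (η - 1) * Complex.normSq (parA X ρ q)) := by
  have h1 : (fun z => rePart ρ z ^ η) =ᶠ[𝓝 q] fun z => ρ₀ z ^ η := by
    filter_upwards [hq] with z hz
    rw [hz]
  have h2 : (2 : WithTop ℕ∞) ≤ ((⊤ : ℕ∞) : WithTop ℕ∞) :=
    WithTop.coe_le_coe.2 (le_top : (2 : ℕ∞) ≤ ⊤)
  have h3 := levi_comp (g := fun t => t ^ η) ((contDiff_rePart ρ).contDiffAt.of_le h2 (x := q))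
    (Real.contDiffAt_rpow_const_of_ne hr.ne') X X
  have h4 : deriv (deriv fun t : ℝ => t ^ η) (rePart ρ q) =
      η * ((η - 1) * rePart ρ q ^ (η - 1 - 1)) := by
    rw [Real.deriv_rpow_const', deriv_const_mul_field, Real.deriv_rpow_const]
  rw [← levi_congr h1, h3, h4, Real.deriv_rpow_const, ← levA_eq_levi hρ,
    ← parA_eq_dirDeriv_cplx hρ, Complex.mul_conj, Complex.add_re, Complex.re_ofReal_mul,
    Complex.re_ofReal_mul, Complex.ofReal_re]
  have h5 : rePart ρ q ^ (η - 1) = rePart ρ q ^ (η - 1 - 1) * rePart ρ q := by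
    rw [← Real.rpow_add_one hr.ne']; congr 1; ring
  rw [h5]; ring

namespace DefData

/-- The Steinness condition forces a lower bound on the normal derivative along null vectors. -/
theorem quadratic_of_mem_steinExpSet (h : DefData Ω ρ₀ ρ W) {η : ℝ}
    (hη : η ∈ steinExpSet Ω ρ₀) {p v : Fin n → ℂ} (hp : p ∈ frontier Ω)
    (hv : parA v ρ p = 0) (hnull : leviTan ρ W (p, v) = 0) (t : ℂ) :
    0 ≤ normDer ρ W (p, v) + 2 * ((starRingEnd ℂ) t * mixTerm ρ W (p, v)).re +
      (η - 1) * Complex.normSq t := by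
  obtain ⟨hη1, O, hO, hfO, hpsh⟩ := hη
  set ν := (2 : ℝ)⁻¹ • fieldAt W p with hν
  have hν1 : fderiv ℝ (rePart ρ) p ν = 1 := h.fderiv_field (h.parA_field hp)
  let c : ℝ → (Fin n → ℂ) := fun s => p + s • ν
  have hc : Continuous c := continuous_const.add (continuous_id.smul continuous_const)
  have hc0 : c 0 = p := by simp [c]
  have hct : Filter.Tendsto c (𝓝[>] 0) (𝓝 p) := by
    have := hc.tendsto 0
    rw [hc0] at this
    exact this.mono_left nhdsWithin_le_nhds
  have hslope : ∀ {f : ℝ → ℝ} {d : ℝ}, HasDerivAt f d 0 → f 0 = 0 →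
      Filter.Tendsto (fun s => f s / s) (𝓝[>] 0) (𝓝 d) := by
    intro f d hf hf0
    have h1 := (hasDerivAt_iff_tendsto_slope.1 hf).mono_left
      (nhdsWithin_mono (0 : ℝ) fun t ht => (ne_of_gt ht))
    refine h1.congr fun s => ?_
    rw [slope_def_field, hf0, sub_zero, sub_zero]
  have hr1 : Filter.Tendsto (fun s => rePart ρ (c s) / s) (𝓝[>] 0) (𝓝 1) := by
    refine hslope ?_ (by rw [hc0, h.rho_eq_zero hp])
    rw [← hν1]
    exact BdryData.hasDerivAt_line p ν
  have hl1 : Filter.Tendsto (fun s => leviTan ρ W (c s, v) / s) (𝓝[>] 0)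
      (𝓝 (normDer ρ W (p, v))) := by
    refine hslope ?_ (by rw [hc0, hnull])
    have h1 : HasFDerivAt (leviTan ρ W) (fderiv ℝ (leviTan ρ W) (p, v)) (c 0, v) := by
      rw [hc0]
      exact ((contDiff_leviTan ρ W).differentiable (by simp) _).hasFDerivAt
    have h2 : HasDerivAt c ν 0 := by
      simpa [c] using ((hasDerivAt_id (0 : ℝ)).smul_const ν).const_add p
    exact h1.comp_hasDerivAt (0 : ℝ) (h2.prodMk (hasDerivAt_const 0 v))
  have hA : Filter.Tendsto (fun s => levA ρ (tanProj ρ W (c s, v)) (fieldAt W (c s)) (c s))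
      (𝓝[>] 0) (𝓝 (mixTerm ρ W (p, v))) := by
    have h1 : Continuous fun q : Fin n → ℂ =>
        levA ρ (tanProj ρ W (q, v)) (fieldAt W q) q :=
      (contDiff_levA ρ contDiff_id ((contDiff_tanProj ρ W).comp
        (contDiff_id.prodMk contDiff_const)) (contDiff_fieldAt W)).continuous
    have h2 := (h1.tendsto p).comp hct
    rwa [tanProj_of_tangent (x := (p, v)) hv] at h2
  have hL : Filter.Tendsto (fun s => (levA ρ (fieldAt W (c s)) (fieldAt W (c s)) (c s)).re)
      (𝓝[>] 0) (𝓝 (levA ρ (fieldAt W p) (fieldAt W p) p).re) := by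
    have h1 : Continuous fun q : Fin n → ℂ => (levA ρ (fieldAt W q) (fieldAt W q) q).re :=
      Complex.continuous_re.comp
        (contDiff_levA ρ contDiff_id (contDiff_fieldAt W) (contDiff_fieldAt W)).continuous
    exact (h1.tendsto p).comp hct
  have hr0 : Filter.Tendsto (fun s => rePart ρ (c s)) (𝓝[>] 0) (𝓝 0) := by
    have := ((contDiff_rePart ρ).continuous.tendsto p).comp hct
    rwa [h.rho_eq_zero hp] at this
  have hlim : Filter.Tendsto (fun s => (leviTan ρ W (c s, v) / s) / (rePart ρ (c s) / s) +
      2 * ((starRingEnd ℂ) t * levA ρ (tanProj ρ W (c s, v)) (fieldAt W (c s)) (c s)).re +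
      rePart ρ (c s) * (Complex.normSq t *
        (levA ρ (fieldAt W (c s)) (fieldAt W (c s)) (c s)).re) + (η - 1) * Complex.normSq t)
      (𝓝[>] 0) (𝓝 (normDer ρ W (p, v) / 1 +
        2 * ((starRingEnd ℂ) t * mixTerm ρ W (p, v)).re +
        0 * (Complex.normSq t * (levA ρ (fieldAt W p) (fieldAt W p) p).re) +
        (η - 1) * Complex.normSq t)) :=
    (((hl1.div hr1 one_ne_zero).add (((Complex.continuous_re.tendsto _).comp
      (hA.const_mul _)).const_mul 2)).add (hr0.mul (hL.const_mul _))).add tendsto_const_nhds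
  rw [div_one, zero_mul, add_zero] at hlim
  refine ge_of_tendsto hlim ?_
  filter_upwards [self_mem_nhdsWithin, hr1.eventually (lt_mem_nhds (show (0 : ℝ) < 1 by norm_num)),
    hct.eventually (eventually_nhds_of_nhdsSet h.notMem_closure_iff hp),
    hct.eventually (eventually_nhds_of_nhdsSet h.norm hp),
    hct.eventually (h.germ hp).eventuallyEq_nhds,
    hct.eventually (hO.mem_nhds (hfO hp))] with s hs hrs hcl hn hge hsO
  have hs0 : (0 : ℝ) < s := hs
  have hr : 0 < rePart ρ (c s) := by
    have := mul_pos hrs hs0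
    rwa [div_mul_cancel₀ _ hs0.ne'] at this
  set r := rePart ρ (c s) with hrdef
  set X := tanProj ρ W (c s, v) + ((r : ℂ) * t) • fieldAt W (c s) with hX
  have hα : parA X ρ (c s) = r * t := by
    rw [hX, parA_add, BdryData.tanProj_tangent (x := (c s, v)) hn, parA_smul, hn]
    ring
  have hnon : 0 ≤ r * (levA ρ X X (c s)).re + (η - 1) * Complex.normSq (parA X ρ (c s)) := by
    by_cases hX0 : X = 0
    · rw [hX0]
      simp [levA, parA]
    · have h1 := hpsh (c s) ⟨hcl.2 hr, hsO⟩ X hX0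
      rw [levi_rpow h.real hge hr] at h1
      have h2 : 0 < η * rePart ρ (c s) ^ (η - 1 - 1) :=
        mul_pos (by linarith) (Real.rpow_pos_of_pos hr _)
      exact (pos_of_mul_pos_right h1 h2.le).le
  have hlev : (levA ρ X X (c s)).re = leviTan ρ W (c s, v) +
      2 * ((starRingEnd ℂ) ((r : ℂ) * t) *
        levA ρ (tanProj ρ W (c s, v)) (fieldAt W (c s)) (c s)).re +
      Complex.normSq ((r : ℂ) * t) * (levA ρ (fieldAt W (c s)) (fieldAt W (c s)) (c s)).re :=
    levA_add_smul_re h.real _ _ _ _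
  rw [hα, hlev, map_mul, Complex.conj_ofReal, mul_assoc, Complex.re_ofReal_mul,
    Complex.normSq_mul, Complex.normSq_ofReal] at hnon
  have e1 : leviTan ρ W (c s, v) / s / (r / s) = leviTan ρ W (c s, v) / r := by
    field_simp
  change 0 ≤ leviTan ρ W (c s, v) / s / (r / s) + _ + r * _ + _
  rw [e1]
  have e2 : r ^ 2 * (leviTan ρ W (c s, v) / r) = r * leviTan ρ W (c s, v) := by
    field_simp
  refine nonneg_of_mul_nonneg_right (a := r ^ 2) ?_ (by positivity)
  rw [mul_add, mul_add, mul_add, e2]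
  linarith

theorem normDer_lower_of_mem_steinExpSet (h : DefData Ω ρ₀ ρ W) {η : ℝ}
    (hη : η ∈ steinExpSet Ω ρ₀) {p v : Fin n → ℂ} (hp : p ∈ frontier Ω)
    (hv : parA v ρ p = 0) (hnull : leviTan ρ W (p, v) = 0) :
    Complex.normSq (mixTerm ρ W (p, v)) / (η - 1) ≤ normDer ρ W (p, v) := by
  have hη1 : 0 < η - 1 := by have := hη.1; linarith
  set A := mixTerm ρ W (p, v) with hA
  have h1 := h.quadratic_of_mem_steinExpSet hη hp hv hnull (((-(η - 1)⁻¹ : ℝ) : ℂ) * A)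
  rw [← hA, map_mul, Complex.conj_ofReal, mul_assoc, Complex.re_ofReal_mul, mul_comm _ A,
    Complex.mul_conj, Complex.ofReal_re, Complex.normSq_mul, Complex.normSq_ofReal] at h1
  have h2 : 2 * (-(η - 1)⁻¹ * Complex.normSq A) + (η - 1) *
      (-(η - 1)⁻¹ * -(η - 1)⁻¹ * Complex.normSq A) = -(Complex.normSq A / (η - 1)) := by
    field_simp
    ring
  linarith

/-- Every Steinness exponent satisfies the key inequality at the infinite type points. -/
theorem steinExpSet_subset (h : DefData Ω ρ₀ ρ W)
    (hpsc : ∀ p ∈ frontier Ω, ∀ v, parA v ρ p = 0 → 0 ≤ (levA ρ v v p).re)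
    {U : Set (Fin n → ℂ)} (hU : IsOpen U) (hfr : frontier Ω ⊆ U) :
    steinExpSet Ω ρ₀ ⊆ etaRhoInfSet Ω U ρ₀ := by
  intro η hη
  refine ⟨hη.1, fun L hL p hp _ h0 => ?_⟩
  rw [h.keyIneqAt_iff hpsc hU hL hp (hfr hp) h0]
  have hv : parA (L p) ρ p = 0 := by
    rw [← h.dirDeriv_eq (h.germ hp)]; exact hL.2 p (hfr hp)
  refine h.normDer_lower_of_mem_steinExpSet hη hp hv ?_
  rw [h.levi_eq (h.germ hp)] at h0
  rw [leviTan, tanProj_of_tangent (x := (p, L p)) hv, h0, Complex.zero_re]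

end DefData

end Necessity

section Sufficiency

variable {n : ℕ} {Ω V : Set (Fin n → ℂ)} {ρ₀ : (Fin n → ℂ) → ℝ} {ρ : smoothAlg n}
  {W : Fin n → smoothAlg n}

theorem parA_mul (f g : smoothAlg n) (v q : Fin n → ℂ) :
    parA v (f * g) q = f.1 q * parA v g q + g.1 q * parA v f q := by
  simp only [parA, Derivation.leibniz, smul_eq_mul, smoothAlg.add_val, smoothAlg.mul_val,
    Finset.mul_sum, ← Finset.sum_add_distrib]
  exact Finset.sum_congr rfl fun j _ => by ring

theorem levA_mul {f g : smoothAlg n} (hf : cj f = f) (hg : cj g = g) (v w q : Fin n → ℂ) :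
    levA (f * g) v w q = f.1 q * levA g v w q + g.1 q * levA f v w q +
      parA v f q * (starRingEnd ℂ) (parA w g q) + parA v g q * (starRingEnd ℂ) (parA w f q) := by
  have hc : ∀ f : smoothAlg n, cj f = f → ∀ k, (starRingEnd ℂ) ((dDer k f).1 q) =
      (dbDer k f).1 q := fun f hf k => by rw [← cj_val, ← dbDer_cj, hf]
  have key : ∀ j k, (dDer j (dbDer k (f * g))).1 q =
      f.1 q * (dDer j (dbDer k g)).1 q + g.1 q * (dDer j (dbDer k f)).1 q +
        (dDer j f).1 q * (dbDer k g).1 q + (dDer j g).1 q * (dbDer k f).1 q := fun j k => by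
    simp only [Derivation.leibniz, map_add, smul_eq_mul, smoothAlg.add_val, smoothAlg.mul_val]
    ring
  simp only [levA, parA, map_sum, map_mul, hc f hf, hc g hg]
  rw [Finset.sum_mul_sum, Finset.sum_mul_sum, Finset.mul_sum, Finset.mul_sum,
    ← Finset.sum_add_distrib, ← Finset.sum_add_distrib, ← Finset.sum_add_distrib]
  refine Finset.sum_congr rfl fun j _ => ?_
  rw [Finset.mul_sum, Finset.mul_sum,
    ← Finset.sum_add_distrib, ← Finset.sum_add_distrib, ← Finset.sum_add_distrib]
  refine Finset.sum_congr rfl fun k _ => ?_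
  rw [key]
  ring

/-- The exponential of a smooth function. -/
def expAlg (ψ : smoothAlg n) : smoothAlg n := compReal Real.exp Real.contDiff_exp ψ

theorem cj_expAlg (ψ : smoothAlg n) : cj (expAlg ψ) = expAlg ψ := cj_compReal _ _ _

theorem rePart_mul_expAlg (ρ ψ : smoothAlg n) (z : Fin n → ℂ) :
    rePart (ρ * expAlg ψ) z = rePart ρ z * Real.exp (rePart ψ z) := by
  rw [rePart, smoothAlg.mul_val, expAlg, compReal_val, mul_comm, Complex.re_ofReal_mul, mul_comm]
  rfl

theorem powForm_eq (hρ : cj ρ = ρ) {ψ : smoothAlg n} (hψ : cj ψ = ψ) (η : ℝ)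
    {q : Fin n → ℂ} (hr : 0 < rePart ρ q) (v : Fin n → ℂ) :
    rePart (ρ * expAlg ψ) q * (levA (ρ * expAlg ψ) v v q).re +
      (η - 1) * Complex.normSq (parA v (ρ * expAlg ψ) q) =
      Real.exp (rePart ψ q) ^ 2 * (rePart ρ q * powForm ρ ψ η (q, v)) := by
  have hE : (expAlg ψ).1 q = ((Real.exp (rePart ψ q) : ℝ) : ℂ) := rfl
  have hEp : parA v (expAlg ψ) q = ((Real.exp (rePart ψ q) : ℝ) : ℂ) * parA v ψ q := by
    rw [expAlg, parA_compReal _ _ hψ, Real.deriv_exp]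
  have hEl : levA (expAlg ψ) v v q = ((Real.exp (rePart ψ q) : ℝ) : ℂ) * levA ψ v v q +
      ((Real.exp (rePart ψ q) : ℝ) : ℂ) * (parA v ψ q * (starRingEnd ℂ) (parA v ψ q)) := by
    rw [expAlg, levA_compReal _ _ hψ, Real.deriv_exp, Real.deriv_exp]
  have hd : rePart ρ q * ((η - 1) * Complex.normSq (parA v ρ q) / rePart ρ q) =
      (η - 1) * Complex.normSq (parA v ρ q) := by field_simp
  have hpf : rePart ρ q * powForm ρ ψ η (q, v) = rePart ρ q * (levA ρ v v q).re +
      (η - 1) * Complex.normSq (parA v ρ q) +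
      rePart ρ q * (2 * η * (parA v ρ q * (starRingEnd ℂ) (parA v ψ q)).re) +
      rePart ρ q * (rePart ρ q * ((levA ψ v v q).re +
        η * Complex.normSq (parA v ψ q))) := by
    rw [powForm, mul_add, mul_add, mul_add, hd]
  rw [hpf, rePart_mul_expAlg, levA_mul hρ (cj_expAlg ψ), parA_mul, hEl, hEp, hE,
    ← ofReal_rePart hρ]
  simp only [Complex.normSq_apply, Complex.add_re, Complex.add_im, Complex.mul_re, Complex.mul_im,
    Complex.conj_re, Complex.conj_im, Complex.ofReal_re, Complex.ofReal_im]
  ring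

theorem powForm_smul (ρ ψ : smoothAlg n) (η : ℝ) (c : ℝ) (q v : Fin n → ℂ) :
    powForm ρ ψ η (q, (c : ℂ) • v) = c ^ 2 * powForm ρ ψ η (q, v) := by
  simp only [powForm, levA_smul_left, levA_smul_right, parA_smul, Complex.conj_ofReal, map_mul,
    Complex.normSq_ofReal, Complex.re_ofReal_mul]
  have : ((c : ℂ) * parA v ρ q * ((c : ℂ) * (starRingEnd ℂ) (parA v ψ q))).re =
      c ^ 2 * (parA v ρ q * (starRingEnd ℂ) (parA v ψ q)).re := by
    rw [← Complex.re_ofReal_mul]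
    congr 1
    push_cast
    ring
  rw [this]
  ring

theorem IsDefFn.mul_exp (h : IsDefFn Ω V ρ₀) (h0 : ∀ p ∈ frontier Ω, ρ₀ p = 0) (ψ : smoothAlg n) :
    IsDefFn Ω V fun z => ρ₀ z * Real.exp (rePart ψ z) := by
  have hE : ContDiff ℝ (⊤ : ℕ∞) fun z => Real.exp (rePart ψ z) := (contDiff_rePart ψ).exp
  refine ⟨h.isOpen, h.subset, h.smooth.mul hE.contDiffOn, ?_, fun p hp => ?_⟩
  · conv_lhs => rw [h.eq]
    ext z
    rw [Set.mem_ofPred_eq, Set.mem_ofPred_eq, mul_neg_iff]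
    have := Real.exp_pos (rePart ψ z)
    constructor
    · exact fun hz => ⟨hz.1, Or.inr ⟨hz.2, this⟩⟩
    · rintro ⟨h1, h2 | h2⟩
      · exact absurd h2.2 (not_lt.2 this.le)
      · exact ⟨h1, h2.1⟩
  · have h1 : DifferentiableAt ℝ ρ₀ p :=
      (h.smooth.contDiffAt (h.isOpen.mem_nhds (h.subset hp.1))).differentiableAt (by simp)
    have h2 : DifferentiableAt ℝ (fun z => Real.exp (rePart ψ z)) p :=
      hE.differentiable (by simp) p
    rw [fderiv_fun_mul h1 h2, h0 p hp, zero_smul, zero_add]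
    exact smul_ne_zero (Real.exp_pos _).ne' (h.grad_ne p hp)

namespace DefData

theorem apply_eq_zero (h : DefData Ω ρ₀ ρ W) {p : Fin n → ℂ} (hp : p ∈ frontier Ω) :
    ρ₀ p = 0 := by
  rw [← (h.germ hp).self_of_nhds, h.rho_eq_zero hp]

/-- Every tangent vector at a boundary point extends to a tangent vector field. -/
theorem exists_tangentField (h : DefData Ω ρ₀ ρ W) (U : Set (Fin n → ℂ)) {p v : Fin n → ℂ}
    (hp : p ∈ frontier Ω) (hv : parA v ρ p = 0) : ∃ L, IsTangentField ρ₀ L U ∧ L p = v := by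
  obtain ⟨O, hO, hOo, hpO⟩ := eventually_nhds_iff.1
    ((h.germ hp).eventuallyEq_nhds.and (eventually_nhds_of_nhdsSet h.norm hp))
  obtain ⟨χ, hχ, h1, h0, -⟩ := exists_cutoff (isClosed_singleton (x := p)) hOo
    (Set.singleton_subset_iff.2 hpO)
  refine ⟨fun z => ((χ z : ℝ) : ℂ) • tanProj ρ W (z, v), ⟨?_, fun z _ => ?_⟩, ?_⟩
  · exact ((Complex.ofRealCLM.contDiff.comp hχ).smul ((contDiff_tanProj ρ W).comp
      (contDiff_id.prodMk contDiff_const))).contDiffOn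
  · by_cases hz : z ∈ O
    · rw [h.dirDeriv_eq (hO z hz).1, parA_smul,
        BdryData.tanProj_tangent (x := (z, v)) (hO z hz).2, mul_zero]
    · have : χ z = 0 := h0.self_of_nhdsSet z hz
      simp [this, dirDeriv]
  · have : χ p = 1 := h1.self_of_nhdsSet p rfl
    change ((χ p : ℝ) : ℂ) • tanProj ρ W (p, v) = v
    rw [this, tanProj_of_tangent (x := (p, v)) hv, Complex.ofReal_one, one_smul]

theorem normDer_lower_of_mem_etaRhoInfSet (h : DefData Ω ρ₀ ρ W)
    (hpsc : ∀ p ∈ frontier Ω, ∀ v, parA v ρ p = 0 → 0 ≤ (levA ρ v v p).re)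
    {U : Set (Fin n → ℂ)} (hU : IsOpen U) (hfr : frontier Ω ⊆ U) {η₂ : ℝ}
    (hη : η₂ ∈ etaRhoInfSet Ω U ρ₀) :
    ∀ x ∈ nullSet (frontier Ω) ρ, ¬ FiniteTypePt (rePart ρ) x.1 →
      Complex.normSq (mixTerm ρ W x) / (η₂ - 1) ≤ normDer ρ W x := by
  rintro ⟨p, v⟩ hx hinf
  obtain ⟨hp, -, hv, hl⟩ := mem_nullSet.1 hx
  obtain ⟨L, hL, hLp⟩ := h.exists_tangentField U hp hv
  have h0 : levi ρ₀ (L p) (L p) p = 0 := by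
    rw [h.levi_eq (h.germ hp), hLp]
    rw [← Complex.conj_eq_iff_re.1 (levA_conj h.real v v p), hl, Complex.ofReal_zero]
  have hinf' : ¬ FiniteTypePt ρ₀ p := by rwa [← finiteTypePt_congr (h.germ hp)]
  have := (h.keyIneqAt_iff hpsc hU hL hp (hfr hp) h0).1 (hη.2 L hL p hp hinf' h0)
  rwa [hLp] at this

/-- Exponents beyond one satisfying the key inequality are Steinness exponents of a modified
defining function. -/
theorem exists_mem_steinExpSet (h : DefData Ω ρ₀ ρ W) (hdef : IsDefFn Ω V ρ₀)
    (hpsc : ∀ p ∈ frontier Ω, ∀ v, parA v ρ p = 0 → 0 ≤ (levA ρ v v p).re)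
    {U : Set (Fin n → ℂ)} (hU : IsOpen U) (hfr : frontier Ω ⊆ U) {η₂ η : ℝ}
    (hη₂ : η₂ ∈ etaRhoInfSet Ω U ρ₀) (hη : η₂ < η) :
    ∃ ρ' : (Fin n → ℂ) → ℝ, IsDefFn Ω V ρ' ∧ η ∈ steinExpSet Ω ρ' := by
  have hη1 : 1 < η := hη₂.1.trans hη
  obtain ⟨ψ, hψ, hnull⟩ := h.exists_weight hpsc hη₂.1 hη
    (h.normDer_lower_of_mem_etaRhoInfSet hpsc hU hfr hη₂)
  refine ⟨_, hdef.mul_exp (fun p hp => h.apply_eq_zero hp) ψ, hη1, ?_⟩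
  obtain ⟨O, hO, hfO, hP⟩ := eventually_nhdsSet_iff_exists.1
    ((h.powForm_pos_nhdsSet hpsc ψ hη1 hnull).and
      (h.notMem_closure_iff.and h.eq.eventually_nhdsSet))
  refine ⟨O, hO, hfO, fun q hq X hX => ?_⟩
  obtain ⟨h1, h2, h3⟩ := hP q hq.2
  have hr : 0 < rePart ρ q := h2.1 hq.1
  have hgerm : rePart (ρ * expAlg ψ) =ᶠ[𝓝 q] fun z => ρ₀ z * Real.exp (rePart ψ z) := by
    filter_upwards [h3] with z hz
    rw [rePart_mul_expAlg, hz]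
  have hr' : 0 < rePart (ρ * expAlg ψ) q := by
    rw [rePart_mul_expAlg]; exact mul_pos hr (Real.exp_pos _)
  have hreal : cj (ρ * expAlg ψ) = ρ * expAlg ψ := by rw [cj_mul, h.real, cj_expAlg]
  have hXn : ‖X‖ ≠ 0 := norm_ne_zero_iff.2 hX
  have hpos : 0 < powForm ρ ψ η (q, X) := by
    have h4 := h1 hr (((‖X‖⁻¹ : ℝ) : ℂ) • X) (by
      rw [norm_smul, Complex.norm_real, norm_inv, norm_norm, inv_mul_cancel₀ hXn])
    rw [powForm_smul] at h4
    exact pos_of_mul_pos_right h4 (sq_nonneg _)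
  rw [levi_rpow hreal hgerm hr', powForm_eq h.real hψ η hr]
  have h5 := Real.rpow_pos_of_pos hr' (η - 1 - 1)
  have h6 := Real.exp_pos (rePart ψ q)
  have h7 : 0 < η := by linarith
  positivity

end DefData

/-- On a pseudoconvex domain every defining function has a positive semidefinite Levi form. -/
theorem DefData.pseudoconvex (h : DefData Ω ρ₀ ρ W) (hbd : Bornology.IsBounded Ω)
    (hpsc : IsPseudoconvex Ω) :
    ∀ p ∈ frontier Ω, ∀ v, parA v ρ p = 0 → 0 ≤ (levA ρ v v p).re := by
  obtain ⟨V₁, ρ₁, hdef, hp₁⟩ := hpsc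
  obtain ⟨ρ₂, W₂, h₂⟩ := hdef.exists_defData h.isOpen hbd
  refine h.toBdryData.psc_transfer h₂.toBdryData fun p hp v hv => ?_
  rw [← h₂.levi_eq (h₂.germ hp)]
  exact hp₁ p hp v (by rw [h₂.dirDeriv_eq (h₂.germ hp), hv])

end Sufficiency

/-- Theorem 6.3: the Steinness index equals the infimum over all smooth
defining functions `ρ` of `η_ρ`, where the key inequality is only required at infinite type
boundary points. -/
theorem steinIndex_eq_iInf_etaRhoInf {n : ℕ} (hn : 2 ≤ n) (Ω : Set (Fin n → ℂ))
    (hΩ : IsOpen Ω) (hbd : Bornology.IsBounded Ω) (hpsc : IsPseudoconvex Ω)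
    (U : Set (Fin n → ℂ)) (hU : IsOpen U) (hfr : frontier Ω ⊆ U) :
    steinIndex Ω =
      ⨅ (V : Set (Fin n → ℂ)) (ρ : (Fin n → ℂ) → ℝ) (_ : IsDefFn Ω V ρ),
        etaRhoInf Ω U ρ := by
  refine le_antisymm ?_ ?_
  · refine le_iInf fun V => le_iInf fun ρ₀ => le_iInf fun hdef => le_sInf ?_
    rintro _ ⟨η₂, hη₂, rfl⟩
    obtain ⟨ρ, W, h⟩ := hdef.exists_defData hΩ hbd
    have hp := h.pseudoconvex hbd hpsc
    have hle : ∀ η, η₂ < η → steinIndex Ω ≤ ENNReal.ofReal η := fun η hη => by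
      obtain ⟨ρ', hdef', hmem⟩ := h.exists_mem_steinExpSet hdef hp hU hfr hη₂ hη
      have h1 : steinIndex Ω ≤ steinExp Ω ρ' :=
        iInf_le_of_le V (iInf_le_of_le ρ' (iInf_le_of_le hdef' le_rfl))
      exact h1.trans (sInf_le ⟨η, hmem, rfl⟩)
    have hlim : Filter.Tendsto ENNReal.ofReal (𝓝[>] η₂) (𝓝 (ENNReal.ofReal η₂)) :=
      (ENNReal.continuous_ofReal.tendsto η₂).mono_left nhdsWithin_le_nhds
    refine ge_of_tendsto hlim ?_
    filter_upwards [self_mem_nhdsWithin] with η hη using hle η hη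
  · refine le_iInf fun V => le_iInf fun ρ₀ => le_iInf fun hdef => ?_
    obtain ⟨ρ, W, h⟩ := hdef.exists_defData hΩ hbd
    have h1 : (⨅ (V : Set (Fin n → ℂ)) (ρ : (Fin n → ℂ) → ℝ) (_ : IsDefFn Ω V ρ),
        etaRhoInf Ω U ρ) ≤ etaRhoInf Ω U ρ₀ :=
      iInf_le_of_le V (iInf_le_of_le ρ₀ (iInf_le_of_le hdef le_rfl))
    refine h1.trans ?_
    exact sInf_le_sInf (Set.image_mono
      (h.steinExpSet_subset (h.pseudoconvex hbd hpsc) hU hfr))
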